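/- Let R ≥ 2 and let σ be a finite Borel measure supported in (−1/r, −r) ∪ (r, 1/r) such that 1 − σ_{−2} + ∫ dσ(t)/(t² + Et + 1) > 0 for every real E with |E| > R. Then there exists exactly one J ∈ M_R (a whole-line Jacobi matrix with ‖J‖ ≤ R, reflectionless on (−2,2)) whose F function satisfies F(λ) = −σ_{−1} + (1 − σ_{−2})λ + ∫ dσ(t)/(t − λ) for all λ ∈ ℂ⁺. -/

import Mathlib

open MeasureTheory Complex Filter Set

noncomputable section

/-- A Herglotz function: a holomorphic map from the open upper half plane to itself. -/
def IsHerglotz (m : ℂ → ℂ) : Prop :=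
  DifferentiableOn ℂ m {z : ℂ | 0 < z.im} ∧ ∀ z : ℂ, 0 < z.im → 0 < (m z).im

/-- `f` is a solution of the difference equation
`a_n f(n+1) + a_{n-1} f(n-1) + b_n f(n) = z f(n)` on `ℤ`. -/
def JacobiSolution (a b : ℤ → ℝ) (z : ℂ) (f : ℤ → ℂ) : Prop :=
  ∀ n : ℤ, (a n : ℂ) * f (n + 1) + (a (n - 1) : ℂ) * f (n - 1) + (b n : ℂ) * f n = z * f n

/-- `f : ℤ → ℂ` is square summable near `+∞`. -/
def SquareSummableAtTop (f : ℤ → ℂ) : Prop := Summable fun n : ℕ => ‖f (n : ℤ)‖ ^ 2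

/-- `f : ℤ → ℂ` is square summable near `-∞`. -/
def SquareSummableAtBot (f : ℤ → ℂ) : Prop := Summable fun n : ℕ => ‖f (-(n : ℤ))‖ ^ 2

/-- `m` is the half-line `m`-function `m₊` of the whole-line Jacobi matrix with
coefficients `a, b`: `m₊(z) = -f₊(1,z)/(a₀ f₊(0,z))`, where `f₊(·,z)` is a nontrivial
solution that is square summable near `+∞`. -/
def IsJacobiMPlus (a b : ℤ → ℝ) (m : ℂ → ℂ) : Prop :=
  ∀ z : ℂ, 0 < z.im → ∃ f : ℤ → ℂ, JacobiSolution a b z f ∧ SquareSummableAtTop f ∧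
    f 0 ≠ 0 ∧ m z = -(f 1 / ((a 0 : ℂ) * f 0))

/-- `m` is the half-line `m`-function `m₋` of the whole-line Jacobi matrix with
coefficients `a, b`: `m₋(z) = f₋(1,z)/(a₀ f₋(0,z))`, where `f₋(·,z)` is a nontrivial
solution that is square summable near `-∞`. -/
def IsJacobiMMinus (a b : ℤ → ℝ) (m : ℂ → ℂ) : Prop :=
  ∀ z : ℂ, 0 < z.im → ∃ f : ℤ → ℂ, JacobiSolution a b z f ∧ SquareSummableAtBot f ∧
    f 0 ≠ 0 ∧ m z = f 1 / ((a 0 : ℂ) * f 0)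

/-- The pair `(m₊, m₋)` is reflectionless on `(-2,2)`:
`m₊(x) = -conj(m₋(x))` for Lebesgue-a.e. `x ∈ (-2,2)` (boundary values). -/
def ReflectionlessOn22 (mp mm : ℂ → ℂ) : Prop :=
  ∀ᵐ x : ℝ, x ∈ Set.Ioo (-2:ℝ) 2 →
    Tendsto (fun y : ℝ => mp (↑x + ↑y * I) + starRingEnd ℂ (mm (↑x + ↑y * I)))
      (nhdsWithin 0 (Set.Ioi 0)) (nhds 0)

/-- The whole-line Jacobi matrix with coefficients `a, b` is reflectionless on `(-2,2)`. -/
def JacobiReflectionless (a b : ℤ → ℝ) : Prop :=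
  ∃ mp mm : ℂ → ℂ, IsJacobiMPlus a b mp ∧ IsJacobiMMinus a b mm ∧ ReflectionlessOn22 mp mm

/-- `T` is the bounded operator on `ℓ²(ℤ)` given by the Jacobi matrix with
coefficients `a, b`: `(Tu)_n = a_n u_{n+1} + a_{n-1} u_{n-1} + b_n u_n`. -/
def IsJacobiOperator (a b : ℤ → ℝ)
    (T : lp (fun _ : ℤ => ℂ) 2 →L[ℂ] lp (fun _ : ℤ => ℂ) 2) : Prop :=
  ∀ u : lp (fun _ : ℤ => ℂ) 2, ∀ n : ℤ,
    T u n = (a n : ℂ) * u (n + 1) + (a (n - 1) : ℂ) * u (n - 1) + (b n : ℂ) * u n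

/-- `J ∈ M_R`: the whole-line Jacobi matrix with coefficients `a, b` (with `a_n > 0`)
defines a bounded operator of norm `≤ R` and is reflectionless on `(-2,2)`. -/
def MemMR (R : ℝ) (a b : ℤ → ℝ) : Prop :=
  (∀ n : ℤ, 0 < a n) ∧
  (∃ T : lp (fun _ : ℤ => ℂ) 2 →L[ℂ] lp (fun _ : ℤ => ℂ) 2,
    IsJacobiOperator a b T ∧ ‖T‖ ≤ R) ∧
  JacobiReflectionless a b

/-- The domain `Ω = ℂ⁺ ∪ (-2,2) ∪ ℂ⁻`. -/
def Omega22 : Set ℂ := {z : ℂ | z.im ≠ 0 ∨ (-2 < z.re ∧ z.re < 2)}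

/-- `F` is the `F` function of the Jacobi matrix with coefficients `a, b`, reflectionless on
`(-2,2)`: `F(λ) = M(-λ - 1/λ)` on `ℂ⁺`, where `M : Ω → ℂ⁺` is the holomorphic continuation
of `m₊` to `Ω = ℂ⁺ ∪ (-2,2) ∪ ℂ⁻`. -/
def IsFFunction (a b : ℤ → ℝ) (F : ℂ → ℂ) : Prop :=
  ∃ mp M : ℂ → ℂ, IsJacobiMPlus a b mp ∧
    DifferentiableOn ℂ M Omega22 ∧
    (∀ z ∈ Omega22, 0 < (M z).im) ∧
    (∀ z : ℂ, 0 < z.im → M z = mp z) ∧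
    (∀ l : ℂ, 0 < l.im → F l = M (-l - 1/l))

lemma hp_normSq (z w : ℂ) : ‖z - (starRingEnd ℂ) w‖ ^ 2 = ‖z - w‖ ^ 2 + 4 * (z.im * w.im) := by
  rw [← Complex.normSq_eq_norm_sq, ← Complex.normSq_eq_norm_sq]
  simp [Complex.normSq_apply]
  ring

lemma hp_sub_conj_ne {z w : ℂ} (hz : 0 < z.im) (hw : 0 < w.im) : z - (starRingEnd ℂ) w ≠ 0 := by
  intro h
  have := congrArg Complex.im h
  simp at this
  linarith

lemma hp_norm_lt {z w : ℂ} (hz : 0 < z.im) (hw : 0 < w.im) :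
    ‖(z - w) / (z - (starRingEnd ℂ) w)‖ < 1 := by
  have h := hp_normSq z w
  have h2 := mul_pos hz hw
  rw [norm_div, div_lt_one (norm_pos_iff.2 (hp_sub_conj_ne hz hw))]
  exact lt_of_pow_lt_pow_left₀ 2 (norm_nonneg _) (by linarith)

lemma schwarz_pick {F : ℂ → ℂ} (hF : IsHerglotz F) {z w : ℂ} (hz : 0 < z.im) (hw : 0 < w.im) :
    ‖F z - F w‖ * ‖z - (starRingEnd ℂ) w‖ ≤ ‖z - w‖ * ‖F z - (starRingEnd ℂ) (F w)‖ := by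
  set G : ℂ → ℂ := fun ζ => (w - (starRingEnd ℂ) w * ζ) / (1 - ζ) with hG
  have hne : ∀ ζ : ℂ, ‖ζ‖ < 1 → 1 - ζ ≠ 0 := by
    intro ζ h h0
    have : ζ = 1 := by linear_combination -h0
    rw [this] at h; simp at h
  have hGim : ∀ ζ : ℂ, ‖ζ‖ < 1 → 0 < (G ζ).im := by
    intro ζ h
    have e : (G ζ).im = w.im * (1 - ‖ζ‖^2) / Complex.normSq (1 - ζ) := by
      rw [← Complex.normSq_eq_norm_sq]
      simp only [hG, Complex.div_im]
      simp [Complex.normSq_apply]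
      ring
    rw [e]
    have := Complex.normSq_pos.2 (hne ζ h)
    have h1 : ‖ζ‖^2 < 1 := by nlinarith [norm_nonneg ζ]
    exact div_pos (mul_pos hw (by linarith)) this
  set H : ℂ → ℂ := fun ζ => (F (G ζ) - F w) / (F (G ζ) - (starRingEnd ℂ) (F w)) with hH
  have hGd : DifferentiableOn ℂ G (Metric.ball 0 1) := by
    intro ζ h
    have := hne ζ (by simpa using h)
    apply DifferentiableAt.differentiableWithinAt
    simp only [hG]
    fun_prop (disch := assumption)
  have hFG : DifferentiableOn ℂ (fun ζ => F (G ζ)) (Metric.ball 0 1) :=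
    hF.1.comp hGd (fun ζ h => hGim ζ (by simpa using h))
  have hHd : DifferentiableOn ℂ H (Metric.ball 0 1) := by
    apply DifferentiableOn.div
    · exact hFG.sub_const _
    · exact hFG.sub_const _
    · intro ζ h
      exact hp_sub_conj_ne (hF.2 _ (hGim ζ (by simpa using h))) (hF.2 _ hw)
  have hmaps : MapsTo H (Metric.ball 0 1) (Metric.closedBall 0 1) := by
    intro ζ h
    have := hp_norm_lt (hF.2 _ (hGim ζ (by simpa using h))) (hF.2 _ hw)
    exact mem_closedBall_zero_iff.2 this.le
  have hH0 : H 0 = 0 := by simp [hH, hG]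
  have hcz := hp_sub_conj_ne hz hw
  have key := Complex.norm_le_norm_of_mapsTo_ball hHd hmaps hH0 (hp_norm_lt hz hw)
  have hGz : G ((z - w) / (z - (starRingEnd ℂ) w)) = z := by
    have h1 := hne _ (hp_norm_lt hz hw)
    simp only [hG]
    rw [div_eq_iff h1]
    field_simp
    ring
  simp only [hH, hGz, norm_div] at key
  have hcF := norm_pos_iff.2 (hp_sub_conj_ne (hF.2 _ hz) (hF.2 _ hw))
  rwa [div_le_div_iff₀ hcF (norm_pos_iff.2 hcz)] at key

lemma schwarz_pick' {F : ℂ → ℂ} (hF : IsHerglotz F) {z w : ℂ} (hz : 0 < z.im) (hw : 0 < w.im) :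
    z.im * w.im * ‖F z - (starRingEnd ℂ) (F w)‖^2 ≤
      (F z).im * (F w).im * ‖z - (starRingEnd ℂ) w‖^2 := by
  have h1 := schwarz_pick hF hz hw
  have h2 := pow_le_pow_left₀ (by positivity) h1 2
  rw [mul_pow, mul_pow, hp_normSq, hp_normSq] at h2
  rw [hp_normSq, hp_normSq]
  nlinarith

lemma julia {F : ℂ → ℂ} (hF : IsHerglotz F)
    (h0 : Tendsto (fun y : ℝ => F (y * I) / (y * I)) (nhdsWithin 0 (Ioi 0)) (nhds 1))
    {z : ℂ} (hz : 0 < z.im) : z.im * ‖F z‖^2 ≤ (F z).im * ‖z‖^2 := by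
  have hid : Tendsto (fun y : ℝ => (y * I : ℂ)) (nhdsWithin 0 (Ioi 0)) (nhds 0) := by
    have : Tendsto (fun y : ℝ => (y * I : ℂ)) (nhds 0) (nhds ((0:ℝ) * I)) :=
      Continuous.tendsto (by fun_prop) 0
    simp only [ofReal_zero, zero_mul] at this
    exact this.mono_left nhdsWithin_le_nhds
  have hpos : ∀ᶠ y : ℝ in nhdsWithin 0 (Ioi 0), 0 < y := eventually_mem_nhdsWithin
  have hF0 : Tendsto (fun y : ℝ => F (y * I)) (nhdsWithin 0 (Ioi 0)) (nhds 0) := by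
    have := h0.mul hid
    rw [one_mul] at this
    refine this.congr' ?_
    filter_upwards [hpos] with y hy
    have : (y * I : ℂ) ≠ 0 := by simp [hy.ne']
    exact div_mul_cancel₀ _ this
  have him : Tendsto (fun y : ℝ => (F (y * I)).im / y) (nhdsWithin 0 (Ioi 0)) (nhds 1) := by
    have := (Complex.continuous_re.tendsto _).comp h0
    rw [one_re] at this
    refine this.congr' ?_
    filter_upwards [hpos] with y hy
    simp [Complex.div_re, Complex.normSq_apply]
    field_simp
  have hl : Tendsto (fun y : ℝ => z.im * ‖F z - (starRingEnd ℂ) (F (y * I))‖^2)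
      (nhdsWithin 0 (Ioi 0)) (nhds (z.im * ‖F z - (starRingEnd ℂ) 0‖^2)) :=
    (((tendsto_const_nhds.sub ((Complex.continuous_conj.tendsto _).comp hF0)).norm).pow 2).const_mul _
  have hr : Tendsto (fun y : ℝ => (F z).im * ((F (y * I)).im / y) * ‖z - (starRingEnd ℂ) (y * I)‖^2)
      (nhdsWithin 0 (Ioi 0)) (nhds ((F z).im * 1 * ‖z - (starRingEnd ℂ) 0‖^2)) :=
    (him.const_mul _).mul
     (((tendsto_const_nhds.sub ((Complex.continuous_conj.tendsto _).comp hid)).norm).pow 2)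
  have := le_of_tendsto_of_tendsto hl hr (by
    filter_upwards [hpos] with y hy
    have h := schwarz_pick' hF hz (w := y * I) (by simpa using hy)
    have e : (y * I : ℂ).im = y := by simp
    rw [e] at h
    rw [mul_div_assoc', div_mul_eq_mul_div, le_div_iff₀ hy]
    linarith)
  simpa using this

lemma julia' {F : ℂ → ℂ} (hF : IsHerglotz F)
    (h0 : Tendsto (fun y : ℝ => F (y * I) / (y * I)) (nhdsWithin 0 (Ioi 0)) (nhds 1))
    {z : ℂ} (hz : 0 < z.im) : 0 ≤ (-1 / F z + 1 / z).im := by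
  have h := julia hF h0 hz
  have hz0 : z ≠ 0 := by rintro rfl; simp at hz
  have hFz := hF.2 z hz
  have hF0 : F z ≠ 0 := by intro h; rw [h] at hFz; simp at hFz
  have a1 := Complex.normSq_pos.2 hz0
  have a2 := Complex.normSq_pos.2 hF0
  have e : (-1 / F z + 1 / z).im = (F z).im / Complex.normSq (F z) - z.im / Complex.normSq z := by
    simp [Complex.div_im]
    ring
  rw [e, sub_nonneg, div_le_div_iff₀ a1 a2, Complex.normSq_eq_norm_sq, Complex.normSq_eq_norm_sq]
  exact h


/-- `F(l) = l g(l)` near `0` in the upper half plane, with `g` real analytic, `g(0) = 1`. -/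
def GoodAtZero (F : ℂ → ℂ) : Prop :=
  ∃ g : ℂ → ℂ, AnalyticAt ℂ g 0 ∧ g 0 = 1 ∧ (∀ᶠ x : ℝ in nhds 0, (g x).im = 0) ∧
    ∀ᶠ l : ℂ in nhds 0, 0 < l.im → F l = l * g l

/-- The reflected function. -/
def invF (α : ℝ) (F : ℂ → ℂ) : ℂ → ℂ := fun l => -(α : ℂ) / F (-1 / l)

structure FClass (F : ℂ → ℂ) (α : ℝ) : Prop where
  herg : IsHerglotz F
  pos : 0 < α
  good0 : GoodAtZero F
  goodInf : GoodAtZero (invF α F)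

/-- Coefficient stripping relation. -/
def StripRel (F : ℂ → ℂ) (F1 : ℂ → ℂ) (α1 b : ℝ) : Prop :=
  ∀ l : ℂ, 0 < l.im → -1 / F l = -l - 1 / l - b + F1 l / α1

lemma analytic_factor {h : ℂ → ℂ} (ha : AnalyticAt ℂ h 0)
    (hr : ∀ᶠ x : ℝ in nhds 0, (h x).im = 0) :
    ∃ p : ℂ → ℂ, AnalyticAt ℂ p 0 ∧ (∀ᶠ x : ℝ in nhds 0, (p x).im = 0) ∧
      ∀ l, h l = h 0 + l * p l := by
  refine ⟨dslope h 0, ?_, ?_, ?_⟩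
  · obtain ⟨s, hs⟩ := ha
    exact ⟨_, hs.has_fpower_series_dslope_fslope⟩
  · have ha' : AnalyticAt ℂ (dslope h 0) 0 := by
      obtain ⟨s, hs⟩ := ha
      exact ⟨_, hs.has_fpower_series_dslope_fslope⟩
    have h0 : (h 0).im = 0 := by simpa using hr.self_of_nhds
    have h1 : ∀ᶠ x : ℝ in nhds 0, x ≠ 0 → (dslope h 0 x).im = 0 := by
      filter_upwards [hr] with x hx hx0
      rw [dslope_of_ne _ (by exact_mod_cast hx0), slope_def_field]
      rw [sub_zero, Complex.div_ofReal_im]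
      simp [hx, h0]
    have h2 : (dslope h 0 ((0:ℝ):ℂ)).im = 0 := by
      have hc : Tendsto (fun x : ℝ => (dslope h 0 (x:ℂ)).im) (nhdsWithin 0 {0}ᶜ)
          (nhds ((dslope h 0 ((0:ℝ):ℂ)).im)) := by
        apply Tendsto.mono_left _ nhdsWithin_le_nhds
        apply (Complex.continuous_im.tendsto _).comp
        have : ContinuousAt (dslope h 0) ((0:ℝ):ℂ) := by simpa using ha'.continuousAt
        exact this.tendsto.comp (Complex.continuous_ofReal.tendsto 0)
      refine tendsto_nhds_unique hc (tendsto_const_nhds.congr' ?_)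
      have : ∀ᶠ x : ℝ in nhdsWithin 0 {0}ᶜ, x ≠ 0 := eventually_mem_nhdsWithin
      filter_upwards [this, h1.filter_mono nhdsWithin_le_nhds] with x a b
      exact (b a).symm
    filter_upwards [h1] with x hx
    by_cases h : x = 0
    · rw [h]; exact h2
    · exact hx h
  · intro l
    have := sub_smul_dslope h 0 l
    simp only [sub_zero, smul_eq_mul] at this
    rw [this]; ring

lemma tendsto_mulI : Tendsto (fun y : ℝ => (y * I : ℂ)) (nhdsWithin 0 (Ioi 0)) (nhds 0) := by
  have : Tendsto (fun y : ℝ => (y * I : ℂ)) (nhds 0) (nhds ((0:ℝ) * I)) :=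
    Continuous.tendsto (by fun_prop) 0
  simp only [ofReal_zero, zero_mul] at this
  exact this.mono_left nhdsWithin_le_nhds

lemma evpos : ∀ᶠ y : ℝ in nhdsWithin 0 (Ioi 0), 0 < y := eventually_mem_nhdsWithin

lemma GoodAtZero.tendsto {F : ℂ → ℂ} (h : GoodAtZero F) :
    Tendsto (fun y : ℝ => F (y * I) / (y * I)) (nhdsWithin 0 (Ioi 0)) (nhds 1) := by
  obtain ⟨g, ga, g1, -, hg⟩ := h
  have h1 := ga.continuousAt.tendsto.comp tendsto_mulI
  rw [g1] at h1
  refine h1.congr' ?_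
  filter_upwards [evpos, tendsto_mulI.eventually hg] with y hy h
  have h0 : (y * I : ℂ) ≠ 0 := by simp [hy.ne']
  rw [h (by simpa using hy), mul_div_cancel_left₀ _ h0]; rfl

lemma GoodAtZero.tendsto0 {F : ℂ → ℂ} (h : GoodAtZero F) :
    Tendsto (fun y : ℝ => F (y * I)) (nhdsWithin 0 (Ioi 0)) (nhds 0) := by
  have := h.tendsto.mul tendsto_mulI
  rw [one_mul] at this
  refine this.congr' ?_
  filter_upwards [evpos] with y hy
  have : (y * I : ℂ) ≠ 0 := by simp [hy.ne']
  exact div_mul_cancel₀ _ this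

lemma neg_inv_im {l : ℂ} (hl : 0 < l.im) : 0 < (-1 / l).im := by
  have hz0 : l ≠ 0 := by rintro rfl; simp at hl
  have a1 := Complex.normSq_pos.2 hz0
  have : (-1 / l).im = l.im / Complex.normSq l := by
    simp [Complex.div_im]; ring
  rw [this]; positivity

lemma ne_zero_of_im_pos {l : ℂ} (hl : 0 < l.im) : l ≠ 0 := by rintro rfl; simp at hl

lemma invF_invF {α : ℝ} (hα : α ≠ 0) (F : ℂ → ℂ) : invF α (invF α F) = F := by
  funext l
  have h : (-1 : ℂ) / (-1 / l) = l := by simp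
  have hα' : (α : ℂ) ≠ 0 := by exact_mod_cast hα
  simp only [invF, h]
  by_cases hF : F l = 0
  · simp [hF]
  · field_simp

lemma FClass.inv {F : ℂ → ℂ} {α : ℝ} (h : FClass F α) : FClass (invF α F) α := by
  refine ⟨⟨?_, ?_⟩, h.pos, h.goodInf, ?_⟩
  · intro l hl
    have hl' : 0 < l.im := hl
    have h0 := ne_zero_of_im_pos hl'
    have him := neg_inv_im hl'
    have hF := h.herg.2 _ him
    have hd : DifferentiableAt ℂ F (-1 / l) :=
      (h.herg.1 _ him).differentiableAt ((isOpen_lt continuous_const Complex.continuous_im).mem_nhds him)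
    apply DifferentiableAt.differentiableWithinAt
    have : DifferentiableAt ℂ (fun l : ℂ => F (-1 / l)) l := by
      apply DifferentiableAt.comp (f := fun l : ℂ => -1 / l) (g := F) l hd
      fun_prop (disch := assumption)
    exact (differentiableAt_const _).div this (ne_zero_of_im_pos hF)
  · intro l hl
    have hF := neg_inv_im (h.herg.2 _ (neg_inv_im hl))
    have e : invF α F l = (α : ℂ) * (-1 / F (-1 / l)) := by simp only [invF]; ring
    rw [e, Complex.im_ofReal_mul]
    exact mul_pos h.pos hF
  · rw [invF_invF h.pos.ne']; exact h.good0

lemma strip_exists {F : ℂ → ℂ} {α : ℝ} (h : FClass F α) :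
    ∃ F1 : ℂ → ℂ, ∃ α1 b : ℝ, FClass F1 α1 ∧ StripRel F F1 α1 b := by
  have hju := fun l hl => julia' h.herg h.good0.tendsto (z := l) hl
  obtain ⟨g, ga, g1, gr, hg⟩ := h.good0
  have gia : AnalyticAt ℂ (fun l => (g l)⁻¹) 0 := ga.inv (by simp [g1])
  obtain ⟨p, pa, pr, hp⟩ := analytic_factor gia (by
    filter_upwards [gr] with x hx
    simp [Complex.inv_im, hx])
  obtain ⟨q, qa, qr, hq⟩ := analytic_factor pa pr
  simp only [g1, inv_one] at hp
  set b : ℝ := (p 0).re with hb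
  have pb : p 0 = b := by
    apply Complex.ext <;> simp [hb]
    simpa using pr.self_of_nhds
  set A : ℝ := 1 - (q 0).re with hA
  have qA : 1 - q 0 = A := by
    apply Complex.ext <;> simp [hA]
    simpa using qr.self_of_nhds
  set N : ℂ → ℂ := fun l => -1 / F l + l + 1 / l + b with hN
  have hNl : ∀ᶠ l : ℂ in nhds 0, 0 < l.im → N l = l * (1 - q l) := by
    filter_upwards [hg] with l hl him
    have l0 := ne_zero_of_im_pos him
    have e : -1 / F l = - (1 / l) * (g l)⁻¹ := by
      rw [hl him]; field_simp
    simp only [hN]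
    rw [e, hp l, hq l, pb]
    field_simp
    ring
  have hNim : ∀ l : ℂ, 0 < l.im → l.im ≤ (N l).im := by
    intro l hl
    have := hju l hl
    simp only [hN]
    simp only [Complex.add_im, Complex.ofReal_im] at this ⊢
    linarith
  have hA1 : 1 ≤ A := by
    have hc : Tendsto (fun y : ℝ => (1 - q (y * I)).re) (nhdsWithin 0 (Ioi 0)) (nhds A) := by
      have := qa.continuousAt.tendsto.comp tendsto_mulI
      have := (Complex.continuous_re.tendsto _).comp (this.const_sub 1)
      rw [qA] at this
      exact this
    refine ge_of_tendsto hc ?_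
    filter_upwards [evpos, tendsto_mulI.eventually hNl] with y hy h
    have hy' : 0 < (y * I : ℂ).im := by simpa using hy
    have h1 := hNim _ hy'
    rw [h hy'] at h1
    have e1 : (y * I : ℂ).im = y := by simp
    have e2 : (y * I * (1 - q (y * I)) : ℂ).im = y * (1 - q (y * I)).re := by
      rw [mul_assoc, Complex.im_ofReal_mul]; simp
    rw [e1, e2] at h1
    nlinarith
  have hA0 : (A : ℂ) ≠ 0 := by
    have : A ≠ 0 := by linarith
    exact_mod_cast this
  refine ⟨fun l => (A⁻¹ : ℝ) * N l, A⁻¹, b, ⟨⟨?_, ?_⟩, by positivity, ?_, ?_⟩, ?_⟩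
  · apply DifferentiableOn.const_mul
    intro l hl
    have hl' : 0 < l.im := hl
    have l0 := ne_zero_of_im_pos hl'
    have hd := h.herg.1 l hl
    have F0 := ne_zero_of_im_pos (h.herg.2 l hl')
    simp only [hN]
    refine DifferentiableWithinAt.add_const _ (DifferentiableWithinAt.add
      (DifferentiableWithinAt.add ?_ differentiableWithinAt_id) ?_)
    · exact (differentiableWithinAt_const _).div hd F0
    · exact (differentiableWithinAt_const _).div differentiableWithinAt_id l0
  · intro l hl
    rw [Complex.im_ofReal_mul]
    have := hNim l hl
    have : 0 < A⁻¹ := by positivity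
    nlinarith [mul_pos this hl]
  · refine ⟨fun l => (A⁻¹ : ℝ) * (1 - q l), ?_, ?_, ?_, ?_⟩
    · exact analyticAt_const.mul (analyticAt_const.sub qa)
    · simp only []
      rw [qA]; push_cast; field_simp
    · filter_upwards [qr] with x hx
      rw [Complex.im_ofReal_mul]; simp [hx]
    · filter_upwards [hNl] with l hl him
      rw [hl him]; ring
  · obtain ⟨gs, gsa, gs1, gsr, hgs⟩ := h.goodInf
    refine ⟨fun l => (1 + l^2 - b * l - l^2 * gs l / α)⁻¹, ?_, ?_, ?_, ?_⟩
    · apply AnalyticAt.inv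
      · have : AnalyticAt ℂ (fun l : ℂ => l) 0 := analyticAt_id
        have hα : (α : ℂ) ≠ 0 := by exact_mod_cast h.pos.ne'
        fun_prop (disch := assumption)
      · simp
    · simp
    · filter_upwards [gsr] with x hx
      have e : (gs x) = ((gs x).re : ℝ) := by apply Complex.ext <;> simp [hx]
      rw [e]
      norm_cast
    · filter_upwards [hgs] with l hl him
      have l0 := ne_zero_of_im_pos him
      have hα : (α : ℂ) ≠ 0 := by exact_mod_cast h.pos.ne'
      have e := hl him
      simp only [invF] at e ⊢
      have e2 : -1 / F (-1 / l) = l * gs l / α := by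
        rw [← e]; field_simp
      simp only [hN]
      rw [e2]
      have e3 : (1 : ℂ) / (-1 / l) = -l := by rw [one_div_div]; ring
      rw [e3]
      push_cast
      have e4 : l * gs l / α + -1 / l + -l + b =
        - (l⁻¹ * (1 + l^2 - b * l - l^2 * gs l / α)) := by
        field_simp
        ring
      rw [e4, neg_div, mul_neg, div_neg, neg_neg]
      have : (A:ℂ)⁻¹ ≠ 0 := inv_ne_zero hA0
      rw [div_mul_eq_div_div, div_self this, one_div, mul_inv, inv_inv]
  · intro l hl
    have : ((A⁻¹ : ℝ) : ℂ) ≠ 0 := by push_cast; exact inv_ne_zero hA0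
    simp only [hN]
    rw [mul_div_cancel_left₀ _ this]
    ring

lemma StripRel.inv {F F1 : ℂ → ℂ} {α α1 b : ℝ} (h : FClass F α) (h1 : FClass F1 α1)
    (hs : StripRel F F1 α1 b) : StripRel (invF α1 F1) (invF α F) α (-b) := by
  intro l hl
  have him := neg_inv_im hl
  have e := hs _ him
  have l0 := ne_zero_of_im_pos hl
  have F0 := ne_zero_of_im_pos (h.herg.2 _ him)
  have F10 := ne_zero_of_im_pos (h1.herg.2 _ him)
  have hα : (α : ℂ) ≠ 0 := by exact_mod_cast h.pos.ne'
  have hα1 : (α1 : ℂ) ≠ 0 := by exact_mod_cast h1.pos.ne'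
  simp only [invF]
  have e3 : (1 : ℂ) / (-1 / l) = -l := by rw [one_div_div]; ring
  have e5 : -(-1 / l) = 1 / l := by ring
  rw [e3, e5] at e
  have e6 : -(α : ℂ) / F (-1 / l) / α = -1 / F (-1 / l) := by field_simp
  have e7 : -1 / (-(α1 : ℂ) / F1 (-1 / l)) = F1 (-1 / l) / α1 := by
    field_simp
  rw [e6, e7, e]
  push_cast
  ring

lemma strip_exists_back {F1 : ℂ → ℂ} {α1 : ℝ} (h : FClass F1 α1) :
    ∃ F : ℂ → ℂ, ∃ α b : ℝ, FClass F α ∧ StripRel F F1 α1 b := by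
  obtain ⟨G, β, b, hG, hs⟩ := strip_exists h.inv
  refine ⟨invF β G, β, -b, hG.inv, ?_⟩
  have := StripRel.inv h.inv hG hs
  rwa [invF_invF h.pos.ne'] at this


lemma int_seq {X : Type*} (Rl : ℤ → X → X → Prop) (hf : ∀ n x, ∃ y, Rl n x y)
    (hb : ∀ n y, ∃ x, Rl n x y) (x0 : X) : ∃ s : ℤ → X, s 0 = x0 ∧ ∀ n, Rl n (s n) (s (n + 1)) := by
  choose fw hfw using hf
  choose bw hbw using hb
  let p : ℕ → X := fun n => Nat.rec x0 (fun k x => fw k x) n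
  let q : ℕ → X := fun n => Nat.rec x0 (fun k x => bw (Int.negSucc k) x) n
  refine ⟨fun n => match n with
    | Int.ofNat k => p k
    | Int.negSucc k => q (k + 1), rfl, ?_⟩
  intro n
  match n with
  | Int.ofNat k => exact hfw k (p k)
  | Int.negSucc 0 => exact hbw (Int.negSucc 0) x0
  | Int.negSucc (k + 1) =>
    have e : (Int.negSucc (k+1) + 1 : ℤ) = Int.negSucc k := by
      simp [Int.negSucc_eq]
    rw [e]
    exact hbw (Int.negSucc (k+1)) (q (k + 1))

lemma strip_seq {F : ℂ → ℂ} {α : ℝ} (h : FClass F α) :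
    ∃ (Fs : ℤ → ℂ → ℂ) (αs bs : ℤ → ℝ), Fs 0 = F ∧ αs 0 = α ∧ (∀ n, FClass (Fs n) (αs n)) ∧
      ∀ n, StripRel (Fs n) (Fs (n + 1)) (αs (n + 1)) (bs (n + 1)) := by
  let X := {p : (ℂ → ℂ) × ℝ // FClass p.1 p.2}
  obtain ⟨s, s0, hs⟩ := int_seq (X := X)
    (fun _ x y => ∃ b : ℝ, StripRel x.1.1 y.1.1 y.1.2 b)
    (fun _ x => by
      obtain ⟨F1, α1, b, h1, h2⟩ := strip_exists x.2
      exact ⟨⟨(F1, α1), h1⟩, b, h2⟩)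
    (fun _ x => by
      obtain ⟨F1, α1, b, h1, h2⟩ := strip_exists_back x.2
      exact ⟨⟨(F1, α1), h1⟩, b, h2⟩) ⟨(F, α), h⟩
  choose b hb using hs
  refine ⟨fun n => (s n).1.1, fun n => (s n).1.2, fun n => b (n - 1), by simp [s0], by simp [s0],
    fun n => (s n).2, fun n => ?_⟩
  simp only [add_sub_cancel_right]
  exact hb n

lemma ratio_seq (c : ℤ → ℂ) (hc : ∀ n, c n ≠ 0) : ∃ f : ℤ → ℂ, f 0 = 1 ∧ (∀ n, f n ≠ 0) ∧
    ∀ n, f (n + 1) = c n * f n := by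
  let X := {x : ℂ // x ≠ 0}
  obtain ⟨s, s0, hs⟩ := int_seq (X := X) (fun n x y => y.1 = c n * x.1)
    (fun n x => ⟨⟨c n * x.1, mul_ne_zero (hc n) x.2⟩, rfl⟩)
    (fun n x => ⟨⟨(c n)⁻¹ * x.1, mul_ne_zero (inv_ne_zero (hc n)) x.2⟩, by
      simp only []; rw [mul_inv_cancel_left₀ (hc n)]⟩) ⟨1, one_ne_zero⟩
  exact ⟨fun n => (s n).1, by simp [s0], fun n => (s n).2, hs⟩

lemma wronsk_im {a b : ℤ → ℝ} {z : ℂ} {f : ℤ → ℂ} (hf : JacobiSolution a b z f) (n : ℤ) :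
    a n * ((starRingEnd ℂ) (f n) * f (n + 1)).im =
      a (n - 1) * ((starRingEnd ℂ) (f (n - 1)) * f n).im + z.im * ‖f n‖ ^ 2 := by
  have h := congrArg (fun w => ((starRingEnd ℂ) (f n) * w).im) (hf n)
  rw [← Complex.normSq_eq_norm_sq, Complex.normSq_apply]
  simp at h ⊢
  linarith

lemma JacobiSolution.conj {a b : ℤ → ℝ} {z : ℂ} {f : ℤ → ℂ} (hf : JacobiSolution a b z f) :
    JacobiSolution a b ((starRingEnd ℂ) z) (fun n => (starRingEnd ℂ) (f n)) := by
  intro n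
  have h := congrArg (starRingEnd ℂ) (hf n)
  simpa using h

lemma ssq_top {a b : ℤ → ℝ} {z : ℂ} {f : ℤ → ℂ} (hf : JacobiSolution a b z f) (hz : 0 < z.im)
    (hW : ∀ n, a n * ((starRingEnd ℂ) (f n) * f (n + 1)).im ≤ 0) : SquareSummableAtTop f := by
  set W : ℤ → ℝ := fun n => a n * ((starRingEnd ℂ) (f n) * f (n + 1)).im with hWd
  have hW' : ∀ n, W n = W (n - 1) + z.im * ‖f n‖ ^ 2 := by
    intro n
    have := wronsk_im hf n
    simp only [hWd, sub_add_cancel]; exact this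
  refine summable_of_sum_range_le (c := -W (-1) / z.im) (fun n => by positivity) (fun N => ?_)
  have : z.im * ∑ i ∈ Finset.range N, ‖f (i : ℤ)‖ ^ 2 = W (N - 1) - W (-1) := by
    induction N with
    | zero => simp
    | succ k ih =>
      rw [Finset.sum_range_succ, mul_add, ih]
      have := hW' k
      push_cast
      simp only [add_sub_cancel_right]
      linarith
  rw [le_div_iff₀ hz, mul_comm, this]
  have := hW (N - 1)
  linarith

lemma ssq_bot {a b : ℤ → ℝ} {z : ℂ} {f : ℤ → ℂ} (hf : JacobiSolution a b z f) (hz : z.im < 0)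
    (hW : ∀ n, a n * ((starRingEnd ℂ) (f n) * f (n + 1)).im ≤ 0) : SquareSummableAtBot f := by
  set W : ℤ → ℝ := fun n => a n * ((starRingEnd ℂ) (f n) * f (n + 1)).im with hWd
  have hW' : ∀ n, W n = W (n - 1) + z.im * ‖f n‖ ^ 2 := by
    intro n
    have := wronsk_im hf n
    simp only [hWd, sub_add_cancel]; exact this
  refine summable_of_sum_range_le (c := -W 0 / (-z.im)) (fun n => by positivity) (fun N => ?_)
  have : z.im * ∑ i ∈ Finset.range N, ‖f (-(i : ℤ))‖ ^ 2 = W 0 - W (-(N:ℤ)) := by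
    induction N with
    | zero => simp
    | succ k ih =>
      rw [Finset.sum_range_succ, mul_add, ih]
      have := hW' (-k)
      push_cast
      have e : -((k:ℤ) + 1) = -k - 1 := by ring
      rw [e]
      linarith
  rw [le_div_iff₀ (by linarith)]
  have := hW (-(N:ℤ))
  simp only [hWd] at *
  linarith

/-- Data of a full stripped family. -/
structure Family (Fs : ℤ → ℂ → ℂ) (a b : ℤ → ℝ) : Prop where
  apos : ∀ n, 0 < a n
  herg : ∀ n, IsHerglotz (Fs n)
  strip : ∀ n l, 0 < l.im → -1 / Fs (n - 1) l = -l - 1 / l - b n + (a n : ℂ)^2 * Fs n l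
  lim0 : ∀ n, Tendsto (fun y : ℝ => Fs n (y * I)) (nhdsWithin 0 (Ioi 0)) (nhds 0)
  limInf : ∀ n, Tendsto (fun y : ℝ => (Fs n ((y⁻¹ : ℝ) * I))⁻¹) (nhdsWithin 0 (Ioi 0)) (nhds 0)

lemma family_exists {F : ℂ → ℂ} {α : ℝ} (h : FClass F α) :
    ∃ Fs a b, Fs 0 = F ∧ (a 0)^2 = α⁻¹ ∧ Family Fs a b := by
  obtain ⟨Fs, αs, b, F0, α0, hc, hs⟩ := strip_seq h
  have hpos := fun n => (hc n).pos
  have hsq : ∀ n, (Real.sqrt (αs n)⁻¹)^2 = (αs n)⁻¹ := fun n => Real.sq_sqrt (by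
    have := hpos n; positivity)
  refine ⟨Fs, fun n => Real.sqrt (αs n)⁻¹, b, F0, by rw [hsq, α0], ?_, fun n => (hc n).herg, ?_,
    fun n => (hc n).good0.tendsto0, ?_⟩
  · intro n
    have := hpos n
    positivity
  · intro n l hl
    have := hs (n - 1) l hl
    rw [sub_add_cancel] at this
    rw [this]
    norm_cast
    rw [hsq]
    push_cast
    ring
  · intro n
    have h1 := (hc n).goodInf.tendsto0
    have h2 := h1.const_mul (-((αs n)⁻¹ : ℂ))
    rw [mul_zero] at h2
    refine h2.congr' ?_
    filter_upwards [evpos] with y hy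
    have hα : (αs n : ℂ) ≠ 0 := by exact_mod_cast (hpos n).ne'
    simp only [invF]
    have e : (-1 : ℂ) / (y * I) = (y⁻¹ : ℝ) * I := by
      have hy' : (y : ℂ) ≠ 0 := by exact_mod_cast hy.ne'
      push_cast
      field_simp
      simp
    rw [e]
    field_simp

lemma Family.sol {Fs : ℤ → ℂ → ℂ} {a b : ℤ → ℝ} (h : Family Fs a b) {l : ℂ} (hl : 0 < l.im) :
    ∃ f : ℤ → ℂ, f 0 = 1 ∧ (∀ n, f n ≠ 0) ∧ (∀ n, f (n + 1) = -(a n * Fs n l) * f n) ∧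
      JacobiSolution a b (-l - 1 / l) f ∧ 
      (∀ n, a n * ((starRingEnd ℂ) (f n) * f (n + 1)).im ≤ 0) := by
  have hF := fun n => (h.herg n).2 l hl
  have hF0 := fun n => ne_zero_of_im_pos (hF n)
  have ha : ∀ n, (a n : ℂ) ≠ 0 := fun n => by exact_mod_cast (h.apos n).ne'
  obtain ⟨f, f0, fn, hf⟩ := ratio_seq (fun n => -(a n * Fs n l))
    (fun n => neg_ne_zero.2 (mul_ne_zero (ha n) (hF0 n)))
  refine ⟨f, f0, fn, hf, ?_, ?_⟩
  · intro n
    have h1 := hf n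
    have h2 := hf (n - 1)
    rw [sub_add_cancel] at h2
    have h3 := h.strip n l hl
    have h4 : (a (n-1) : ℂ) * f (n - 1) = (-1 / Fs (n - 1) l) * f n := by
      rw [h2]
      have := hF0 (n - 1)
      field_simp
    rw [h1, h4, h3]
    ring
  · intro n
    have e : ((starRingEnd ℂ) (f n) * f (n + 1)) = -((a n * ‖f n‖^2 : ℝ) * Fs n l) := by
      rw [hf n]
      push_cast
      rw [← Complex.conj_mul']
      ring
    rw [e, neg_im, Complex.im_ofReal_mul]
    have := h.apos n
    have := hF n
    have : 0 ≤ a n * (a n * ‖f n‖^2 * (Fs n l).im) := by positivity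
    linarith

/-- The inverse of `l ↦ -l - 1/l` with values in the upper half plane. -/
def lamU (z : ℂ) : ℂ := (-z + I * exp (log (4 - z ^ 2) / 2)) / 2

lemma slit_of_omega {z : ℂ} (hz : z ∈ Omega22) : 4 - z ^ 2 ∈ slitPlane := by
  rw [Complex.mem_slitPlane_iff]
  simp only [Omega22, mem_ofPred_eq] at hz
  by_contra hcon
  push Not at hcon
  obtain ⟨h1, h2⟩ := hcon
  simp [pow_two] at h1 h2
  have h3 : z.re * z.im = 0 := by linarith
  rcases mul_eq_zero.1 h3 with h | h
  · rw [h] at h1; nlinarith [sq_nonneg z.im]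
  · rcases hz with h' | h'
    · exact h' h
    · rw [h] at h1; nlinarith

lemma half_sq_re {w : ℂ} (hw : w ∈ slitPlane) : 0 < (exp (log w / 2)).re := by
  rw [Complex.exp_re]
  apply mul_pos (Real.exp_pos _)
  apply Real.cos_pos_of_mem_Ioo
  have h1 := Complex.neg_pi_lt_arg w
  have h2 := Complex.arg_le_pi w
  have h3 : w.arg ≠ Real.pi := Complex.slitPlane_arg_ne_pi hw
  have h4 : w.arg < Real.pi := lt_of_le_of_ne h2 h3
  simp [Complex.log_im]
  constructor <;> linarith

lemma half_sq {w : ℂ} (hw : w ≠ 0) : exp (log w / 2) ^ 2 = w := by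
  rw [← Complex.exp_nat_mul]
  push_cast
  rw [mul_div_cancel₀ _ two_ne_zero, Complex.exp_log hw]

lemma lamU_eq {z : ℂ} (hz : z ∈ Omega22) : lamU z * lamU z + z * lamU z + 1 = 0 := by
  have hs := half_sq (slitPlane_ne_zero (slit_of_omega hz))
  simp only [lamU]
  linear_combination (1/4 : ℂ) * (I^2 * hs + (4 - z^2) * Complex.I_sq)

lemma lamU_im {z : ℂ} (hz : z ∈ Omega22) : 0 < (lamU z).im := by
  have hs := half_sq (slitPlane_ne_zero (slit_of_omega hz))
  have hp := half_sq_re (slit_of_omega hz)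
  set s := exp (log (4 - z ^ 2) / 2)
  have e1 : lamU z = (-z + I * s) / 2 := rfl
  set m := (-z - I * s) / 2 with hm
  have e2 : lamU z * m = 1 := by
    rw [e1, hm]
    linear_combination (-1/4 : ℂ) * (I^2 * hs + (4 - z^2) * Complex.I_sq)
  have e3 : (lamU z).im - m.im = s.re := by
    rw [e1, hm]; simp
    ring
  have h0 : lamU z ≠ 0 := left_ne_zero_of_mul_eq_one e2
  have e4 : m = (lamU z)⁻¹ := eq_inv_of_mul_eq_one_right e2
  have hn := Complex.normSq_pos.2 h0
  by_contra hcon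
  push Not at hcon
  have : 0 ≤ m.im := by
    rw [e4, Complex.inv_im]
    apply div_nonneg _ hn.le
    linarith
  linarith

lemma lamU_phi {z : ℂ} (hz : z ∈ Omega22) : -lamU z - 1 / lamU z = z := by
  have h := lamU_eq hz
  have h0 := ne_zero_of_im_pos (lamU_im hz)
  field_simp
  linear_combination -h

lemma phi_mem {l : ℂ} (hl : 0 < l.im) : -l - 1 / l ∈ Omega22 := by
  have h0 := ne_zero_of_im_pos hl
  have hn := Complex.normSq_pos.2 h0
  simp only [Omega22, mem_ofPred_eq]
  by_cases h : normSq l = 1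
  · right
    have e : (-l - 1 / l).re = -2 * l.re := by
      simp [h]; ring
    rw [e]
    rw [normSq_apply] at h
    constructor <;> nlinarith
  · left
    have e : (-l - 1 / l).im = l.im / normSq l * (1 - normSq l) := by
      simp [Complex.inv_im]
      field_simp
      ring
    rw [e]
    have : 1 - normSq l ≠ 0 := fun h' => h (by linarith)
    exact mul_ne_zero (by positivity) this

lemma phi_inj {l m : ℂ} (hl : 0 < l.im) (hm : 0 < m.im) (h : -l - 1 / l = -m - 1 / m) : l = m := by
  have l0 := ne_zero_of_im_pos hl
  have m0 := ne_zero_of_im_pos hm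
  field_simp at h
  have h2 : (l - m) * (l * m - 1) = 0 := by linear_combination -h
  rcases mul_eq_zero.1 h2 with h3 | h3
  · linear_combination h3
  · exfalso
    have e : m = l⁻¹ := eq_inv_of_mul_eq_one_right (by linear_combination h3)
    rw [e, Complex.inv_im] at hm
    have hn := Complex.normSq_pos.2 l0
    have : 0 < l.im / normSq l := by positivity
    have e : -l.im / normSq l = -(l.im / normSq l) := by ring
    linarith

lemma lamU_of_phi {l : ℂ} (hl : 0 < l.im) : lamU (-l - 1 / l) = l :=
  phi_inj (lamU_im (phi_mem hl)) hl (lamU_phi (phi_mem hl))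

lemma lamU_diff : DifferentiableOn ℂ lamU Omega22 := by
  intro z hz
  have := slit_of_omega hz
  apply DifferentiableAt.differentiableWithinAt
  unfold lamU
  have h1 : DifferentiableAt ℂ (fun z : ℂ => log (4 - z^2)) z :=
    DifferentiableAt.clog (by fun_prop) this
  fun_prop

lemma omega_open : IsOpen Omega22 := by
  have h1 : IsOpen {z : ℂ | z.im ≠ 0} := isOpen_ne_fun Complex.continuous_im continuous_const
  have h2 : IsOpen {z : ℂ | -2 < z.re ∧ z.re < 2} :=
    (isOpen_lt continuous_const Complex.continuous_re).inter
      (isOpen_lt Complex.continuous_re continuous_const)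
  exact h1.union h2

lemma omega_of_im {z : ℂ} (h : z.im ≠ 0) : z ∈ Omega22 := Or.inl h

lemma omega_conj {z : ℂ} (h : z ∈ Omega22) : (starRingEnd ℂ) z ∈ Omega22 := by
  simpa [Omega22] using h


section
variable {Fs : ℤ → ℂ → ℂ} {a b : ℤ → ℝ}

lemma Family.mplus (h : Family Fs a b) : IsJacobiMPlus a b (fun z => Fs 0 (lamU z)) := by
  intro z hz
  have hO := omega_of_im hz.ne'
  obtain ⟨f, f0, fn, hf, hs, hW⟩ := h.sol (lamU_im hO)
  rw [lamU_phi hO] at hs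
  refine ⟨f, hs, ssq_top hs hz hW, fn 0, ?_⟩
  have h1 := hf 0
  rw [zero_add] at h1
  have ha : (a 0 : ℂ) ≠ 0 := by exact_mod_cast (h.apos 0).ne'
  rw [h1, f0]
  field_simp

lemma Family.mminus (h : Family Fs a b) :
    IsJacobiMMinus a b (fun z => -(starRingEnd ℂ) (Fs 0 (lamU ((starRingEnd ℂ) z)))) := by
  intro z hz
  have hO := omega_conj (omega_of_im hz.ne')
  obtain ⟨f, f0, fn, hf, hs, hW⟩ := h.sol (lamU_im hO)
  rw [lamU_phi hO] at hs
  have hb := ssq_bot hs (by simpa using hz) hW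
  have hs' := hs.conj
  rw [Complex.conj_conj] at hs'
  refine ⟨_, hs', ?_, ?_, ?_⟩
  · simpa [SquareSummableAtBot] using hb
  · simp [f0]
  have h1 := hf 0
  rw [zero_add] at h1
  have ha : (a 0 : ℂ) ≠ 0 := by exact_mod_cast (h.apos 0).ne'
  simp only [h1, f0]
  simp
  field_simp

lemma Family.Mdiff (h : Family Fs a b) :
    DifferentiableOn ℂ (fun z => Fs 0 (lamU z)) Omega22 :=
  (h.herg 0).1.comp lamU_diff (fun _ hz => lamU_im hz)

lemma Family.refl (h : Family Fs a b) : JacobiReflectionless a b := by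
  refine ⟨_, _, h.mplus, h.mminus, ?_⟩
  refine Eventually.of_forall (fun x hx => ?_)
  have hO : (x : ℂ) ∈ Omega22 := Or.inr (by simpa using hx)
  have hc : ContinuousAt (fun z => Fs 0 (lamU z)) (x : ℂ) :=
    (h.Mdiff.differentiableAt (omega_open.mem_nhds hO)).continuousAt
  have t1 : Tendsto (fun y : ℝ => (x + y * I : ℂ)) (nhdsWithin 0 (Ioi 0)) (nhds x) := by
    have := tendsto_mulI.const_add (x : ℂ)
    rwa [add_zero] at this
  have t2 : Tendsto (fun y : ℝ => (starRingEnd ℂ) (x + y * I : ℂ)) (nhdsWithin 0 (Ioi 0)) (nhds x) := by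
    have := (Complex.continuous_conj.tendsto _).comp t1
    rwa [Complex.conj_ofReal] at this
  have := (hc.tendsto.comp t1).sub (hc.tendsto.comp t2)
  rw [sub_self] at this
  refine this.congr (fun y => ?_)
  simp [sub_eq_add_neg]

lemma Family.isF (h : Family Fs a b) : IsFFunction a b (Fs 0) := by
  refine ⟨_, _, h.mplus, h.Mdiff, fun z hz => (h.herg 0).2 _ (lamU_im hz), fun z _ => rfl, ?_⟩
  intro l hl
  rw [lamU_of_phi hl]
end


lemma moments_bound {ι : Type*} {R : ℝ} (hR : 0 < R) {Ψ : ℂ → ℂ}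
    (hΨ : DifferentiableOn ℂ Ψ (Metric.ball 0 (1 / R))) (p : ℕ → ι → ℂ) (s : ℕ → ℂ) (ζ : ι → ℂ)
    (L : Filter ι) [NeBot L] (hζ : Tendsto ζ L (nhds 0)) (hζ0 : ∀ᶠ i in L, ζ i ≠ 0)
    (hrec : ∀ k, ∀ᶠ i in L, p k i = ζ i * (p (k + 1) i - s k))
    (hp : ∀ k, Tendsto (p k) L (nhds 0)) (h0 : ∀ᶠ i in L, p 0 i = Ψ (ζ i)) :
    ∀ ρ, R < ρ → ∃ C, ∀ k, ‖s k‖ ≤ C * ρ ^ k := by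
  intro ρ hρ
  have hρ0 : 0 < ρ := hR.trans hρ
  obtain ⟨ρ2, h2, h3⟩ := exists_between hρ
  have hρ20 : 0 < ρ2 := hR.trans h2
  have hsub : Metric.closedBall (0:ℂ) ((⟨1/ρ2, by positivity⟩ : NNReal) : ℝ) ⊆ Metric.ball 0 (1 / R) :=
    Metric.closedBall_subset_ball (one_div_lt_one_div_of_lt hR h2)
  have hps := (hΨ.mono hsub).hasFPowerSeriesOnBall (by
    show (0:ℝ) < 1 / ρ2
    positivity)
  set q := cauchyPowerSeries Ψ 0 ((⟨1/ρ2, by positivity⟩ : NNReal) : ℝ)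
  set D : ℕ → ℂ → ℂ := fun k => (Function.swap dslope (0:ℂ))^[k] Ψ with hD
  have hDs : ∀ k, HasFPowerSeriesAt (D k) (FormalMultilinearSeries.fslope^[k] q) 0 := fun k =>
    HasFPowerSeriesAt.has_fpower_series_iterate_dslope_fslope k hps.hasFPowerSeriesAt
  have hD0 : ∀ k, D k 0 = q.coeff k := by
    intro k
    rw [← (hDs k).coeff_zero 1, FormalMultilinearSeries.apply_eq_prod_smul_coeff]
    simp [FormalMultilinearSeries.coeff_iterate_fslope]
  have hDrec : ∀ k l, D k l = D k 0 + l * D (k + 1) l := by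
    intro k l
    have := sub_smul_dslope (D k) 0 l
    simp only [sub_zero, smul_eq_mul] at this
    have e : D (k + 1) = dslope (D k) 0 := by
      simp only [hD, Function.iterate_succ_apply']
    rw [e, this]; ring
  have hDc : ∀ k, Tendsto (fun i => D k (ζ i)) L (nhds (D k 0)) := fun k =>
    (hDs k).continuousAt.tendsto.comp hζ
  have main : ∀ k, (∀ᶠ i in L, p k i = ζ i * D (k + 1) (ζ i)) ∧ s k = - D (k + 1) 0 := by
    have step : ∀ k, (∀ᶠ i in L, p k i = ζ i * D (k + 1) (ζ i)) →
        (∀ᶠ i in L, p (k+1) i = D (k + 1) (ζ i) + s k) ∧ s k = - D (k + 1) 0 := by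
      intro k hk
      have h1 : ∀ᶠ i in L, p (k+1) i = D (k + 1) (ζ i) + s k := by
        filter_upwards [hk, hrec k, hζ0] with i a b c
        have : p (k + 1) i - s k = D (k + 1) (ζ i) := mul_left_cancel₀ c (by rw [← b, a])
        linear_combination this
      refine ⟨h1, ?_⟩
      have t1 := (hDc (k + 1)).add_const (s k)
      have t2 := (hp (k + 1)).congr' h1
      have := tendsto_nhds_unique t1 t2
      linear_combination this
    intro k
    induction k with
    | zero =>
      have hd0 : D 0 0 = 0 := by
        have t2 := (hp 0).congr' h0
        exact tendsto_nhds_unique (hDc 0) t2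
      have : ∀ᶠ i in L, p 0 i = ζ i * D (0 + 1) (ζ i) := by
        filter_upwards [h0] with i h
        rw [h]
        have := hDrec 0 (ζ i)
        rw [hd0, zero_add] at this
        exact this
      exact ⟨this, (step 0 this).2⟩
    | succ k ih =>
      obtain ⟨h1, h2⟩ := step k ih.1
      have : ∀ᶠ i in L, p (k + 1) i = ζ i * D (k + 1 + 1) (ζ i) := by
        filter_upwards [h1] with i h
        rw [h, h2, hDrec (k + 1) (ζ i)]
        ring
      exact ⟨this, (step _ this).2⟩
  obtain ⟨rr, e⟩ : ∃ rr : NNReal, (rr : ℝ) = 1 / ρ := ⟨⟨1/ρ, by positivity⟩, rfl⟩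
  have hlt : (rr : ENNReal) < q.radius := by
    refine lt_of_lt_of_le (ENNReal.coe_lt_coe.2 (NNReal.coe_lt_coe.1 ?_)) hps.r_le
    rw [e]
    exact one_div_lt_one_div_of_lt hρ20 h3
  obtain ⟨C, hC, hCb⟩ := q.norm_mul_pow_le_of_lt_radius hlt
  refine ⟨C * ρ, fun k => ?_⟩
  rw [(main k).2, norm_neg, hD0]
  have h := hCb (k + 1)
  rw [FormalMultilinearSeries.norm_apply_eq_norm_coef] at h
  rw [e, div_pow, one_pow, mul_one_div, div_le_iff₀ (by positivity)] at h
  rw [mul_assoc, ← pow_succ']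
  exact h

lemma growth_bound {R : ℝ} (N : ℕ → ℝ) (h0 : ∀ k, 0 ≤ N k)
    (hlc : ∀ k, N (k + 1) ^ 2 ≤ N k * N (k + 2))
    (hg : ∀ ρ, R < ρ → ∃ C, ∀ k, N k ≤ C * (ρ ^ 2) ^ k) : N 1 ≤ R ^ 2 * N 0 := by
  by_contra hcon
  push Not at hcon
  have hN0 : 0 < N 0 := by
    rcases (h0 0).lt_or_eq with h | h
    · exact h
    · exfalso
      have := hlc 0
      rw [← h] at this hcon
      simp at this hcon
      rw [this] at hcon
      exact lt_irrefl _ hcon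
  set q := N 1 / N 0 with hq
  have hqR : R ^ 2 < q := by rw [hq, lt_div_iff₀ hN0]; exact hcon
  have hq0 : 0 < q := lt_of_le_of_lt (sq_nonneg R) hqR
  have hind : ∀ k, 0 < N k ∧ q * N k ≤ N (k + 1) := by
    intro k
    induction k with
    | zero => exact ⟨hN0, by rw [hq]; field_simp; rfl⟩
    | succ k ih =>
      have h1 : 0 < N (k + 1) := lt_of_lt_of_le (mul_pos hq0 ih.1) ih.2
      refine ⟨h1, ?_⟩
      have h2 := hlc k
      by_contra hc
      push Not at hc
      have h3 : N k * N (k + 2) < N k * (q * N (k + 1)) := mul_lt_mul_of_pos_left hc ih.1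
      nlinarith
  have hlow : ∀ k, q ^ k * N 0 ≤ N k := by
    intro k
    induction k with
    | zero => simp
    | succ k ih =>
      have := (hind k).2
      rw [pow_succ']
      nlinarith
  obtain ⟨t, ht1, ht2⟩ := exists_between hqR
  have ht0 : 0 < t := lt_of_le_of_lt (sq_nonneg R) ht1
  obtain ⟨C, hC⟩ := hg (Real.sqrt t) (Real.lt_sqrt_of_sq_lt ht1)
  rw [Real.sq_sqrt ht0.le] at hC
  have hlim := tendsto_pow_atTop_atTop_of_one_lt ((one_lt_div ht0).2 ht2)
  obtain ⟨k, hk⟩ := (hlim.eventually_gt_atTop (C / N 0)).exists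
  have h1 := (hlow k).trans (hC k)
  rw [div_pow, div_lt_div_iff₀ hN0 (by positivity)] at hk
  linarith


def T0 (a b : ℤ → ℝ) : (ℤ →₀ ℝ) →ₗ[ℝ] (ℤ →₀ ℝ) :=
  Finsupp.linearCombination ℝ (fun n => Finsupp.single (n+1) (a n) + Finsupp.single (n-1) (a (n-1))
    + Finsupp.single n (b n))

lemma T0_single (a b : ℤ → ℝ) (n : ℤ) : T0 a b (Finsupp.single n 1) =
    Finsupp.single (n+1) (a n) + Finsupp.single (n-1) (a (n-1)) + Finsupp.single n (b n) := by
  simp [T0]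

lemma lc_T0 {M : Type*} [AddCommGroup M] [Module ℝ M] (a b : ℤ → ℝ) (u : ℤ → M) (v : ℤ →₀ ℝ) :
    Finsupp.linearCombination ℝ u (T0 a b v) = Finsupp.linearCombination ℝ
      (fun n => a n • u (n+1) + a (n-1) • u (n-1) + b n • u n) v := by
  have : (Finsupp.linearCombination ℝ u).comp (T0 a b) = Finsupp.linearCombination ℝ
      (fun n => a n • u (n+1) + a (n-1) • u (n-1) + b n • u n) := by
    apply Finsupp.lhom_ext'
    intro n
    ext
    simp [T0_single]
  exact LinearMap.congr_fun this v

def ip (v w : ℤ →₀ ℝ) : ℝ := Finsupp.linearCombination ℝ (⇑w) v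

lemma ip_eq (v w : ℤ →₀ ℝ) (S : Finset ℤ) (hS : v.support ⊆ S) : ip v w = ∑ n ∈ S, v n * w n := by
  rw [ip, Finsupp.linearCombination_apply, Finsupp.sum_of_support_subset _ hS]
  · simp
  · simp

lemma ip_comm (v w : ℤ →₀ ℝ) : ip v w = ip w v := by
  classical
  rw [ip_eq v w (v.support ∪ w.support) Finset.subset_union_left,
    ip_eq w v (v.support ∪ w.support) Finset.subset_union_right]
  simp only [mul_comm]

lemma ip_self_nonneg (v : ℤ →₀ ℝ) : 0 ≤ ip v v := by
  rw [ip_eq v v _ subset_rfl]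
  exact Finset.sum_nonneg fun n _ => mul_self_nonneg _

lemma ip_cs (v w : ℤ →₀ ℝ) : (ip v w)^2 ≤ ip v v * ip w w := by
  classical
  rw [ip_eq v w (v.support ∪ w.support) Finset.subset_union_left,
    ip_eq v v (v.support ∪ w.support) Finset.subset_union_left,
    ip_eq w w (v.support ∪ w.support) Finset.subset_union_right]
  have := Finset.sum_mul_sq_le_sq_mul_sq (v.support ∪ w.support) v w
  simpa only [sq (v _), sq (w _)] using this

lemma T0_apply (a b : ℤ → ℝ) (v : ℤ →₀ ℝ) (n : ℤ) :
    T0 a b v n = a n * v (n+1) + a (n-1) * v (n-1) + b n * v n := by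
  induction v using Finsupp.induction_linear with
  | zero => simp
  | add f g hf hg => simp only [map_add, Finsupp.add_apply, hf, hg]; ring
  | single m c =>
    have : Finsupp.single m c = c • Finsupp.single m (1:ℝ) := by simp
    rw [this, map_smul, T0_single]
    simp only [Finsupp.smul_apply, Finsupp.add_apply, Finsupp.single_apply, smul_eq_mul]
    by_cases h1 : m + 1 = n
    · subst h1
      have e1 : ¬ (m - 1 = m + 1) := by omega
      have e2 : ¬ (m = m + 1 + 1) := by omega
      simp [e1, e2]
      ring
    · by_cases h2 : m - 1 = n
      · subst h2
        have e1 : ¬ (m + 1 = m - 1) := by omega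
        have e2 : ¬ (m = m - 1 - 1) := by omega
        have e3 : ¬ (m = m - 1) := by omega
        simp [e1, e2, e3]
        ring
      · have h3 : ¬ (m = n + 1) := by omega
        have h4 : ¬ (m = n - 1) := by omega
        simp [h1, h2, h3, h4]
        by_cases h5 : m = n
        · subst h5; simp; ring
        · simp [h5]

lemma ip_T0 (a b : ℤ → ℝ) (v w : ℤ →₀ ℝ) : ip (T0 a b v) w = ip v (T0 a b w) := by
  rw [ip, lc_T0, ip]
  congr 2
  ext n
  rw [T0_apply]; simp

lemma ip_T0_pow (a b : ℤ → ℝ) (k : ℕ) : ∀ (v w : ℤ →₀ ℝ),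
    ip ((T0 a b ^ k) v) w = ip v ((T0 a b ^ k) w) := by
  induction k with
  | zero => intro v w; simp
  | succ k ih =>
    intro v w
    rw [pow_succ, Module.End.mul_apply, ih, ip_T0]
    rw [← Module.End.mul_apply, ← pow_succ']
    rw [pow_succ]

lemma ip_single (v : ℤ →₀ ℝ) (n : ℤ) : ip v (Finsupp.single n 1) = v n := by
  rw [ip_comm, ip]; simp

lemma ip_add_le (v w : ℤ →₀ ℝ) : ip (v + w) (v + w) ≤ 2 * ip v v + 2 * ip w w := by
  classical
  rw [ip_eq (v+w) (v+w) (v.support ∪ w.support) Finsupp.support_add,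
    ip_eq v v (v.support ∪ w.support) Finset.subset_union_left,
    ip_eq w w (v.support ∪ w.support) Finset.subset_union_right, Finset.mul_sum, Finset.mul_sum,
    ← Finset.sum_add_distrib]
  refine Finset.sum_le_sum fun n _ => ?_
  simp only [Finsupp.add_apply]
  nlinarith [sq_nonneg (v n - w n)]

lemma ip_smul (c : ℝ) (v : ℤ →₀ ℝ) : ip (c • v) (c • v) = c^2 * ip v v := by
  rw [ip_eq (c•v) (c•v) v.support Finsupp.support_smul, ip_eq v v _ subset_rfl, Finset.mul_sum]
  refine Finset.sum_congr rfl fun n _ => ?_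
  simp only [Finsupp.smul_apply, smul_eq_mul]; ring

def VV (a b : ℤ → ℝ) (R : ℝ) : Submodule ℝ (ℤ →₀ ℝ) where
  carrier := {v | ∀ ρ, R < ρ → ∃ C, ∀ k, ip ((T0 a b ^ k) v) ((T0 a b ^ k) v) ≤ C * (ρ ^ 2) ^ k}
  zero_mem' := fun ρ _ => ⟨0, fun k => by simp [ip]⟩
  add_mem' := by
    intro v w hv hw ρ hρ
    obtain ⟨C, hC⟩ := hv ρ hρ
    obtain ⟨D, hD⟩ := hw ρ hρ
    refine ⟨2 * C + 2 * D, fun k => ?_⟩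
    rw [map_add]
    have := ip_add_le ((T0 a b ^ k) v) ((T0 a b ^ k) w)
    linarith [hC k, hD k]
  smul_mem' := by
    intro c v hv ρ hρ
    obtain ⟨C, hC⟩ := hv ρ hρ
    refine ⟨c^2 * C, fun k => ?_⟩
    rw [map_smul, ip_smul, mul_assoc]
    exact mul_le_mul_of_nonneg_left (hC k) (sq_nonneg c)

lemma VV_T0 {a b : ℤ → ℝ} {R : ℝ} {v : ℤ →₀ ℝ} (hv : v ∈ VV a b R) : T0 a b v ∈ VV a b R := by
  intro ρ hρ
  obtain ⟨C, hC⟩ := hv ρ hρ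
  refine ⟨C * ρ^2, fun k => ?_⟩
  rw [← Module.End.mul_apply, ← pow_succ, mul_assoc, ← pow_succ']
  exact hC (k+1)

lemma VV_top {a b : ℤ → ℝ} {R : ℝ} (ha : ∀ n, 0 < a n) (h0 : Finsupp.single 0 1 ∈ VV a b R)
    (h1 : Finsupp.single 1 1 ∈ VV a b R) (v : ℤ →₀ ℝ) : v ∈ VV a b R := by
  have es : ∀ (n : ℤ) (c : ℝ), Finsupp.single n c = c • Finsupp.single n (1:ℝ) := by intro n c; simp
  have key : ∀ n : ℤ, T0 a b (Finsupp.single n 1) = a n • Finsupp.single (n+1) (1:ℝ) +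
     a (n-1) • Finsupp.single (n-1) (1:ℝ) + b n • Finsupp.single n (1:ℝ) := by
    intro n; rw [T0_single]; simp
  have up : ∀ n : ℤ, Finsupp.single (n-1) (1:ℝ) ∈ VV a b R → Finsupp.single n (1:ℝ) ∈ VV a b R →
      Finsupp.single (n+1) (1:ℝ) ∈ VV a b R := by
    intro n h h'
    have e : Finsupp.single (n+1) (1:ℝ) = (a n)⁻¹ • (T0 a b (Finsupp.single n 1) -
      a (n-1) • Finsupp.single (n-1) (1:ℝ) - b n • Finsupp.single n (1:ℝ)) := by
      rw [key, eq_inv_smul_iff₀ (ha n).ne']; abel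
    rw [e]
    exact Submodule.smul_mem _ _ (Submodule.sub_mem _ (Submodule.sub_mem _ (VV_T0 h')
      (Submodule.smul_mem _ _ h)) (Submodule.smul_mem _ _ h'))
  have down : ∀ n : ℤ, Finsupp.single (n+1) (1:ℝ) ∈ VV a b R → Finsupp.single n (1:ℝ) ∈ VV a b R →
      Finsupp.single (n-1) (1:ℝ) ∈ VV a b R := by
    intro n h h'
    have e : Finsupp.single (n-1) (1:ℝ) = (a (n-1))⁻¹ • (T0 a b (Finsupp.single n 1) -
      a n • Finsupp.single (n+1) (1:ℝ) - b n • Finsupp.single n (1:ℝ)) := by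
      rw [key, eq_inv_smul_iff₀ (ha _).ne']; abel
    rw [e]
    exact Submodule.smul_mem _ _ (Submodule.sub_mem _ (Submodule.sub_mem _ (VV_T0 h')
      (Submodule.smul_mem _ _ h)) (Submodule.smul_mem _ _ h'))
  have all : ∀ n : ℤ, Finsupp.single n (1:ℝ) ∈ VV a b R ∧ Finsupp.single (n+1) (1:ℝ) ∈ VV a b R := by
    intro n
    induction n using Int.induction_on with
    | zero => exact ⟨h0, by simpa using h1⟩
    | succ n ih =>
      refine ⟨ih.2, up _ ?_ ih.2⟩
      simpa using ih.1
    | pred n ih =>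
      refine ⟨down _ ih.2 ih.1, ?_⟩
      simpa using ih.1
  induction v using Finsupp.induction_linear with
  | zero => exact Submodule.zero_mem _
  | add f g hf hg => exact Submodule.add_mem _ hf hg
  | single m c => rw [es]; exact Submodule.smul_mem _ _ (all m).1

lemma VV_of_moments {a b : ℤ → ℝ} {R : ℝ} {n : ℤ}
    (h : ∀ ρ, R < ρ → ∃ C, ∀ k : ℕ, |(T0 a b ^ k) (Finsupp.single n 1) n| ≤ C * ρ ^ k) :
    Finsupp.single n 1 ∈ VV a b R := by
  intro ρ hρ
  obtain ⟨C, hC⟩ := h ρ hρ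
  refine ⟨C, fun k => ?_⟩
  rw [ip_comm, ← ip_T0_pow, ip_single, ← Module.End.mul_apply, ← pow_add, ← pow_mul, two_mul]
  exact (le_abs_self _).trans (hC _)

lemma VV_bound {a b : ℤ → ℝ} {R : ℝ} {v : ℤ →₀ ℝ} (hv : v ∈ VV a b R) :
    ip (T0 a b v) (T0 a b v) ≤ R^2 * ip v v := by
  have := growth_bound (R := R) (fun k => ip ((T0 a b ^ k) v) ((T0 a b ^ k) v))
    (fun k => ip_self_nonneg _) ?_ hv
  · simpa using this
  · intro k
    have := ip_cs ((T0 a b ^ k) v) ((T0 a b ^ (k+2)) v)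
    convert this using 2
    rw [pow_succ' _ (k+1), Module.End.mul_apply, ← ip_T0, ← Module.End.mul_apply, ← pow_succ']


lemma lp2_sum_le (u : lp (fun _ : ℤ => ℂ) 2) (S : Finset ℤ) : ∑ n ∈ S, ‖u n‖^2 ≤ ‖u‖^2 := by
  have := lp.sum_rpow_le_norm_rpow (p := 2) (by norm_num) u S
  norm_num at this
  exact this

def trunc (S : Finset ℤ) (x : ℤ → ℝ) : ℤ →₀ ℝ := Finsupp.indicator S (fun n _ => x n)

lemma trunc_apply {S : Finset ℤ} {x : ℤ → ℝ} {n : ℤ} (h : n ∈ S) : trunc S x n = x n := by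
  simp [trunc, Finsupp.indicator_apply, h]

lemma ip_trunc (S : Finset ℤ) (x : ℤ → ℝ) : ip (trunc S x) (trunc S x) = ∑ n ∈ S, x n ^ 2 := by
  rw [ip_eq (trunc S x) (trunc S x) S (Finsupp.support_indicator_subset _ _)]
  refine Finset.sum_congr rfl fun n hn => ?_
  rw [trunc_apply hn]; ring

lemma sum_le_ip (S : Finset ℤ) (v : ℤ →₀ ℝ) : ∑ n ∈ S, v n ^ 2 ≤ ip v v := by
  classical
  rw [ip_eq v v (v.support ∪ S) Finset.subset_union_left]
  simp only [← sq]
  exact Finset.sum_le_sum_of_subset_of_nonneg Finset.subset_union_right fun _ _ _ => sq_nonneg _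

lemma jac_sum_le {a b : ℤ → ℝ} {R : ℝ} (h : ∀ v, ip (T0 a b v) (T0 a b v) ≤ R^2 * ip v v)
    (u : lp (fun _ : ℤ => ℂ) 2) (S : Finset ℤ) :
    ∑ n ∈ S, ‖(a n : ℂ) * u (n + 1) + (a (n - 1) : ℂ) * u (n - 1) + (b n : ℂ) * u n‖^2 ≤
      R^2 * ‖u‖^2 := by
  classical
  set S' : Finset ℤ := S ∪ S.image (· + 1) ∪ S.image (· - 1)
  have m1 : ∀ n ∈ S, n ∈ S' := fun n hn => by
    simp only [S', Finset.mem_union]; exact Or.inl (Or.inl hn)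
  have m2 : ∀ n ∈ S, n + 1 ∈ S' := fun n hn => by
    simp only [S', Finset.mem_union]; exact Or.inl (Or.inr (Finset.mem_image_of_mem _ hn))
  have m3 : ∀ n ∈ S, n - 1 ∈ S' := fun n hn => by
    simp only [S', Finset.mem_union]; exact Or.inr (Finset.mem_image_of_mem _ hn)
  set x := trunc S' (fun n => (u n).re)
  set y := trunc S' (fun n => (u n).im)
  calc _ = ∑ n ∈ S, ((T0 a b x n)^2 + (T0 a b y n)^2) := by
        refine Finset.sum_congr rfl fun n hn => ?_
        rw [← Complex.normSq_eq_norm_sq, Complex.normSq_apply, T0_apply, T0_apply,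
          trunc_apply (m1 n hn), trunc_apply (m2 n hn), trunc_apply (m3 n hn),
          trunc_apply (m1 n hn), trunc_apply (m2 n hn), trunc_apply (m3 n hn)]
        simp
        ring
    _ ≤ ip (T0 a b x) (T0 a b x) + ip (T0 a b y) (T0 a b y) := by
        rw [Finset.sum_add_distrib]
        exact add_le_add (sum_le_ip _ _) (sum_le_ip _ _)
    _ ≤ R^2 * ip x x + R^2 * ip y y := add_le_add (h x) (h y)
    _ = R^2 * ∑ n ∈ S', ‖u n‖^2 := by
        rw [ip_trunc, ip_trunc, ← mul_add, ← Finset.sum_add_distrib]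
        congr 1
        refine Finset.sum_congr rfl fun n hn => ?_
        rw [← Complex.normSq_eq_norm_sq, Complex.normSq_apply]; ring
    _ ≤ _ := mul_le_mul_of_nonneg_left (lp2_sum_le u S') (sq_nonneg _)

lemma jac_op_exists {a b : ℤ → ℝ} {R : ℝ} (hR : 0 ≤ R)
    (h : ∀ v, ip (T0 a b v) (T0 a b v) ≤ R^2 * ip v v) :
    ∃ T : lp (fun _ : ℤ => ℂ) 2 →L[ℂ] lp (fun _ : ℤ => ℂ) 2, IsJacobiOperator a b T ∧ ‖T‖ ≤ R := by
  have hmem : ∀ u : lp (fun _ : ℤ => ℂ) 2, Memℓp (fun n : ℤ =>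
      (a n : ℂ) * u (n + 1) + (a (n - 1) : ℂ) * u (n - 1) + (b n : ℂ) * u n) 2 := by
    intro u
    refine memℓp_gen' (C := R^2 * ‖u‖^2) fun S => ?_
    have := jac_sum_le h u S
    norm_num
    exact this
  let L : lp (fun _ : ℤ => ℂ) 2 →ₗ[ℂ] lp (fun _ : ℤ => ℂ) 2 :=
    { toFun := fun u => ⟨_, hmem u⟩
      map_add' := by
        intro u v
        ext n
        show (a n : ℂ) * (u (n + 1) + v (n + 1)) + (a (n - 1) : ℂ) * (u (n - 1) + v (n - 1)) +
          (b n : ℂ) * (u n + v n) =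
          ((a n : ℂ) * u (n + 1) + (a (n - 1) : ℂ) * u (n - 1) + (b n : ℂ) * u n) +
          ((a n : ℂ) * v (n + 1) + (a (n - 1) : ℂ) * v (n - 1) + (b n : ℂ) * v n)
        ring
      map_smul' := by
        intro c v
        ext n
        simp
        ring }
  have hb : ∀ u, ‖L u‖ ≤ R * ‖u‖ := by
    intro u
    refine lp.norm_le_of_forall_sum_le (by norm_num) (by positivity) fun S => ?_
    have := jac_sum_le h u S
    rw [← mul_pow] at this
    norm_num
    exact this
  exact ⟨L.mkContinuous R hb, fun u n => rfl, L.mkContinuous_norm_le hR hb⟩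


lemma Family.green1 {Fs : ℤ → ℂ → ℂ} {a b : ℤ → ℝ} (h : Family Fs a b) (n0 : ℤ) (y : ℝ) :
    ∃ u : ℤ → ℂ, 0 < y → ((∀ n, (a n : ℂ) * u (n+1) + (a (n-1) : ℂ) * u (n-1) + (b n : ℂ) * u n =
      (I * ((y:ℂ)⁻¹ - y)) * u n + if n = n0 then 1 else 0) ∧
      u n0 = -1 / ((a n0 : ℂ)^2 * (Fs n0 (y * I) - (starRingEnd ℂ) (Fs n0 ((y⁻¹ : ℝ) * I)))) ∧
      (∀ n, n0 ≤ n → u (n+1) = -(a n * Fs n (y * I)) * u n) ∧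
      (∀ n, n < n0 → u n = -((a n : ℂ)⁻¹ * (starRingEnd ℂ) ((Fs n ((y⁻¹ : ℝ) * I))⁻¹)) * u (n+1))) := by
  by_cases hy : 0 < y
  swap
  · exact ⟨0, fun h => absurd h hy⟩
  have hyC : (y : ℂ) ≠ 0 := by exact_mod_cast hy.ne'
  have l1 : 0 < ((y : ℂ) * I).im := by simpa using hy
  have l2 : 0 < (((y⁻¹ : ℝ) : ℂ) * I).im := by simpa using hy
  have ha : ∀ n, (a n : ℂ) ≠ 0 := fun n => by exact_mod_cast (h.apos n).ne'
  obtain ⟨f, f0, fn, fr, fs, -⟩ := h.sol l1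
  obtain ⟨g', g0, gn', gr', gs', -⟩ := h.sol l2
  set G := fun n => (starRingEnd ℂ) (Fs n ((y⁻¹ : ℝ) * I)) with hG
  set g : ℤ → ℂ := fun n => (starRingEnd ℂ) (g' n) with hg
  have gn : ∀ n, g n ≠ 0 := fun n => by simpa [hg] using gn' n
  have gr : ∀ n, g (n+1) = -(a n * G n) * g n := by
    intro n
    simp only [hg, hG, gr', map_mul, map_neg, Complex.conj_ofReal]
  have Gn : ∀ n, G n ≠ 0 := fun n => by
    have := ne_zero_of_im_pos ((h.herg n).2 _ l2)
    simpa [hG] using this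
  have ez1 : -((y:ℂ) * I) - 1 / (y * I) = I * ((y:ℂ)⁻¹ - y) := by
    field_simp
    ring_nf; rw [I_sq]; ring
  have ez2 : (starRingEnd ℂ) (-(((y⁻¹ : ℝ):ℂ) * I) - 1 / (((y⁻¹ : ℝ):ℂ) * I)) = I * ((y:ℂ)⁻¹ - y) := by
    simp only [map_sub, map_neg, map_mul, map_div₀, map_one, conj_I, conj_ofReal]
    push_cast
    field_simp
    ring_nf; rw [I_sq]; ring
  have gs : JacobiSolution a b (I * ((y:ℂ)⁻¹ - y)) g := by
    intro n
    have := congrArg (starRingEnd ℂ) (gs' n)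
    rw [map_mul (starRingEnd ℂ) (-(((y⁻¹ : ℝ):ℂ) * I) - 1 / (((y⁻¹ : ℝ):ℂ) * I)), ez2] at this
    simpa [hg] using this
  rw [ez1] at fs
  set c := -((a n0 : ℂ)^2 * (Fs n0 (y * I) - G n0)) with hc
  have hc0 : c ≠ 0 := by
    rw [hc, neg_ne_zero]
    refine mul_ne_zero (pow_ne_zero _ (ha n0)) (ne_zero_of_im_pos ?_)
    have e1 := (h.herg n0).2 _ l1
    have e2 := (h.herg n0).2 _ l2
    simp only [hG, sub_im, conj_im]
    linarith
  refine ⟨fun n => (if n0 ≤ n then f n / f n0 else g n / g n0) / c, fun _ => ⟨?_, ?_, ?_, ?_⟩⟩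
  · intro n
    have e1 := fs n
    have e2 := gs n
    generalize I * ((y:ℂ)⁻¹ - y) = z at e1 e2 ⊢
    rcases lt_trichotomy n n0 with hn | hn | hn
    · have k1 : ¬ n0 ≤ n := by omega
      have k2 : ¬ n0 ≤ n - 1 := by omega
      have k3 : (if n0 ≤ n + 1 then f (n+1) / f n0 else g (n+1) / g n0) = g (n+1) / g n0 := by
        split_ifs with hh
        · have : n + 1 = n0 := by omega
          rw [this, div_self (fn _), div_self (gn _)]
        · rfl
      simp only [k3, k1, k2, hn.ne, if_false]
      have := gn n0
      field_simp
      linear_combination e2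
    · subst hn
      have k2 : ¬ n ≤ n - 1 := by omega
      have k3 : n ≤ n + 1 := by omega
      simp only [k2, k3, le_refl, if_true, if_false]
      have f1 := fn n
      have g1 := gn n
      rw [fr] at e1 ⊢
      rw [gr] at e2
      field_simp
      rw [hc]
      linear_combination e2
    · have k1 : n0 ≤ n := by omega
      have k2 : n0 ≤ n - 1 := by omega
      have k3 : n0 ≤ n + 1 := by omega
      simp only [k3, k1, k2, hn.ne', if_false, if_true]
      have := fn n0
      field_simp
      linear_combination e1
  · simp only [le_refl, if_true]
    rw [div_self (fn _), hc]
    rw [neg_div, one_div, one_div, inv_neg]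
  · intro n hn
    have k3 : n0 ≤ n + 1 := by omega
    simp only [hn, k3, if_true, fr]
    ring
  · intro n hn
    have k1 : ¬ n0 ≤ n := by omega
    have k3 : (if n0 ≤ n + 1 then f (n+1) / f n0 else g (n+1) / g n0) = g (n+1) / g n0 := by
      split_ifs with hh
      · have : n + 1 = n0 := by omega
        rw [this, div_self (fn _), div_self (gn _)]
      · rfl
    simp only [k3]
    simp only [k1, if_false, gr]
    have := Gn n
    have := ha n
    rw [map_inv₀]
    change _ = -((a n:ℂ)⁻¹ * (G n)⁻¹) * _
    have := gn n0
    generalize G n = q at *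
    field_simp

lemma Family.green {Fs : ℤ → ℂ → ℂ} {a b : ℤ → ℝ} (h : Family Fs a b) (n0 : ℤ) :
    ∃ u : ℝ → ℤ → ℂ, (∀ y, 0 < y → ∀ n, (a n : ℂ) * u y (n+1) + (a (n-1) : ℂ) * u y (n-1) +
      (b n : ℂ) * u y n = (I * ((y:ℂ)⁻¹ - y)) * u y n + if n = n0 then 1 else 0) ∧
      (∀ y, 0 < y → u y n0 =
        -1 / ((a n0 : ℂ)^2 * (Fs n0 (y * I) - (starRingEnd ℂ) (Fs n0 ((y⁻¹ : ℝ) * I))))) ∧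
      (∀ n, Tendsto (fun y => u y n) (nhdsWithin 0 (Ioi 0)) (nhds 0)) := by
  choose u hu using h.green1 n0
  refine ⟨u, fun y hy => (hu y hy).1, fun y hy => (hu y hy).2.1, ?_⟩
  have ev : ∀ᶠ y : ℝ in nhdsWithin 0 (Ioi 0), 0 < y := eventually_mem_nhdsWithin
  have cinf : ∀ n, Tendsto (fun y : ℝ => (starRingEnd ℂ) ((Fs n ((y⁻¹ : ℝ) * I))⁻¹))
      (nhdsWithin 0 (Ioi 0)) (nhds 0) := by
    intro n
    have := (Complex.continuous_conj.tendsto 0).comp (h.limInf n)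
    rw [map_zero] at this
    exact this
  have base : Tendsto (fun y => u y n0) (nhdsWithin 0 (Ioi 0)) (nhds 0) := by
    have ha : (a n0 : ℂ) ≠ 0 := by exact_mod_cast (h.apos n0).ne'
    have t1 := ((cinf n0).div ((((h.lim0 n0).mul (cinf n0)).const_sub 1).const_mul ((a n0 : ℂ)^2))
      (by simpa using ha))
    simp only [mul_zero, sub_zero, zero_div] at t1
    refine t1.congr' ?_
    filter_upwards [ev] with y hy
    rw [(hu y hy).2.1]
    simp only [Pi.div_apply, map_inv₀]
    have l2 : 0 < (((y⁻¹ : ℝ) : ℂ) * I).im := by simpa using hy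
    have : (starRingEnd ℂ) (Fs n0 ((y⁻¹ : ℝ) * I)) ≠ 0 := by
      simpa using ne_zero_of_im_pos ((h.herg n0).2 _ l2)
    have l1 : 0 < ((y : ℂ) * I).im := by simpa using hy
    set G := (starRingEnd ℂ) (Fs n0 ((y⁻¹ : ℝ) * I)) with hG
    have d : Fs n0 (y * I) - G ≠ 0 := by
      refine ne_zero_of_im_pos ?_
      have e1 := (h.herg n0).2 _ l1
      have e2 := (h.herg n0).2 _ l2
      simp only [hG, sub_im, conj_im]
      linarith
    have d2 : 1 - Fs n0 (y * I) * G⁻¹ ≠ 0 := by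
      intro hh; apply d
      field_simp at hh
      linear_combination -hh
    rw [div_eq_div_iff (mul_ne_zero (pow_ne_zero _ ha) d2) (mul_ne_zero (pow_ne_zero _ ha) d)]
    field_simp
    ring
  have up : ∀ k : ℕ, Tendsto (fun y => u y (n0 + k)) (nhdsWithin 0 (Ioi 0)) (nhds 0) := by
    intro k
    induction k with
    | zero => simpa using base
    | succ k ih =>
      have t := ((h.lim0 (n0 + k)).const_mul (-(a (n0+k) : ℂ))).mul ih
      rw [mul_zero] at t
      refine t.congr' ?_
      filter_upwards [ev] with y hy
      have := (hu y hy).2.2.1 (n0 + k) (by omega)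
      push_cast
      rw [← add_assoc, this]; ring
  have down : ∀ k : ℕ, Tendsto (fun y => u y (n0 - k)) (nhdsWithin 0 (Ioi 0)) (nhds 0) := by
    intro k
    induction k with
    | zero => simpa using base
    | succ k ih =>
      have t := ((cinf (n0 - k - 1)).const_mul (-(a (n0-k-1) : ℂ)⁻¹)).mul ih
      rw [mul_zero] at t
      refine t.congr' ?_
      filter_upwards [ev] with y hy
      have := (hu y hy).2.2.2 (n0 - k - 1) (by omega)
      rw [sub_add_cancel] at this
      rw [Nat.cast_succ, ← sub_sub, this]
      ring
  intro n
  rcases le_total n0 n with hn | hn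
  · obtain ⟨k, rfl⟩ := Int.le.dest hn
    exact up k
  · obtain ⟨k, hk⟩ := Int.le.dest hn
    have : n = n0 - k := by omega
    rw [this]; exact down k

/-- inverse of `ζ = 1/φ` near zero -/
def lamZ (ζ : ℂ) : ℂ := -2 * ζ / (1 + exp (log (1 - 4 * ζ^2) / 2))

lemma lamZ_aux {ζ : ℂ} (h : ‖ζ‖ < 1/2) : 0 < (1 - 4 * ζ^2).re ∧
    0 < (exp (log (1 - 4 * ζ^2) / 2)).re := by
  have h1 : ‖4 * ζ^2‖ < 1 := by
    rw [norm_mul, norm_pow]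
    have := norm_nonneg ζ
    norm_num
    nlinarith
  have h2 : 0 < (1 - 4 * ζ^2).re := by
    have := (abs_re_le_norm (4 * ζ^2)).trans_lt h1
    rw [abs_lt] at this
    rw [sub_re, one_re]; linarith
  refine ⟨h2, half_sq_re ?_⟩
  exact Or.inl h2

lemma lamZ_diff : DifferentiableOn ℂ lamZ (Metric.ball 0 (1/2)) := by
  intro ζ hζ
  have hh := lamZ_aux (ζ := ζ) (by simpa using hζ)
  have hne : 1 + exp (log (1 - 4 * ζ^2) / 2) ≠ 0 := by
    intro h
    have := congrArg Complex.re h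
    rw [add_re, one_re, zero_re] at this
    linarith [hh.2]
  have hs : (1 - 4 * ζ^2) ∈ slitPlane := Or.inl hh.1
  apply DifferentiableAt.differentiableWithinAt
  unfold lamZ
  refine DifferentiableAt.div (by fun_prop) ?_ hne
  refine (differentiableAt_const _).add ?_
  refine DifferentiableAt.cexp ?_
  have h1 : DifferentiableAt ℂ (fun ζ : ℂ => 1 - 4 * ζ^2) ζ := by fun_prop
  exact (h1.clog hs).div_const _

lemma lamZ_norm_le {ζ : ℂ} (h : ‖ζ‖ < 1/2) : ‖lamZ ζ‖ ≤ 2 * ‖ζ‖ := by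
  have hh := lamZ_aux h
  have : 1 ≤ ‖1 + exp (log (1 - 4 * ζ^2) / 2)‖ := by
    refine le_trans ?_ (re_le_norm _)
    rw [add_re, one_re]; linarith [hh.2]
  unfold lamZ
  rw [norm_div, norm_mul, norm_neg, Complex.norm_ofNat]
  exact div_le_self (by positivity) this

lemma lamZ_quad {ζ : ℂ} (h : ‖ζ‖ < 1/2) : (lamZ ζ)^2 * ζ + lamZ ζ + ζ = 0 := by
  have hh := lamZ_aux h
  have e : (exp (log (1 - 4 * ζ^2) / 2))^2 = 1 - 4 * ζ^2 := half_sq (by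
    intro h0; rw [h0] at hh; simp at hh)
  unfold lamZ
  set s := exp (log (1 - 4 * ζ^2) / 2)
  have hne : 1 + s ≠ 0 := by
    intro h
    have := congrArg Complex.re h
    rw [add_re, one_re, zero_re] at this
    linarith [hh.2]
  field_simp
  linear_combination ζ * e

lemma lamZ_lt {r R : ℝ} (hr0 : 0 < r) (hr1 : r ≤ 1) (hrR : r + 1/r = R) {ζ : ℂ}
    (hζ : ‖ζ‖ < 1/R) : ‖lamZ ζ‖ < r := by
  have hR2 : 2 ≤ R := by
    rw [← hrR]; rw [← sub_nonneg]
    have : r + 1/r - 2 = (r-1)^2 / r := by field_simp; ring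
    rw [this]; positivity
  have h2 : ‖ζ‖ < 1/2 := hζ.trans_le (one_div_le_one_div_of_le (by norm_num) hR2)
  have q := lamZ_quad h2
  have n1 := lamZ_norm_le h2
  set l := lamZ ζ
  have hl1 : ‖l‖ < 1 := by linarith
  have e : ‖l‖ ≤ ‖ζ‖ * (‖l‖^2 + 1) := by
    have : l = - (ζ * (l^2 + 1)) := by linear_combination q
    calc ‖l‖ = ‖ζ * (l^2 + 1)‖ := by rw [← norm_neg (ζ * _), ← this]
      _ ≤ ‖ζ‖ * (‖l‖^2 + 1) := by
        rw [norm_mul]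
        refine mul_le_mul_of_nonneg_left ?_ (norm_nonneg _)
        refine (norm_add_le _ _).trans ?_
        simp
  by_contra hcon
  push Not at hcon
  have hR0 : 0 < R := by linarith
  rw [lt_div_iff₀ hR0] at hζ
  have h3 : R * ‖l‖ ≤ ‖ζ‖ * R * (‖l‖^2 + 1) := by nlinarith
  have h4 : R * ‖l‖ < ‖l‖^2 + 1 := by nlinarith [norm_nonneg l, sq_nonneg ‖l‖]
  have h5 : R * r = r^2 + 1 := by rw [← hrR]; field_simp
  have h6 : (‖l‖ - r) * (r * ‖l‖ - 1) ≤ 0 := by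
    apply mul_nonpos_of_nonneg_of_nonpos (by linarith)
    nlinarith
  nlinarith

lemma lamZ_y {y : ℝ} (hy : 0 < y) (hy1 : y < 1/4) :
    ‖(I * ((y:ℂ)⁻¹ - y))⁻¹‖ < 1/2 ∧ lamZ (I * ((y:ℂ)⁻¹ - y))⁻¹ = y * I := by
  have e : (I * ((y:ℂ)⁻¹ - y))⁻¹ = -(((y / (1 - y^2) : ℝ)) : ℂ) * I := by
    push_cast
    have h1 : (y:ℂ) ≠ 0 := by exact_mod_cast hy.ne'
    have h2 : (1 - (y:ℂ)^2) ≠ 0 := by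
      have : (1 - y^2) ≠ 0 := by nlinarith
      exact_mod_cast this
    have h3 : I * ((y:ℂ)⁻¹ - y) = I * ((1 - (y:ℂ)^2) / y) := by field_simp
    rw [h3, mul_inv, inv_I, inv_div]; ring
  have b1 : 0 < 1 - y^2 := by nlinarith
  have b2 : y / (1 - y^2) < 1/2 := by rw [div_lt_div_iff₀ b1 (by norm_num)]; nlinarith
  have b3 : 0 < y / (1 - y^2) := by positivity
  have hn : ‖(I * ((y:ℂ)⁻¹ - y))⁻¹‖ < 1/2 := by
    rw [e, norm_mul, norm_neg, Complex.norm_real, norm_I, mul_one, Real.norm_eq_abs, abs_of_pos b3]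
    exact b2
  refine ⟨hn, ?_⟩
  have q := lamZ_quad hn
  have nb := lamZ_norm_le hn
  set ζ := (I * ((y:ℂ)⁻¹ - y))⁻¹
  have hζ0 : ζ ≠ 0 := by
    rw [e]; simp; constructor
    · exact hy.ne'
    · intro h; apply b1.ne'; exact_mod_cast h
  have q2 : (y * I)^2 * ζ + y * I + ζ = 0 := by
    have h1 : (y:ℂ) ≠ 0 := by exact_mod_cast hy.ne'
    have h2 : (1 - (y:ℂ)^2) ≠ 0 := by
      have : (1 - y^2) ≠ 0 := by nlinarith
      exact_mod_cast this
    rw [e]; push_cast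
    field_simp
    ring_nf
    rw [show I^3 = I^2 * I by ring, I_sq]; ring
  have q3 : (lamZ ζ - y * I) * ((lamZ ζ + y * I) * ζ + 1) = 0 := by linear_combination q - q2
  rcases mul_eq_zero.1 q3 with h | h
  · linear_combination h
  · exfalso
    have h1 : (lamZ ζ + y * I) * ζ = -1 := by linear_combination h
    have h2 := congrArg norm h1
    rw [norm_mul, norm_neg, norm_one] at h2
    have h3 : ‖lamZ ζ + y * I‖ ≤ 1 + y := by
      refine (norm_add_le _ _).trans ?_
      rw [norm_mul, norm_I, Complex.norm_real, Real.norm_eq_abs, abs_of_pos hy]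
      linarith
    have := norm_nonneg ζ
    nlinarith


lemma Family.moments {Fs : ℤ → ℂ → ℂ} {a b : ℤ → ℝ} (h : Family Fs a b) (n0 : ℤ) {r R : ℝ}
    (hr0 : 0 < r) (hr1 : r ≤ 1) (hrR : r + 1/r = R) {Φ : ℂ → ℂ}
    (hΦ : DifferentiableOn ℂ Φ (Metric.ball 0 r))
    (hΦy : ∀ᶠ y : ℝ in nhdsWithin 0 (Ioi 0), Φ (y * I) =
       -1 / ((a n0 : ℂ)^2 * (Fs n0 (y * I) - (starRingEnd ℂ) (Fs n0 ((y⁻¹ : ℝ) * I))))) :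
    Finsupp.single n0 1 ∈ VV a b R := by
  have hR2 : 2 ≤ R := by
    rw [← hrR]; rw [← sub_nonneg]
    have : r + 1/r - 2 = (r-1)^2 / r := by field_simp; ring
    rw [this]; positivity
  have hR0 : 0 < R := by linarith
  obtain ⟨u, hu, hu0, hul⟩ := h.green n0
  have ev : ∀ᶠ y : ℝ in nhdsWithin 0 (Ioi 0), 0 < y := eventually_mem_nhdsWithin
  have ev4 : ∀ᶠ y : ℝ in nhdsWithin 0 (Ioi 0), y < 1/4 :=
    mem_nhdsWithin_of_mem_nhds (Iio_mem_nhds (by norm_num))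
  apply VV_of_moments
  set v : ℕ → (ℤ →₀ ℝ) := fun k => (T0 a b ^ k) (Finsupp.single n0 1) with hv
  have hΨ : DifferentiableOn ℂ (fun ζ => Φ (lamZ ζ)) (Metric.ball 0 (1/R)) := by
    have hsub : Metric.ball (0:ℂ) (1/R) ⊆ Metric.ball 0 (1/2) :=
      Metric.ball_subset_ball (one_div_le_one_div_of_le (by norm_num) hR2)
    refine hΦ.comp (lamZ_diff.mono hsub) ?_
    intro ζ hζ
    have := lamZ_lt hr0 hr1 hrR (ζ := ζ) (by simpa using hζ)
    simpa using this
  have key := moments_bound (ι := ℝ) hR0 hΨ (fun k y => Finsupp.linearCombination ℝ (u y) (v k))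
    (fun k => ((v k n0 : ℝ) : ℂ)) (fun y => (I * ((y:ℂ)⁻¹ - y))⁻¹) (nhdsWithin 0 (Ioi 0)) ?_ ?_ ?_ ?_ ?_
  · intro ρ hρ
    obtain ⟨C, hC⟩ := key ρ hρ
    refine ⟨C, fun k => ?_⟩
    have := hC k
    rwa [Complex.norm_real, Real.norm_eq_abs] at this
  · have t : Tendsto (fun y : ℝ => -(((y / (1 - y^2) : ℝ)) : ℂ) * I) (nhdsWithin 0 (Ioi 0)) (nhds 0) := by
      have : ContinuousAt (fun y : ℝ => -(((y / (1 - y^2) : ℝ)) : ℂ) * I) 0 := by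
        refine ContinuousAt.mul (ContinuousAt.neg ?_) continuousAt_const
        refine Complex.continuous_ofReal.continuousAt.comp ?_
        exact ContinuousAt.div (by fun_prop) (by fun_prop) (by norm_num)
      have := this.tendsto
      simp at this
      refine tendsto_nhdsWithin_of_tendsto_nhds ?_
      simpa using this
    refine t.congr' ?_
    filter_upwards [ev, ev4] with y hy hy1
    push_cast
    have h1 : (y:ℂ) ≠ 0 := by exact_mod_cast hy.ne'
    have h2 : (1 - (y:ℂ)^2) ≠ 0 := by
      have : (1 - y^2) ≠ 0 := by nlinarith
      exact_mod_cast this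
    have h3 : I * ((y:ℂ)⁻¹ - y) = I * ((1 - (y:ℂ)^2) / y) := by field_simp
    rw [h3, mul_inv, inv_I, inv_div]; ring
  · filter_upwards [ev, ev4] with y hy hy1
    apply inv_ne_zero
    refine mul_ne_zero I_ne_zero ?_
    have : y⁻¹ - y ≠ 0 := by
      have h1 : 4 < y⁻¹ := by rw [lt_inv_comm₀ (by norm_num) hy]; linarith
      intro h; linarith
    exact_mod_cast this
  · intro k
    filter_upwards [ev, ev4] with y hy hy1
    have hz : I * ((y:ℂ)⁻¹ - y) ≠ 0 := by
      refine mul_ne_zero I_ne_zero ?_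
      have : y⁻¹ - y ≠ 0 := by
        have h1 : 4 < y⁻¹ := by rw [lt_inv_comm₀ (by norm_num) hy]; linarith
        intro h; linarith
      exact_mod_cast this
    have e1 : Finsupp.linearCombination ℝ (u y) (v (k+1)) = (I * ((y:ℂ)⁻¹ - y)) *
        Finsupp.linearCombination ℝ (u y) (v k) + v k n0 := by
      have : v (k+1) = T0 a b (v k) := by
        simp only [hv, pow_succ', Module.End.mul_apply]
      rw [this, lc_T0]
      have e2 : (fun n => a n • u y (n+1) + a (n-1) • u y (n-1) + b n • u y n) =
          fun n => (I * ((y:ℂ)⁻¹ - y)) * u y n + if n = n0 then 1 else 0 := by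
        ext1 n
        rw [← hu y hy n]; simp
      rw [e2]
      simp only [Finsupp.linearCombination_apply, Finsupp.sum, smul_add, Finset.sum_add_distrib,
        Finset.mul_sum]
      congr 1
      · refine Finset.sum_congr rfl fun n _ => ?_
        simp only [Complex.real_smul]; ring
      · simp only [smul_ite, smul_zero, Finset.sum_ite_eq', Finsupp.mem_support_iff]
        split_ifs with hh
        · simp
        · push Not at hh
          simp [hh]
    rw [e1, add_sub_cancel_right, inv_mul_cancel_left₀ hz]
  · intro k
    simp only [Finsupp.linearCombination_apply, Finsupp.sum]
    have : Tendsto (fun y => ∑ n ∈ (v k).support, v k n • u y n) (nhdsWithin 0 (Ioi 0))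
      (nhds (∑ n ∈ (v k).support, v k n • (0:ℂ))) := by
      refine tendsto_finsetSum _ fun n _ => ?_
      exact (hul n).const_smul (v k n)
    simpa using this
  · filter_upwards [ev, ev4, hΦy] with y hy hy1 hh
    rw [(lamZ_y hy hy1).2, hh]
    simp only [hv, pow_zero, Module.End.one_apply, Finsupp.linearCombination_single, one_smul]
    exact hu0 y hy


lemma param_diff {σ : Measure ℝ} [IsFiniteMeasure σ] {c A B : ℝ → ℂ} (hc : Measurable c)
    (hA : Measurable A) (hB : Measurable B) {K δ ε : ℝ} (hδ : 0 < δ) (hε : 0 < ε) {l0 : ℂ}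
    (hcK : ∀ᵐ t ∂σ, ‖c t‖ ≤ K) (hBK : ∀ᵐ t ∂σ, ‖B t‖ ≤ K)
    (hd : ∀ᵐ t ∂σ, ∀ l ∈ Metric.ball l0 ε, δ ≤ ‖A t + l * B t‖) :
    DifferentiableAt ℂ (fun l => ∫ t, c t * (A t + l * B t)⁻¹ ∂σ) l0 := by
  have := hasDerivAt_integral_of_dominated_loc_of_deriv_le (μ := σ) (𝕜 := ℂ)
    (F := fun l t => c t * (A t + l * B t)⁻¹)
    (F' := fun l t => c t * (-(B t) / (A t + l * B t)^2)) (x₀ := l0) (s := Metric.ball l0 ε)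
    (bound := fun _ => K * (K / δ^2)) (Metric.ball_mem_nhds _ hε) ?_ ?_ ?_ ?_ ?_ ?_
  · exact this.2.differentiableAt
  · refine Filter.Eventually.of_forall fun l => ?_
    exact Measurable.aestronglyMeasurable (by fun_prop)
  · refine Integrable.mono' (integrable_const (K * (1 / δ))) ?_ ?_
    · exact Measurable.aestronglyMeasurable (by fun_prop)
    · filter_upwards [hcK, hd] with t h1 h2
      have h3 := h2 l0 (Metric.mem_ball_self hε)
      rw [norm_mul, norm_inv]
      have h0 := norm_nonneg (c t)
      refine mul_le_mul h1 ?_ (by positivity) (h0.trans h1)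
      rw [one_div]
      exact inv_anti₀ hδ h3
  · exact Measurable.aestronglyMeasurable (by fun_prop)
  · filter_upwards [hcK, hBK, hd] with t h1 h1' h2 l hl
    have h3 := h2 l hl
    have h0 := norm_nonneg (c t)
    rw [norm_mul, norm_div, norm_neg, norm_pow]
    refine mul_le_mul h1 ?_ (by positivity) (h0.trans h1)
    exact div_le_div₀ (h0.trans h1) h1' (by positivity) (by gcongr)
  · exact integrable_const _
  · filter_upwards [hd] with t h2 l hl
    have h3 := h2 l hl
    have hne : A t + l * B t ≠ 0 := by
      intro h; rw [h, norm_zero] at h3; linarith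
    have h4 : HasDerivAt (fun l => A t + l * B t) (B t) l := by
      simpa using ((hasDerivAt_id l).mul_const (B t)).const_add (A t)
    exact (h4.inv hne).const_mul _

structure SD (R r : ℝ) (σ : Measure ℝ) : Prop where
  r0 : 0 < r
  r1 : r ≤ 1
  rR : r + 1/r = R
  fin : IsFiniteMeasure σ
  supp : ∀ᵐ t ∂σ, r < |t| ∧ |t| < 1/r
  pos : ∀ E : ℝ, R < |E| →
      0 < 1 - (∫ t : ℝ, (t^2)⁻¹ ∂σ) + ∫ t : ℝ, (t^2 + E*t + 1)⁻¹ ∂σ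

def sal (σ : Measure ℝ) : ℝ := 1 - ∫ t : ℝ, (t^2)⁻¹ ∂σ

def EE (σ : Measure ℝ) (l : ℂ) : ℂ := (↑(-(∫ t : ℝ, t⁻¹ ∂σ)) : ℂ) + (sal σ : ℂ) * l +
            ∫ t : ℝ, ((t:ℂ) - l)⁻¹ ∂σ

section SDsec

variable {R r : ℝ} {σ : Measure ℝ}

lemma SD.int_bdd (h : SD R r σ) {f : ℝ → ℂ} (hf : Measurable f) {C : ℝ}
    (hb : ∀ᵐ t ∂σ, ‖f t‖ ≤ C) : Integrable f σ := by
  have := h.fin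
  exact Integrable.mono' (integrable_const C) hf.aestronglyMeasurable hb

lemma SD.int_bddR (h : SD R r σ) {f : ℝ → ℝ} (hf : Measurable f) {C : ℝ}
    (hb : ∀ᵐ t ∂σ, ‖f t‖ ≤ C) : Integrable f σ := by
  have := h.fin
  exact Integrable.mono' (integrable_const C) hf.aestronglyMeasurable hb

lemma SD.R2 (h : SD R r σ) : 2 ≤ R := by
  have hr0 := h.r0
  rw [← h.rR]; rw [← sub_nonneg]
  have : r + 1/r - 2 = (r-1)^2 / r := by field_simp; ring
  rw [this]; positivity

/-- for `t` in the support, `t² + 1 < R |t|` -/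
lemma SD.quad (h : SD R r σ) {t : ℝ} (ht : r < |t| ∧ |t| < 1/r) : t^2 + 1 < R * |t| := by
  have hr0 := h.r0
  have h1 : r * |t| < 1 := by
    have := ht.2; rw [lt_div_iff₀ hr0] at this; linarith
  have h2 : 0 < (|t| - r) * (1 - r * |t|) := mul_pos (by linarith) (by linarith)
  have h3 : R * r = r^2 + 1 := by rw [← h.rR]; field_simp
  rw [← sq_abs]
  have h4 : 0 < r * (R * |t| - (|t|^2 + 1)) := by nlinarith
  have := (mul_pos_iff_of_pos_left hr0).1 h4
  linarith

lemma SD.quad_lower (h : SD R r σ) {t E : ℝ} (ht : r < |t| ∧ |t| < 1/r) (hE : R < |E|) :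
    r * (|E| - R) ≤ |t^2 + E*t + 1| := by
  have h1 := h.quad ht
  have h2 : |E| * |t| - (t^2+1) ≤ |t^2 + E*t + 1| := by
    rw [← abs_mul]
    have := abs_sub_abs_le_abs_sub (E*t) (-(t^2+1))
    rw [abs_neg, abs_of_pos (by positivity : 0 < t^2+1)] at this
    rw [show E*t - -(t^2+1) = t^2 + E*t + 1 by ring] at this
    exact this
  nlinarith [ht.1]

lemma SD.int_quad (h : SD R r σ) {E : ℝ} (hE : R < |E|) :
    Integrable (fun t : ℝ => (t^2 + E*t + 1)⁻¹) σ := by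
  refine h.int_bddR (C := (r * (|E| - R))⁻¹) (by fun_prop) ?_
  filter_upwards [h.supp] with t ht
  rw [norm_inv, Real.norm_eq_abs]
  exact inv_anti₀ (mul_pos h.r0 (by linarith)) (h.quad_lower ht hE)

lemma SD.al_pos (h : SD R r σ) : 0 < sal σ := by
  have hR := h.R2
  have e1 : R < |R + 1| := by rw [abs_of_pos (by linarith)]; linarith
  have e2 : R < |-(R + 1)| := by rw [abs_neg]; exact e1
  have p1 := h.pos _ e1
  have p2 := h.pos _ e2
  have : (∫ t : ℝ, (t^2 + (R+1)*t + 1)⁻¹ ∂σ) + ∫ t : ℝ, (t^2 + (-(R+1))*t + 1)⁻¹ ∂σ ≤ 0 := by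
    rw [← integral_add (h.int_quad e1) (h.int_quad e2)]
    apply integral_nonpos_of_ae
    filter_upwards [h.supp] with t ht
    have q := h.quad ht
    have n1 := h.quad_lower ht e1
    have n2 := h.quad_lower ht e2
    have hr : 0 < r * (|R+1| - R) := mul_pos h.r0 (by linarith)
    have hr' : 0 < r * (|-(R+1)| - R) := mul_pos h.r0 (by linarith)
    have m1 : t^2 + (R+1)*t + 1 ≠ 0 := fun h0 => by rw [h0, abs_zero] at n1; linarith
    have m2 : t^2 + (-(R+1))*t + 1 ≠ 0 := fun h0 => by rw [h0, abs_zero] at n2; linarith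
    show (t^2 + (R+1)*t + 1)⁻¹ + (t^2 + (-(R+1))*t + 1)⁻¹ ≤ 0
    rw [inv_add_inv m1 m2]
    apply div_nonpos_of_nonneg_of_nonpos
    · nlinarith [sq_nonneg t]
    · have : (t^2 + (R+1)*t + 1) * (t^2 + (-(R+1))*t + 1) = (t^2+1)^2 - (R+1)^2 * |t|^2 := by
        rw [sq_abs]; ring
      rw [this]
      have h0 := abs_nonneg t
      have : t^2 + 1 ≤ (R+1) * |t| := by nlinarith
      nlinarith [sq_nonneg t]
  unfold sal
  linarith

lemma SD.ne_of (h : SD R r σ) {t : ℝ} (ht : r < |t| ∧ |t| < 1/r) : (t:ℂ) ≠ 0 := by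
  have := h.r0
  intro h0
  have h1 : t = 0 := by exact_mod_cast h0
  rw [h1, abs_zero] at ht
  linarith [ht.1]

/-- integrability of the Cauchy kernel -/
lemma SD.int_cauchy (h : SD R r σ) {l : ℂ} {δ : ℝ} (hδ : 0 < δ)
    (hb : ∀ᵐ t : ℝ ∂σ, δ ≤ ‖(t:ℂ) - l‖) : Integrable (fun t : ℝ => ((t:ℂ) - l)⁻¹) σ := by
  refine h.int_bdd (C := δ⁻¹) (by fun_prop) ?_
  filter_upwards [hb] with t ht
  rw [norm_inv]
  exact inv_anti₀ hδ ht

lemma SD.int_inv (h : SD R r σ) : Integrable (fun t : ℝ => t⁻¹) σ := by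
  refine h.int_bddR (C := r⁻¹) (by fun_prop) ?_
  filter_upwards [h.supp] with t ht
  rw [norm_inv, Real.norm_eq_abs]
  exact inv_anti₀ h.r0 ht.1.le

lemma SD.int_inv2 (h : SD R r σ) : Integrable (fun t : ℝ => (t^2)⁻¹) σ := by
  refine h.int_bddR (C := (r^2)⁻¹) (by fun_prop) ?_
  filter_upwards [h.supp] with t ht
  have := h.r0
  rw [norm_inv, norm_pow, Real.norm_eq_abs]
  exact inv_anti₀ (by positivity) (by gcongr; exact ht.1.le)

lemma im_lower {l : ℂ} (t : ℝ) : |l.im| ≤ ‖(t:ℂ) - l‖ := by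
  have := abs_im_le_norm ((t:ℂ) - l)
  simpa using this

lemma SD.EE_im (h : SD R r σ) {l : ℂ} (hl : l.im ≠ 0) :
    ∃ c : ℝ, 0 < c ∧ (EE σ l).im = c * l.im := by
  have hi : Integrable (fun t : ℝ => ((t:ℂ) - l)⁻¹) σ :=
    h.int_cauchy (abs_pos.2 hl) (Filter.Eventually.of_forall fun t => im_lower t)
  refine ⟨sal σ + ∫ t : ℝ, (normSq ((t:ℂ) - l))⁻¹ ∂σ, ?_, ?_⟩
  · have : 0 ≤ ∫ t : ℝ, (normSq ((t:ℂ) - l))⁻¹ ∂σ := integral_nonneg fun t => by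
      have := normSq_nonneg ((t:ℂ) - l)
      positivity
    linarith [h.al_pos]
  · have e1 : (∫ t : ℝ, ((t:ℂ) - l)⁻¹ ∂σ).im = ∫ t : ℝ, (((t:ℂ) - l)⁻¹).im ∂σ :=
      (Complex.imCLM.integral_comp_comm hi).symm
    have e2 : (∫ t : ℝ, (((t:ℂ) - l)⁻¹).im ∂σ) = (∫ t : ℝ, (normSq ((t:ℂ) - l))⁻¹ ∂σ) * l.im := by
      rw [← integral_mul_const]
      congr 1
      ext t
      rw [inv_im]; simp; ring
    unfold EE
    rw [add_im, add_im, ofReal_im, im_ofReal_mul, e1, e2]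
    ring

lemma SD.EE_conj (l : ℂ) : EE σ ((starRingEnd ℂ) l) = (starRingEnd ℂ) (EE σ l) := by
  unfold EE
  rw [map_add, map_add, map_mul, conj_ofReal, conj_ofReal, ← integral_conj]
  congr 2
  ext t
  simp

lemma SD.EE_herg (h : SD R r σ) : IsHerglotz (EE σ) := by
  have := h.fin
  constructor
  · intro l hl
    have hl' : 0 < l.im := hl
    apply DifferentiableAt.differentiableWithinAt
    have := param_diff (σ := σ) (c := fun _ => 1) (A := fun t => (t:ℂ)) (B := fun _ => -1) (K := 1)
      (l0 := l) (by fun_prop) (by fun_prop) (by fun_prop) (half_pos hl') (half_pos hl')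
      (by simp) (by simp) (Filter.Eventually.of_forall fun t l' hl'' => by
        have h1 := im_lower (l := l') t
        rw [Metric.mem_ball, dist_eq_norm] at hl''
        have h2 := (abs_im_le_norm (l' - l)).trans_lt hl''
        rw [sub_im, abs_lt] at h2
        rw [show (t:ℂ) + l' * (-1) = t - l' by ring]
        have h3 := le_abs_self l'.im
        linarith)
    unfold EE
    refine DifferentiableAt.add (by fun_prop) ?_
    refine this.congr_of_eventuallyEq (Filter.Eventually.of_forall fun l' => ?_)
    show _ = ∫ t : ℝ, 1 * ((t:ℂ) + l' * (-1))⁻¹ ∂σ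
    refine integral_congr_ae (Filter.Eventually.of_forall fun t => ?_)
    beta_reduce
    rw [one_mul, mul_neg_one, ← sub_eq_add_neg]
  · intro l hl
    obtain ⟨c, hc, e⟩ := h.EE_im hl.ne'
    rw [e]; positivity

def gg (σ : Measure ℝ) (l : ℂ) : ℂ := sal σ + ∫ t : ℝ, (t:ℂ)⁻¹ * ((t:ℂ) - l)⁻¹ ∂σ
def hh (σ : Measure ℝ) (l : ℂ) : ℂ := sal σ - (∫ t : ℝ, t⁻¹ ∂σ : ℝ) * l +
  l^2 * ∫ t : ℝ, ((t:ℂ) * l - 1)⁻¹ ∂σ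

lemma SD.ball_lower (h : SD R r σ) {l : ℂ} {t : ℝ} (ht : r < |t| ∧ |t| < 1/r) :
    r - ‖l‖ ≤ ‖(t:ℂ) - l‖ := by
  have := norm_sub_norm_le (t:ℂ) l
  rw [Complex.norm_real, Real.norm_eq_abs] at this
  linarith [ht.1]

lemma SD.ball_lower2 (h : SD R r σ) {l : ℂ} {t : ℝ} (ht : r < |t| ∧ |t| < 1/r) :
    1 - ‖l‖/r ≤ ‖(t:ℂ) * l - 1‖ := by
  have := norm_sub_norm_le (1:ℂ) (t * l)
  rw [norm_mul, Complex.norm_real, Real.norm_eq_abs, norm_one, norm_sub_rev] at this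
  have h2 : |t| * ‖l‖ ≤ 1/r * ‖l‖ := by gcongr; exact ht.2.le
  rw [div_mul_eq_mul_div, one_mul] at h2
  linarith

lemma SD.gg_diff (h : SD R r σ) : DifferentiableOn ℂ (gg σ) (Metric.ball 0 r) := by
  have := h.fin
  intro l hl
  have hl' : ‖l‖ < r := by simpa using hl
  apply DifferentiableAt.differentiableWithinAt
  have := param_diff (σ := σ) (c := fun t => (t:ℂ)⁻¹) (A := fun t => (t:ℂ)) (B := fun _ => -1)
    (K := max 1 r⁻¹) (δ := (r - ‖l‖)/2) (ε := (r - ‖l‖)/2) (l0 := l) (by fun_prop) (by fun_prop) (by fun_prop)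
    (by linarith) (by linarith) (by
      filter_upwards [h.supp] with t ht
      rw [norm_inv, Complex.norm_real, Real.norm_eq_abs]
      exact (inv_anti₀ h.r0 ht.1.le).trans (le_max_right _ _)) (by simp)
    (by
      filter_upwards [h.supp] with t ht l' hl''
      have h1 := h.ball_lower (l := l') ht
      rw [Metric.mem_ball, dist_eq_norm] at hl''
      have h2 := norm_sub_norm_le l' l
      rw [show (t:ℂ) + l' * (-1) = t - l' by ring]
      linarith)
  unfold gg
  refine DifferentiableAt.add (by fun_prop) ?_
  refine this.congr_of_eventuallyEq (Filter.Eventually.of_forall fun l' => ?_)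
  show _ = ∫ t : ℝ, (t:ℂ)⁻¹ * ((t:ℂ) + l' * (-1))⁻¹ ∂σ
  refine integral_congr_ae (Filter.Eventually.of_forall fun t => ?_)
  beta_reduce
  rw [mul_neg_one, ← sub_eq_add_neg]

lemma SD.hh_diff (h : SD R r σ) : DifferentiableOn ℂ (hh σ) (Metric.ball 0 r) := by
  have := h.fin
  have hr := h.r0
  intro l hl
  have hl' : ‖l‖ < r := by simpa using hl
  apply DifferentiableAt.differentiableWithinAt
  have hd : 0 < 1 - ‖l‖/r := by rw [sub_pos, div_lt_one hr]; exact hl'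
  have := param_diff (σ := σ) (c := fun t => 1) (A := fun t => -1) (B := fun t => (t:ℂ))
    (K := max 1 (1/r)) (δ := (1 - ‖l‖/r)/2) (ε := r * (1 - ‖l‖/r)/2) (l0 := l) (by fun_prop) (by fun_prop) (by fun_prop)
    (by linarith) (by positivity) (by simp) (by
      filter_upwards [h.supp] with t ht
      rw [Complex.norm_real, Real.norm_eq_abs]
      exact ht.2.le.trans (le_max_right _ _))
    (by
      filter_upwards [h.supp] with t ht l' hl''
      have h1 := h.ball_lower2 (l := l') ht
      rw [Metric.mem_ball, dist_eq_norm] at hl''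
      have h2 := norm_sub_norm_le l' l
      rw [show -1 + l' * (t:ℂ) = t * l' - 1 by ring]
      have h3 : ‖l'‖/r ≤ ‖l‖/r + (1 - ‖l‖/r)/2 := by
        rw [div_le_iff₀ hr, add_mul, div_mul_cancel₀ _ hr.ne']
        linarith
      linarith)
  unfold hh
  refine DifferentiableAt.add (by fun_prop) (DifferentiableAt.mul (by fun_prop) ?_)
  refine this.congr_of_eventuallyEq (Filter.Eventually.of_forall fun l' => ?_)
  show _ = ∫ t : ℝ, 1 * (-1 + l' * (t:ℂ))⁻¹ ∂σ
  refine integral_congr_ae (Filter.Eventually.of_forall fun t => ?_)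
  beta_reduce
  rw [one_mul, show -1 + l' * (t:ℂ) = t * l' - 1 by ring]

lemma SD.gg_eq (h : SD R r σ) {l : ℂ} {δ : ℝ} (hδ : 0 < δ)
    (hb : ∀ᵐ t : ℝ ∂σ, δ ≤ ‖(t:ℂ) - l‖) : EE σ l = l * gg σ l := by
  have i1 := h.int_cauchy hδ hb
  have e1 : ((∫ t : ℝ, t⁻¹ ∂σ : ℝ) : ℂ) = ∫ t : ℝ, (t:ℂ)⁻¹ ∂σ := by
    rw [← integral_complex_ofReal]; simp
  have e2 : (∫ t : ℝ, ((t:ℂ) - l)⁻¹ ∂σ) - ∫ t : ℝ, (t:ℂ)⁻¹ ∂σ =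
      l * ∫ t : ℝ, (t:ℂ)⁻¹ * ((t:ℂ) - l)⁻¹ ∂σ := by
    rw [← integral_sub i1 (by simpa using h.int_inv.ofReal (𝕜 := ℂ)), ← integral_const_mul]
    refine integral_congr_ae ?_
    filter_upwards [h.supp, hb] with t ht hb
    have h1 := h.ne_of ht
    have h2 : (t:ℂ) - l ≠ 0 := fun h0 => by rw [h0, norm_zero] at hb; linarith
    field_simp
    ring
  unfold EE gg
  rw [ofReal_neg, e1]
  linear_combination e2

lemma SD.hh_eq (h : SD R r σ) {l : ℂ} (hl : l ≠ 0) : hh σ l = l * EE σ (1/l) := by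
  have e2 : (∫ t : ℝ, ((t:ℂ) - 1/l)⁻¹ ∂σ) = l * ∫ t : ℝ, ((t:ℂ) * l - 1)⁻¹ ∂σ := by
    rw [← integral_const_mul]
    congr 1
    ext t
    rw [show (t:ℂ) - 1/l = (t * l - 1) / l by field_simp, inv_div]
    ring
  unfold EE hh
  rw [e2, ofReal_neg]
  field_simp
  ring

def NN (σ : Measure ℝ) (l : ℂ) : ℂ := hh σ l - l^2 * gg σ l

lemma SD.NN_eq (h : SD R r σ) {l : ℂ} (hl : l ≠ 0) (hlr : ‖l‖ < r) :
    NN σ l = l * (EE σ (1/l) - EE σ l) := by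
  unfold NN
  rw [h.hh_eq hl, h.gg_eq (l := l) (δ := r - ‖l‖) (by linarith) (by
    filter_upwards [h.supp] with t ht using h.ball_lower ht)]
  ring

lemma SD.NN_ne (h : SD R r σ) {l : ℂ} (hlr : ‖l‖ < r) : NN σ l ≠ 0 := by
  have hr := h.r0
  have hr1 := h.r1
  by_cases hl : l = 0
  · subst hl
    simp only [NN, hh]
    simpa using h.al_pos.ne'
  rw [h.NN_eq hl hlr]
  refine mul_ne_zero hl ?_
  by_cases him : l.im = 0
  · obtain ⟨x, rfl⟩ : ∃ x : ℝ, l = x := ⟨l.re, by apply Complex.ext <;> simp [him]⟩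
    rw [Complex.norm_real, Real.norm_eq_abs] at hlr
    have hx : x ≠ 0 := by exact_mod_cast hl
    have hE : R < |-x - 1/x| := by
      have hx0 : 0 < |x| := abs_pos.2 hx
      have e : |-x - 1/x| = |x| + 1/|x| := by
        rw [show -x - 1/x = -((x^2+1)/x) by field_simp; ring, abs_neg, abs_div,
          abs_of_pos (by positivity : 0 < x^2+1), ← sq_abs]
        field_simp
      rw [e, ← h.rR]
      rw [← sub_pos, show |x| + 1/|x| - (r + 1/r) = (r - |x|) * (1 - r * |x|) / (|x| * r) by
        field_simp; ring]
      have : r * |x| < 1 := by nlinarith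
      have : 0 < (r - |x|) * (1 - r*|x|) := mul_pos (by linarith) (by linarith)
      positivity
    have p := h.pos _ hE
    have i1 : Integrable (fun t : ℝ => ((t:ℂ) - x)⁻¹) σ := h.int_cauchy (δ := r - |x|) (by linarith) (by
      filter_upwards [h.supp] with t ht
      have := h.ball_lower (l := x) ht
      rwa [Complex.norm_real, Real.norm_eq_abs] at this)
    have i2 : Integrable (fun t : ℝ => ((t:ℂ) - 1/x)⁻¹) σ := h.int_cauchy (δ := 1/|x| - 1/r) (by
        rw [sub_pos]; exact one_div_lt_one_div_of_lt (abs_pos.2 hx) hlr) (by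
      filter_upwards [h.supp] with t ht
      have := norm_sub_norm_le (1/(x:ℂ)) t
      rw [Complex.norm_real, Real.norm_eq_abs, norm_div, Complex.norm_real, Real.norm_eq_abs, norm_one,
        norm_sub_rev] at this
      linarith [ht.2])
    have e : (∫ t : ℝ, ((t:ℂ) - 1/x)⁻¹ ∂σ) - (∫ t : ℝ, ((t:ℂ) - x)⁻¹ ∂σ) =
        (1/x - x) * ((∫ t : ℝ, (t^2 + (-x - 1/x)*t + 1)⁻¹ ∂σ : ℝ) : ℂ) := by
      rw [← integral_sub i2 i1, ← integral_complex_ofReal, ← integral_const_mul]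
      refine integral_congr_ae ?_
      filter_upwards [h.supp] with t ht
      have q := h.quad_lower ht hE
      have q0 : t^2 + (-x - 1/x)*t + 1 ≠ 0 := by
        intro h0
        rw [h0, abs_zero] at q
        have := mul_pos hr (sub_pos.2 hE)
        linarith
      have q1 : t^2 + (-x - 1/x)*t + 1 = (t - x) * (t - 1/x) := by field_simp; ring
      have q2 : (t - x) ≠ 0 ∧ (t - 1/x) ≠ 0 := by
        rw [q1] at q0; exact mul_ne_zero_iff.1 q0
      rw [q1]
      have q3 : (t:ℂ) - x ≠ 0 := by exact_mod_cast q2.1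
      have q4 : (t:ℂ) - 1/x ≠ 0 := by
        have := q2.2
        intro h0; apply this; exact_mod_cast h0
      simp only [ofReal_inv, ofReal_mul]
      show _ = (1/(x:ℂ) - x) * (((t - x : ℝ):ℂ) * ((t - 1/x : ℝ):ℂ))⁻¹
      push_cast
      rw [inv_sub_inv q4 q3, div_eq_mul_inv]
      rw [mul_comm ((t:ℂ) - x)]
      ring
    have : EE σ (1/x) - EE σ x = ((1/x - x : ℝ):ℂ) *
        ((1 - (∫ t : ℝ, (t^2)⁻¹ ∂σ) + ∫ t : ℝ, (t^2 + (-x - 1/x)*t + 1)⁻¹ ∂σ : ℝ):ℂ) := by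
      unfold EE sal
      push_cast
      linear_combination e
    rw [this]
    have h1 : (1/x - x) ≠ 0 := by
      intro h0
      have : x^2 = 1 := by field_simp at h0; linarith
      rw [← sq_abs] at this
      nlinarith [abs_nonneg x]
    exact_mod_cast mul_ne_zero h1 p.ne'
  · obtain ⟨c, hc, e⟩ := h.EE_im him
    have him2 : (1/l).im = - l.im / normSq l := by rw [one_div, inv_im]
    have hn : 0 < normSq l := normSq_pos.2 hl
    have him' : (1/l).im ≠ 0 := by
      rw [him2]; exact div_ne_zero (neg_ne_zero.2 him) hn.ne'
    obtain ⟨d, hd, e'⟩ := h.EE_im him'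
    intro h0
    have := congrArg Complex.im h0
    rw [sub_im, e, e', him2, zero_im] at this
    have h2 : l.im * (d / normSq l + c) = 0 := by linear_combination -this
    rcases mul_eq_zero.1 h2 with h3 | h3
    · exact him h3
    · have : 0 < d / normSq l + c := by positivity
      linarith

end SDsec


section SDsec2

variable {R r : ℝ} {σ : Measure ℝ}

lemma SD.gg_zero (h : SD R r σ) : gg σ 0 = 1 := by
  unfold gg sal
  have : (∫ t : ℝ, (t:ℂ)⁻¹ * ((t:ℂ) - 0)⁻¹ ∂σ) = ((∫ t : ℝ, (t^2)⁻¹ ∂σ : ℝ):ℂ) := by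
    rw [← integral_complex_ofReal]
    refine integral_congr_ae (Filter.Eventually.of_forall fun t => ?_)
    simp only [sub_zero]
    push_cast
    rw [sq, mul_inv]
  rw [this]; push_cast; ring

lemma gg_real (x : ℝ) : (gg σ x).im = 0 := by
  have : gg σ x = ((sal σ + ∫ t : ℝ, t⁻¹ * (t - x)⁻¹ ∂σ : ℝ):ℂ) := by
    unfold gg
    rw [ofReal_add, ← integral_complex_ofReal]
    simp
  rw [this, ofReal_im]

lemma hh_real (x : ℝ) : (hh σ x).im = 0 := by
  have : hh σ x = ((sal σ - (∫ t : ℝ, t⁻¹ ∂σ) * x + x^2 * ∫ t : ℝ, (t * x - 1)⁻¹ ∂σ : ℝ):ℂ) := by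
    have e : (∫ t : ℝ, ((t:ℂ) * x - 1)⁻¹ ∂σ) = ((∫ t : ℝ, (t * x - 1)⁻¹ ∂σ : ℝ) : ℂ) := by
      rw [← integral_complex_ofReal]; simp
    unfold hh
    rw [e]; push_cast; rfl
  rw [this, ofReal_im]

lemma hh_zero : hh σ 0 = sal σ := by simp [hh]

lemma SD.fclass (h : SD R r σ) : FClass (EE σ) (sal σ) := by
  have hr := h.r0
  have hnb : Metric.ball (0:ℂ) r ∈ nhds 0 := Metric.ball_mem_nhds _ hr
  have hal : (sal σ : ℂ) ≠ 0 := by exact_mod_cast h.al_pos.ne'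
  refine ⟨h.EE_herg, h.al_pos, ?_, ?_⟩
  · refine ⟨gg σ, h.gg_diff.analyticAt hnb, h.gg_zero, Filter.Eventually.of_forall gg_real, ?_⟩
    refine Filter.Eventually.of_forall fun l hl => ?_
    exact h.gg_eq hl (Filter.Eventually.of_forall fun t => (le_abs_self _).trans (im_lower t))
  · have hha : AnalyticAt ℂ (hh σ) 0 := h.hh_diff.analyticAt hnb
    have hne : hh σ (-0) ≠ 0 := by rw [neg_zero, hh_zero]; exact hal
    have hna : AnalyticAt ℂ (fun l : ℂ => hh σ (-l)) 0 := by
      refine AnalyticAt.fun_comp (g := hh σ) (f := fun l : ℂ => -l) ?_ (by fun_prop)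
      simpa using hha
    refine ⟨fun l => sal σ / hh σ (-l), analyticAt_const.div hna hne, ?_, ?_, ?_⟩
    · show _ / hh σ (-0) = _
      rw [neg_zero, hh_zero, div_self hal]
    · refine Filter.Eventually.of_forall fun x => ?_
      have e1 := hh_real (σ := σ) (-x)
      push_cast at e1
      rw [div_im, e1, ofReal_im]
      simp
    · refine Filter.Eventually.of_forall fun l hl => ?_
      have hl0 := ne_zero_of_im_pos hl
      show -(sal σ : ℂ) / EE σ (-1/l) = l * (sal σ / hh σ (-l))
      rw [h.hh_eq (neg_ne_zero.2 hl0), show 1 / (-l) = -1/l by rw [div_neg, neg_div]]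
      have : EE σ (-1/l) ≠ 0 := by
        apply ne_zero_of_im_pos
        apply h.EE_herg.2
        exact neg_inv_im hl
      field_simp

lemma SD.exists_family (h : SD R r σ) : ∃ Fs a b, Fs 0 = EE σ ∧ Family Fs a b ∧
    Finsupp.single 0 1 ∈ VV a b R ∧ Finsupp.single 1 1 ∈ VV a b R := by
  have hr := h.r0
  obtain ⟨Fs, a, b, F0, -, hF⟩ := family_exists h.fclass
  have ha : ∀ n, (a n : ℂ) ≠ 0 := fun n => by exact_mod_cast (hF.apos n).ne'
  have ev : ∀ᶠ y : ℝ in nhdsWithin 0 (Ioi 0), 0 < y := eventually_mem_nhdsWithin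
  have evr : ∀ᶠ y : ℝ in nhdsWithin 0 (Ioi 0), y < r :=
    mem_nhdsWithin_of_mem_nhds (Iio_mem_nhds hr)
  have NNd : DifferentiableOn ℂ (NN σ) (Metric.ball 0 r) := by
    unfold NN
    exact h.hh_diff.sub ((differentiableOn_pow 2).mul h.gg_diff)
  have NN0 : ∀ l ∈ Metric.ball (0:ℂ) r, NN σ l ≠ 0 := fun l hl => h.NN_ne (by simpa using hl)
  have cj : ∀ y : ℝ, 0 < y → (starRingEnd ℂ) (EE σ ((y⁻¹:ℝ) * I)) = EE σ (1 / (y * I)) := by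
    intro y hy
    rw [← SD.EE_conj]
    congr 1
    rw [map_mul, conj_ofReal, conj_I, one_div, mul_inv, inv_I]; push_cast; ring
  have dd : ∀ y : ℝ, 0 < y → y < r → NN σ (y * I) = y * I * (EE σ (1 / (y * I)) - EE σ (y * I)) := by
    intro y hy hyr
    refine h.NN_eq ?_ ?_
    · simpa using hy.ne'
    · rw [norm_mul, norm_I, mul_one, Complex.norm_real, Real.norm_eq_abs, abs_of_pos hy]; exact hyr
  refine ⟨Fs, a, b, F0, hF, ?_, ?_⟩
  · refine hF.moments 0 hr h.r1 h.rR (Φ := fun l => l / ((a 0:ℂ)^2 * NN σ l)) ?_ ?_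
    · exact differentiableOn_id.div ((differentiableOn_const _).mul NNd)
        (fun l hl => mul_ne_zero (pow_ne_zero _ (ha 0)) (NN0 l hl))
    · filter_upwards [ev, evr] with y hy hyr
      have h0 : (y:ℂ) * I ≠ 0 := by simpa using hy.ne'
      have hn := NN0 (y * I) (by
        simp only [Metric.mem_ball, dist_zero_right]
        rw [norm_mul, norm_I, mul_one, Complex.norm_real, Real.norm_eq_abs, abs_of_pos hy]; exact hyr)
      rw [F0, cj y hy]
      have h1 := dd y hy hyr
      rw [h1] at hn ⊢
      have h2 := (mul_ne_zero_iff.1 hn).2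
      generalize EE σ (1 / (y * I)) = A at *
      generalize EE σ (y * I) = B at *
      have h3 : B - A ≠ 0 := by rw [← neg_sub]; exact neg_ne_zero.2 h2
      have := ha 0
      generalize (y:ℂ) * I = l at *
      rw [← neg_sub B A]
      field_simp
  · refine hF.moments 1 hr h.r1 h.rR (Φ := fun l => l * gg σ l * hh σ l / NN σ l) ?_ ?_
    · exact ((differentiableOn_id.mul h.gg_diff).mul h.hh_diff).div NNd NN0
    · filter_upwards [ev, evr] with y hy hyr
      have h0 : (y:ℂ) * I ≠ 0 := by simpa using hy.ne'
      have hyC : (y:ℂ) ≠ 0 := by exact_mod_cast hy.ne'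
      have hnr : ‖(y:ℂ) * I‖ < r := by
        rw [norm_mul, norm_I, mul_one, Complex.norm_real, Real.norm_eq_abs, abs_of_pos hy]; exact hyr
      have hn := NN0 (y * I) (by simpa using hnr)
      have l1 : 0 < ((y : ℂ) * I).im := by simpa using hy
      have l2 : 0 < (((y⁻¹ : ℝ) : ℂ) * I).im := by simpa using hy
      have s1 := hF.strip 1 _ l1
      have s2 := congrArg (starRingEnd ℂ) (hF.strip 1 _ l2)
      rw [sub_self, F0] at s1 s2
      simp only [map_sub, map_neg, map_add, map_mul, map_div₀, map_one, map_pow, conj_I, conj_ofReal,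
        cj y hy] at s2
      have hA : EE σ (y * I) ≠ 0 := ne_zero_of_im_pos (h.EE_herg.2 _ l1)
      have hB : EE σ (1 / (y * I)) ≠ 0 := by
        rw [← cj y hy]
        simpa using ne_zero_of_im_pos (h.EE_herg.2 _ l2)
      have eg : EE σ (y * I) = y * I * gg σ (y * I) :=
        h.gg_eq l1 (Filter.Eventually.of_forall fun t => (le_abs_self _).trans (im_lower t))
      rw [h.hh_eq h0, ← eg, dd y hy hyr]
      rw [dd y hy hyr] at hn
      have h2 := (mul_ne_zero_iff.1 hn).2
      have e : (a 1 : ℂ)^2 * (Fs 1 (y * I) - (starRingEnd ℂ) (Fs 1 ((y⁻¹:ℝ) * I))) =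
          (EE σ (y * I) - EE σ (1 / (y * I))) / (EE σ (y * I) * EE σ (1 / (y * I))) := by
        have k1 : (a 1 : ℂ)^2 * Fs 1 (y * I) = -1 / EE σ (y * I) + y * I + 1 / (y * I) + b 1 := by
          linear_combination -s1
        have k2 : (a 1 : ℂ)^2 * (starRingEnd ℂ) (Fs 1 ((y⁻¹:ℝ) * I)) =
            -1 / EE σ (1 / (y * I)) + y * I + 1 / (y * I) + b 1 := by
          have k3 : 1 / ((y:ℂ) * I) = -((y⁻¹:ℝ) * I) := by
            rw [one_div, mul_inv, inv_I]; push_cast; ring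
          have k4 : (1:ℂ) / ((y⁻¹:ℝ) * -I) = y * I := by
            push_cast
            rw [one_div, mul_inv, inv_inv, inv_neg, inv_I, neg_neg]
          rw [k4] at s2
          rw [k3] at s2 ⊢
          linear_combination -s2
        rw [mul_sub, k1, k2]
        field_simp
        ring
      rw [e]
      generalize EE σ (1 / (y * I)) = A at *
      generalize EE σ (y * I) = B at *
      have h3 : B - A ≠ 0 := by rw [← neg_sub]; exact neg_ne_zero.2 h2
      generalize (y:ℂ) * I = l at *
      rw [← neg_sub B A]
      field_simp

lemma SD.existence (h : SD R r σ) : ∃ a b, MemMR R a b ∧ IsFFunction a b (EE σ) := by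
  obtain ⟨Fs, a, b, F0, hF, v0, v1⟩ := h.exists_family
  have hb := fun v => VV_bound (VV_top hF.apos v0 v1 v)
  refine ⟨a, b, ⟨hF.apos, jac_op_exists (by linarith [h.R2]) hb, hF.refl⟩, ?_⟩
  rw [← F0]
  exact hF.isF

end SDsec2


set_option maxHeartbeats 2000000 in
/-- uniqueness from vanishing boundary values -/
lemma zero_at_of_bdry {d : ℂ → ℂ} (hd : DifferentiableOn ℂ d {z : ℂ | 0 < z.im}) {B : ℝ}
    (hB : ∀ x y : ℝ, |x| ≤ 1/2 → 0 < y → y ≤ 1/2 → ‖d (x + y * I)‖ ≤ B)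
    (hlim : ∀ᵐ x : ℝ, |x| ≤ 1/2 → Tendsto (fun y : ℝ => d (x + y * I)) (nhdsWithin 0 (Ioi 0)) (nhds 0))
    {v : ℝ} (hv : 0 < v) (hv1 : v ≤ 1/10) : d (v * I) = 0 := by
  set w : ℂ := v * I with hw
  have hwim : w.im = v := by simp [hw]
  have hopen : IsOpen {z : ℂ | 0 < z.im} := isOpen_lt continuous_const Complex.continuous_im
  have hdc : ContinuousOn d {z : ℂ | 0 < z.im} := hd.continuousOn
  have hB0 : 0 ≤ B := (norm_nonneg _).trans (hB 0 (1/2) (by norm_num) (by norm_num) le_rfl)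
  -- main estimate
  have hwI : ‖w + I‖ ≤ 11/10 := by
    rw [show w + I = ((v + 1 : ℝ):ℂ) * I by rw [hw]; push_cast; ring, norm_mul, norm_I, mul_one,
      Complex.norm_real, Real.norm_eq_abs, abs_of_pos (by linarith)]
    linarith
  have key : ∀ (N : ℕ) (ε : ℝ), 0 < ε → ε < v/2 → ‖d w‖ * (1/2) ≤
      (11/10)^N * (2/v) * (∫ x in (-(1/2):ℝ)..(1/2), ‖d (x + ε * I)‖) + 8 * B * (99/100)^N := by
    intro N ε hε hεv
    set φ : ℂ → ℂ := fun z => ((w + I)/(z + I))^N with hφ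
    have hzI : ∀ z : ℂ, 0 < z.im → z + I ≠ 0 := by
      intro z hz h0
      have := congrArg Complex.im h0
      simp at this; linarith
    have hφd : DifferentiableOn ℂ φ {z : ℂ | 0 < z.im} := by
      intro z hz
      apply DifferentiableAt.differentiableWithinAt
      have h1 : DifferentiableAt ℂ (fun z : ℂ => z + I) z := by fun_prop
      exact ((differentiableAt_const (w + I)).div h1 (hzI z hz)).pow N
    have hφw : φ w = 1 := by
      simp only [hφ]
      rw [div_self (hzI w (by rw [hwim]; exact hv)), one_pow]
    set f : ℂ → ℂ := fun z => d z * φ z with hf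
    have hfd : DifferentiableOn ℂ f {z : ℂ | 0 < z.im} := hd.mul hφd
    have hwm : {z : ℂ | 0 < z.im} ∈ nhds w := hopen.mem_nhds (by rw [mem_ofPred_eq, hwim]; exact hv)
    have hk : DifferentiableOn ℂ (dslope f w) {z : ℂ | 0 < z.im} :=
      (Complex.differentiableOn_dslope hwm).2 hfd
    have hrect := Complex.integral_boundary_rect_eq_zero_of_differentiableOn (dslope f w)
      (((-(1/2) : ℝ):ℂ) + (ε:ℂ) * I) (((1/2 : ℝ):ℂ) + ((1/2:ℝ):ℂ) * I) (hk.mono (by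
        intro z hz
        rw [mem_reProdIm] at hz
        have h2 := hz.2
        simp only [add_im, ofReal_im, mul_im, I_im, I_re, ofReal_re, mul_one, mul_zero, add_zero, zero_add] at h2
        rw [uIcc_of_le (by linarith)] at h2
        exact lt_of_lt_of_le hε h2.1))
    simp only [add_im, add_re, mul_re, ofReal_im, mul_im, I_im, I_re, ofReal_re, mul_one, mul_zero,
      add_zero, zero_add, sub_zero] at hrect
    have hfc : ContinuousOn f {z : ℂ | 0 < z.im} := hfd.continuousOn
    have hγc : ∀ (γ : ℝ → ℂ) (s t : ℝ), s ≤ t → Continuous γ →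
        (∀ x ∈ Icc s t, 0 < (γ x).im ∧ γ x ≠ w) →
        IntervalIntegrable (fun x => f (γ x) * (γ x - w)⁻¹) volume s t ∧
        IntervalIntegrable (fun x => (γ x - w)⁻¹) volume s t := by
      intro γ s t hst hγ hx
      have h1 : ContinuousOn (fun x => f (γ x)) (uIcc s t) := by
        rw [uIcc_of_le hst]
        exact hfc.comp hγ.continuousOn (fun x hxx => (hx x hxx).1)
      have h2 : ContinuousOn (fun x => (γ x - w)⁻¹) (uIcc s t) := by
        rw [uIcc_of_le hst]
        exact ContinuousOn.inv₀ (by fun_prop) (fun x hxx => sub_ne_zero.2 (hx x hxx).2)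
      exact ⟨(h1.mul h2).intervalIntegrable, h2.intervalIntegrable⟩
    have side : ∀ (γ : ℝ → ℂ) (s t : ℝ), s ≤ t → Continuous γ →
        (∀ x ∈ Icc s t, 0 < (γ x).im ∧ γ x ≠ w) →
        ∫ x in s..t, dslope f w (γ x) =
          (∫ x in s..t, f (γ x) * (γ x - w)⁻¹) - d w * ∫ x in s..t, (γ x - w)⁻¹ := by
      intro γ s t hst hγ hx
      obtain ⟨h1, h2⟩ := hγc γ s t hst hγ hx
      rw [← intervalIntegral.integral_const_mul, ← intervalIntegral.integral_sub h1 (h2.const_mul _)]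
      apply intervalIntegral.integral_congr
      intro x hxx
      rw [uIcc_of_le hst] at hxx
      beta_reduce
      rw [dslope_of_ne _ (hx x hxx).2, slope_def_field]
      have : f w = d w := by simp only [hf]; rw [hφw, mul_one]
      rw [this]; field_simp
    have imside : ∀ (γ : ℝ → ℂ) (s t : ℝ) (c : ℂ), s ≤ t → Continuous γ →
        (∀ x ∈ Icc s t, 0 < (γ x).im ∧ γ x ≠ w) → (c * ∫ x in s..t, (γ x - w)⁻¹).im =
          ∫ x in s..t, (c * (γ x - w)⁻¹).im := by
      intro γ s t c hst hγ hx
      obtain ⟨h1, h2⟩ := hγc γ s t hst hγ hx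
      rw [← intervalIntegral.integral_const_mul]
      exact (Complex.imCLM.intervalIntegral_comp_comm (h2.const_mul c)).symm
    have cb : Continuous (fun x : ℝ => (x:ℂ) + (ε:ℂ) * I) := by fun_prop
    have ct : Continuous (fun x : ℝ => (x:ℂ) + ((1/2:ℝ):ℂ) * I) := by fun_prop
    have cr : Continuous (fun y : ℝ => ((1/2:ℝ):ℂ) + (y:ℂ) * I) := by fun_prop
    have cl : Continuous (fun y : ℝ => ((-(1/2):ℝ):ℂ) + (y:ℂ) * I) := by fun_prop
    have im1 : ∀ x y : ℝ, ((x:ℂ) + (y:ℂ) * I).im = y := by intro x y; simp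
    have re1 : ∀ x y : ℝ, ((x:ℂ) + (y:ℂ) * I).re = x := by intro x y; simp
    have wre : w.re = 0 := by simp [hw]
    have pb : ∀ x ∈ Icc (-(1/2):ℝ) (1/2), 0 < ((x:ℂ) + (ε:ℂ) * I).im ∧ (x:ℂ) + (ε:ℂ) * I ≠ w := by
      intro x hx
      rw [im1]
      refine ⟨hε, fun h => ?_⟩
      have := congrArg Complex.im h
      rw [im1, hwim] at this; linarith
    have pt : ∀ x ∈ Icc (-(1/2):ℝ) (1/2), 0 < ((x:ℂ) + ((1/2:ℝ):ℂ) * I).im ∧ (x:ℂ) + ((1/2:ℝ):ℂ) * I ≠ w := by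
      intro x hx
      rw [im1]
      refine ⟨by norm_num, fun h => ?_⟩
      have := congrArg Complex.im h
      rw [im1, hwim] at this; linarith
    have pr : ∀ y ∈ Icc ε (1/2), 0 < (((1/2:ℝ):ℂ) + (y:ℂ) * I).im ∧ ((1/2:ℝ):ℂ) + (y:ℂ) * I ≠ w := by
      intro x hx
      rw [im1]
      refine ⟨lt_of_lt_of_le hε hx.1, fun h => ?_⟩
      have := congrArg Complex.re h
      rw [re1, wre] at this; norm_num at this
    have pl : ∀ y ∈ Icc ε (1/2), 0 < (((-(1/2):ℝ):ℂ) + (y:ℂ) * I).im ∧ ((-(1/2):ℝ):ℂ) + (y:ℂ) * I ≠ w := by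
      intro x hx
      rw [im1]
      refine ⟨lt_of_lt_of_le hε hx.1, fun h => ?_⟩
      have := congrArg Complex.re h
      rw [re1, wre] at this; norm_num at this
    have hε2 : ε ≤ 1/2 := by linarith
    rw [side _ _ _ (by norm_num) cb pb, side _ _ _ (by norm_num) ct pt, side _ _ _ hε2 cr pr,
      side _ _ _ hε2 cl pl] at hrect
    simp only [smul_eq_mul] at hrect
    have i1 := imside _ _ _ 1 (by norm_num) cb pb
    have i2 := imside _ _ _ (-1) (by norm_num) ct pt
    have i3 := imside _ _ _ I hε2 cr pr
    have i4 := imside _ _ _ (-I) hε2 cl pl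
    have invim : ∀ z : ℂ, (z⁻¹).im = - z.im / normSq z := fun z => by rw [Complex.inv_im]
    have j1 : 0 ≤ ∫ x in (-(1/2):ℝ)..(1/2), (1 * ((x:ℂ) + (ε:ℂ) * I - w)⁻¹).im := by
      apply intervalIntegral.integral_nonneg (by norm_num)
      intro x hx
      rw [one_mul, inv_im, sub_im, im1, hwim]
      apply div_nonneg (by linarith) (normSq_nonneg _)
    have j3 : 0 ≤ ∫ y in ε..(1/2), (I * (((1/2:ℝ):ℂ) + (y:ℂ) * I - w)⁻¹).im := by
      apply intervalIntegral.integral_nonneg hε2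
      intro x hx
      rw [I_mul_im, inv_re, sub_re, re1, wre]
      apply div_nonneg (by norm_num) (normSq_nonneg _)
    have j4 : 0 ≤ ∫ y in ε..(1/2), (-I * (((-(1/2):ℝ):ℂ) + (y:ℂ) * I - w)⁻¹).im := by
      apply intervalIntegral.integral_nonneg hε2
      intro x hx
      rw [neg_mul, neg_im, I_mul_im, inv_re, sub_re, re1, wre, ← neg_div]
      apply div_nonneg (by norm_num) (normSq_nonneg _)
    have j2 : 1/2 ≤ ∫ x in (-(1/2):ℝ)..(1/2), (-1 * ((x:ℂ) + ((1/2:ℝ):ℂ) * I - w)⁻¹).im := by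
      have hc : (1/2:ℝ) = ∫ x in (-(1/2):ℝ)..(1/2), (1/2 : ℝ) := by
        rw [intervalIntegral.integral_const]; norm_num
      conv_lhs => rw [hc]
      apply intervalIntegral.integral_mono_on (by norm_num) (by simp)
      · have := ((hγc _ _ _ (by norm_num) ct pt).2.const_mul (-1))
        exact ⟨this.1.im, this.2.im⟩
      · intro x hx
        rw [neg_one_mul, neg_im, inv_im, sub_im, im1, hwim, neg_div, neg_neg]
        have hn : normSq ((x:ℂ) + ((1/2:ℝ):ℂ) * I - w) = x^2 + (1/2 - v)^2 := by
          rw [normSq_apply, sub_re, sub_im, re1, im1, hwim, wre]; ring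
        rw [hn, le_div_iff₀ (by nlinarith)]
        have : x^2 ≤ 1/4 := by nlinarith [hx.1, hx.2]
        nlinarith
    set Q : ℂ := 1 * (∫ x in (-(1/2):ℝ)..(1/2), ((x:ℂ) + (ε:ℂ) * I - w)⁻¹) +
      -1 * (∫ x in (-(1/2):ℝ)..(1/2), ((x:ℂ) + ((1/2:ℝ):ℂ) * I - w)⁻¹) +
      I * (∫ y in ε..(1/2), (((1/2:ℝ):ℂ) + (y:ℂ) * I - w)⁻¹) +
      -I * (∫ y in ε..(1/2), (((-(1/2):ℝ):ℂ) + (y:ℂ) * I - w)⁻¹) with hQ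
    have hQim : 1/2 ≤ Q.im := by
      rw [hQ, add_im, add_im, add_im, i1, i2, i3, i4]; linarith
    have hQn : 1/2 ≤ ‖Q‖ := hQim.trans ((le_abs_self _).trans (Complex.abs_im_le_norm Q))
    have hdQ : d w * Q = (∫ x in (-(1/2):ℝ)..(1/2), f ((x:ℂ) + (ε:ℂ) * I) * ((x:ℂ) + (ε:ℂ) * I - w)⁻¹)
      - (∫ x in (-(1/2):ℝ)..(1/2), f ((x:ℂ) + ((1/2:ℝ):ℂ) * I) * ((x:ℂ) + ((1/2:ℝ):ℂ) * I - w)⁻¹)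
      + I * (∫ y in ε..(1/2), f (((1/2:ℝ):ℂ) + (y:ℂ) * I) * (((1/2:ℝ):ℂ) + (y:ℂ) * I - w)⁻¹)
      - I * (∫ y in ε..(1/2), f (((-(1/2):ℝ):ℂ) + (y:ℂ) * I) * (((-(1/2):ℝ):ℂ) + (y:ℂ) * I - w)⁻¹) := by
      rw [hQ]; linear_combination -hrect
    -- bounds
    have hfar : ∀ z : ℂ, 0 < z.im → 1/4 ≤ normSq z → ‖φ z‖ ≤ (99/100)^N := by
      intro z hz h2
      simp only [hφ]
      rw [norm_pow]
      apply pow_le_pow_left₀ (norm_nonneg _)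
      rw [norm_div, div_le_iff₀ (norm_pos_iff.2 (hzI z hz))]
      have h3 : 5/4 ≤ ‖z + I‖^2 := by
        rw [← Complex.normSq_eq_norm_sq, normSq_apply]
        rw [normSq_apply] at h2
        simp only [add_re, add_im, I_re, I_im]
        nlinarith
      have h4 : (11/10:ℝ)/(99/100) ≤ ‖z + I‖ := by
        apply le_of_sq_le_sq _ (norm_nonneg _)
        norm_num at h3 ⊢; linarith
      have h5 := (div_le_iff₀ (by norm_num)).1 h4
      linarith
    have hnear : ∀ z : ℂ, 0 < z.im → ‖φ z‖ ≤ (11/10)^N := by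
      intro z hz
      simp only [hφ]
      rw [norm_pow]
      apply pow_le_pow_left₀ (norm_nonneg _)
      rw [norm_div, div_le_iff₀ (norm_pos_iff.2 (hzI z hz))]
      have h3 : 1 ≤ ‖z + I‖ := by
        refine le_trans ?_ ((le_abs_self _).trans (Complex.abs_im_le_norm (z + I)))
        simp; linarith
      linarith
    have qb : ∀ (z : ℂ) (c : ℝ), 0 < c → (c ≤ |z.re - w.re| ∨ c ≤ |z.im - w.im|) → ‖(z - w)⁻¹‖ ≤ c⁻¹ := by
      intro z c hc h
      rw [norm_inv]
      apply inv_anti₀ hc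
      rcases h with h | h
      · rw [← sub_re] at h; exact h.trans (Complex.abs_re_le_norm _)
      · rw [← sub_im] at h; exact h.trans (Complex.abs_im_le_norm _)
    have nsq : ∀ x y : ℝ, normSq ((x:ℂ) + (y:ℂ) * I) = x^2 + y^2 := by
      intro x y; rw [normSq_apply, re1, im1]; ring
    have fb : ∀ x y c : ℝ, |x| ≤ 1/2 → 0 < y → y ≤ 1/2 → 1/4 ≤ x^2 + y^2 → 0 < c →
        (c ≤ |x| ∨ c ≤ |y - v|) →
        ‖f ((x:ℂ) + (y:ℂ) * I) * ((x:ℂ) + (y:ℂ) * I - w)⁻¹‖ ≤ B * (99/100)^N * c⁻¹ := by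
      intro x y c hx hy hy2 hxy hc hcc
      have q := qb ((x:ℂ) + (y:ℂ) * I) c hc (by rw [re1, im1, wre, hwim, sub_zero]; exact hcc)
      have p := hfar ((x:ℂ) + (y:ℂ) * I) (by rw [im1]; exact hy) (by rw [nsq]; exact hxy)
      rw [norm_mul]
      simp only [hf]
      rw [norm_mul]
      have := hB x y hx hy hy2
      gcongr
    have n2 : ‖∫ x in (-(1/2):ℝ)..(1/2), f ((x:ℂ) + ((1/2:ℝ):ℂ) * I) * ((x:ℂ) + ((1/2:ℝ):ℂ) * I - w)⁻¹‖
        ≤ B * (99/100)^N * (1/4)⁻¹ * |1/2 - (-(1/2))| := by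
      apply intervalIntegral.norm_integral_le_of_norm_le_const
      intro x hx
      rw [uIoc_of_le (by norm_num)] at hx
      apply fb x (1/2) (1/4) (abs_le.2 ⟨hx.1.le, hx.2⟩) (by norm_num) le_rfl (by nlinarith) (by norm_num)
      right; rw [abs_of_pos (by linarith)]; linarith
    have n3 : ‖∫ y in ε..(1/2), f (((1/2:ℝ):ℂ) + (y:ℂ) * I) * (((1/2:ℝ):ℂ) + (y:ℂ) * I - w)⁻¹‖
        ≤ B * (99/100)^N * (1/2)⁻¹ * |1/2 - ε| := by
      apply intervalIntegral.norm_integral_le_of_norm_le_const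
      intro x hx
      rw [uIoc_of_le hε2] at hx
      apply fb (1/2) x (1/2) (by norm_num) (hε.trans hx.1) hx.2 (by nlinarith) (by norm_num)
      left; exact le_abs_self _
    have n4 : ‖∫ y in ε..(1/2), f (((-(1/2):ℝ):ℂ) + (y:ℂ) * I) * (((-(1/2):ℝ):ℂ) + (y:ℂ) * I - w)⁻¹‖
        ≤ B * (99/100)^N * (1/2)⁻¹ * |1/2 - ε| := by
      apply intervalIntegral.norm_integral_le_of_norm_le_const
      intro x hx
      rw [uIoc_of_le hε2] at hx
      apply fb (-(1/2)) x (1/2) (by norm_num) (hε.trans hx.1) hx.2 (by nlinarith) (by norm_num)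
      left; rw [abs_neg]; exact le_abs_self _
    have n1 : ‖∫ x in (-(1/2):ℝ)..(1/2), f ((x:ℂ) + (ε:ℂ) * I) * ((x:ℂ) + (ε:ℂ) * I - w)⁻¹‖ ≤
        (11/10)^N * (2/v) * (∫ x in (-(1/2):ℝ)..(1/2), ‖d (x + ε * I)‖) := by
      rw [← intervalIntegral.integral_const_mul]
      apply intervalIntegral.norm_integral_le_of_norm_le (by norm_num)
      · refine Filter.Eventually.of_forall fun x hx => ?_
        have q := qb ((x:ℂ) + (ε:ℂ) * I) (v/2) (by linarith) (by
          right; rw [im1, hwim, abs_sub_comm, abs_of_pos (by linarith)]; linarith)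
        have p := hnear ((x:ℂ) + (ε:ℂ) * I) (by rw [im1]; exact hε)
        rw [norm_mul]
        simp only [hf]
        rw [norm_mul]
        rw [inv_div] at q
        calc _ ≤ ‖d ((x:ℂ) + (ε:ℂ) * I)‖ * (11/10)^N * (2/v) := by gcongr
          _ = _ := by ring
      · apply IntervalIntegrable.const_mul
        apply ContinuousOn.intervalIntegrable
        apply ContinuousOn.norm
        exact hdc.comp cb.continuousOn (fun x _ => by rw [mem_ofPred_eq, im1]; exact hε)
    have hI : ∀ z : ℂ, ‖I * z‖ = ‖z‖ := fun z => by rw [norm_mul, norm_I, one_mul]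
    have tot : ‖d w‖ * ‖Q‖ ≤ (11/10)^N * (2/v) * (∫ x in (-(1/2):ℝ)..(1/2), ‖d (x + ε * I)‖) +
        B * (99/100)^N * (1/4)⁻¹ * |1/2 - (-(1/2))| + B * (99/100)^N * (1/2)⁻¹ * |1/2 - ε| +
        B * (99/100)^N * (1/2)⁻¹ * |1/2 - ε| := by
      rw [← norm_mul, hdQ]
      refine (norm_sub_le _ _).trans (add_le_add ?_ (by rw [hI]; exact n4))
      refine (norm_add_le _ _).trans (add_le_add ?_ (by rw [hI]; exact n3))
      exact (norm_sub_le _ _).trans (add_le_add n1 n2)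
    have hBN : 0 ≤ B * (99/100)^N := by positivity
    have hab : |1/2 - ε| ≤ 1/2 := by rw [abs_of_nonneg (by linarith)]; linarith
    have hab2 : |(1/2:ℝ) - (-(1/2))| = 1 := by norm_num
    rw [hab2] at tot
    have h6 : B * (99/100)^N * (1/2)⁻¹ * |1/2 - ε| ≤ B * (99/100)^N * (1/2)⁻¹ * (1/2) := by gcongr
    have h7 : ‖d w‖ * (1/2) ≤ ‖d w‖ * ‖Q‖ := by gcongr
    norm_num at h6 tot h7 ⊢
    linarith
  have hlimInt : Tendsto (fun ε : ℝ => ∫ x in (-(1/2):ℝ)..(1/2), ‖d (x + ε * I)‖) (nhdsWithin 0 (Ioi 0)) (nhds 0) := by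
    have : (0:ℝ) = ∫ x in (-(1/2):ℝ)..(1/2), (0:ℝ) := by simp
    suffices hs : Tendsto (fun ε : ℝ => ∫ x in (-(1/2):ℝ)..(1/2), ‖d (x + ε * I)‖) (nhdsWithin 0 (Ioi 0))
        (nhds (∫ x in (-(1/2):ℝ)..(1/2), (0:ℝ))) by rwa [← this] at hs
    have hev : ∀ᶠ ε : ℝ in nhdsWithin 0 (Ioi 0), 0 < ε ∧ ε ≤ 1/2 := by
      filter_upwards [Ioc_mem_nhdsGT (show (0:ℝ) < 1/2 by norm_num)] with ε h using h
    apply intervalIntegral.tendsto_integral_filter_of_dominated_convergence (fun _ => B)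
    · filter_upwards [hev] with ε h
      have cb : Continuous (fun x : ℝ => (x:ℂ) + (ε:ℂ) * I) := by fun_prop
      have : Continuous (fun x : ℝ => ‖d ((x:ℂ) + (ε:ℂ) * I)‖) := by
        apply Continuous.norm
        rw [← continuousOn_univ]
        exact hdc.comp cb.continuousOn (fun x _ => by rw [mem_ofPred_eq]; simp; exact h.1)
      exact this.aestronglyMeasurable
    · filter_upwards [hev] with ε h
      refine Filter.Eventually.of_forall fun x hx => ?_
      rw [uIoc_of_le (by norm_num)] at hx
      rw [norm_norm]
      exact hB x ε (abs_le.2 ⟨hx.1.le, hx.2⟩) h.1 h.2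
    · simp
    · filter_upwards [hlim] with x hx hxx
      rw [uIoc_of_le (by norm_num)] at hxx
      simpa using (hx (abs_le.2 ⟨hxx.1.le, hxx.2⟩)).norm
  have key2 : ∀ N : ℕ, ‖d w‖ * (1/2) ≤ 8 * B * (99/100)^N := by
    intro N
    have h1 : Tendsto (fun ε : ℝ => (11/10:ℝ)^N * (2/v) * (∫ x in (-(1/2):ℝ)..(1/2), ‖d (x + ε * I)‖) + 8 * B * (99/100)^N)
      (nhdsWithin 0 (Ioi 0)) (nhds ((11/10:ℝ)^N * (2/v) * 0 + 8 * B * (99/100)^N)) :=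
      (hlimInt.const_mul _).add_const _
    rw [mul_zero, zero_add] at h1
    apply ge_of_tendsto h1
    filter_upwards [Ioo_mem_nhdsGT (show (0:ℝ) < v/2 by linarith)] with ε h
    exact key N ε h.1 h.2
  have h2 : Tendsto (fun N : ℕ => 8 * B * (99/100:ℝ)^N) atTop (nhds (8 * B * 0)) :=
    (tendsto_pow_atTop_nhds_zero_of_lt_one (by norm_num) (by norm_num)).const_mul _
  have h3 := ge_of_tendsto' h2 key2
  have h4 : ‖d w‖ = 0 := le_antisymm (by linarith) (norm_nonneg _)
  exact norm_eq_zero.1 h4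

lemma zero_of_bdry {d : ℂ → ℂ} (hd : DifferentiableOn ℂ d {z : ℂ | 0 < z.im}) {B : ℝ}
    (hB : ∀ x y : ℝ, |x| ≤ 1/2 → 0 < y → y ≤ 1/2 → ‖d (x + y * I)‖ ≤ B)
    (hlim : ∀ᵐ x : ℝ, |x| ≤ 1/2 → Tendsto (fun y : ℝ => d (x + y * I)) (nhdsWithin 0 (Ioi 0)) (nhds 0))
    {z : ℂ} (hz : 0 < z.im) : d z = 0 := by
  have hopen : IsOpen {z : ℂ | 0 < z.im} := isOpen_lt continuous_const Complex.continuous_im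
  have hA : AnalyticOnNhd ℂ d {z : ℂ | 0 < z.im} := hd.analyticOnNhd hopen
  have hpre : IsPreconnected {z : ℂ | 0 < z.im} := (convex_halfSpace_im_gt 0).isPreconnected
  have hmem : (((1/20:ℝ):ℂ) * I) ∈ {z : ℂ | 0 < z.im} := by
    rw [mem_ofPred_eq]; simp
  refine hA.eqOn_zero_of_preconnected_of_frequently_eq_zero hpre hmem ?_ hz
  have ht : Tendsto (fun v : ℝ => (v:ℂ) * I) (nhdsWithin (1/20) (Ioi (1/20)))
      (nhdsWithin (((1/20:ℝ):ℂ) * I) {((1/20:ℝ):ℂ) * I}ᶜ) := by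
    apply tendsto_nhdsWithin_of_tendsto_nhds_of_eventually_within
    · have : Continuous (fun v : ℝ => (v:ℂ) * I) := by fun_prop
      exact (this.tendsto _).mono_left nhdsWithin_le_nhds
    · filter_upwards [self_mem_nhdsWithin] with v hv h
      have := congrArg Complex.im h
      simp at this
      have hv' : 1/20 < v := hv
      rw [this] at hv'; norm_num at hv'
  apply ht.frequently
  apply Filter.Eventually.frequently
  filter_upwards [Ioc_mem_nhdsGT (show (1/20:ℝ) < 1/10 by norm_num)] with v hv
  exact zero_at_of_bdry hd hB hlim (by linarith [hv.1]) hv.2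


section Opsec

/-- basis vector of the sequence space -/
def del (n : ℤ) : lp (fun _ : ℤ => ℂ) 2 := lp.single 2 n (1:ℂ)

lemma del_apply (n k : ℤ) : del n k = if k = n then 1 else 0 := by
  rw [del, lp.single_apply, Pi.single_apply]

lemma del_norm (n : ℤ) : ‖del n‖ = 1 := by
  rw [del, lp.norm_single (by norm_num)]; simp

variable {a b : ℤ → ℝ} {T : lp (fun _ : ℤ => ℂ) 2 →L[ℂ] lp (fun _ : ℤ => ℂ) 2}

lemma jac_del (hT : IsJacobiOperator a b T) (n : ℤ) :
    T (del n) = (a (n-1) : ℂ) • del (n-1) + (a n : ℂ) • del (n+1) + (b n : ℂ) • del n := by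
  apply lp.ext
  funext k
  rw [hT]
  simp only [lp.coeFn_add, lp.coeFn_smul, Pi.add_apply, Pi.smul_apply, smul_eq_mul, del_apply]
  by_cases h1 : k = n
  · subst h1
    simp [show ¬ (k = k - 1) by omega]
  by_cases h2 : k = n - 1
  · subst h2
    simp [show ¬ (n - 1 - 1 = n) by omega, show ¬ (n - 1 = n + 1) by omega]
  by_cases h3 : k = n + 1
  · subst h3
    simp [show ¬ (n + 1 + 1 = n) by omega, show ¬ (n + 1 = n - 1) by omega]
  have h4 : ¬ (k + 1 = n) := by omega
  have h5 : ¬ (k - 1 = n) := by omega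
  simp [h1, h2, h3, h4, h5]

lemma jac_bdd (hT : IsJacobiOperator a b T) {R : ℝ} (hR : ‖T‖ ≤ R) (n : ℤ) : |a n| ≤ R ∧ |b n| ≤ R := by
  have h : ∀ m, ‖T (del n) m‖ ≤ R := by
    intro m
    refine (lp.norm_apply_le_norm (by norm_num) _ _).trans ((T.le_opNorm _).trans ?_)
    rw [del_norm, mul_one]; exact hR
  constructor
  · have := h (n+1)
    rw [hT, del_apply, del_apply, del_apply, if_neg (by omega), if_pos (by omega), if_neg (by omega)] at this
    simpa using this
  · have := h n
    rw [hT, del_apply, del_apply, del_apply, if_neg (by omega), if_neg (by omega), if_pos (by omega)] at this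
    simpa using this

lemma jac_sa (hT : IsJacobiOperator a b T) : IsSelfAdjoint T := by
  rw [ContinuousLinearMap.isSelfAdjoint_iff']
  ext u n
  have h1 : ∀ (m : ℤ) (v : lp (fun _ : ℤ => ℂ) 2), inner ℂ (del m) v = v m := by
    intro m v
    rw [del, lp.inner_single_left]; simp
  rw [← h1 n, ContinuousLinearMap.adjoint_inner_right, jac_del hT, inner_add_left, inner_add_left,
    inner_smul_left, inner_smul_left, inner_smul_left, h1, h1, h1, hT]
  simp; ring

lemma jac_resolvent (hT : IsJacobiOperator a b T) {z : ℂ} (hz : 0 < z.im) : z ∈ resolventSet ℂ T := by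
  by_contra h
  have h2 : z ∈ spectrum ℂ T := h
  have := (jac_sa hT).mem_spectrum_eq_re h2
  have h3 := congrArg Complex.im this
  rw [ofReal_im] at h3; linarith

/-- diagonal resolvent entry -/
def rho (T : lp (fun _ : ℤ => ℂ) 2 →L[ℂ] lp (fun _ : ℤ => ℂ) 2) (z : ℂ) : ℂ := resolvent T z (del 0) 0

lemma rho_diff (hT : IsJacobiOperator a b T) : DifferentiableOn ℂ (rho T) {z : ℂ | 0 < z.im} := by
  intro z hz
  apply DifferentiableAt.differentiableWithinAt
  have h1 := (spectrum.hasDerivAt_resolvent_const_left (jac_resolvent hT hz)).differentiableAt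
  have h2 : DifferentiableAt ℂ (fun w => resolvent T w (del 0)) z :=
    h1.clm_apply (differentiableAt_const _)
  have h3 : rho T = fun w => (innerSL ℂ (del 0)) (resolvent T w (del 0)) := by
    funext w
    rw [innerSL_apply_apply, del, lp.inner_single_left]; simp [rho, del]
  rw [h3]
  exact (innerSL ℂ (del 0)).differentiableAt.comp z h2

lemma jac_green (hT : IsJacobiOperator a b T) (ha : ∀ n, 0 < a n) {z : ℂ} (hz : 0 < z.im) {f g : ℤ → ℂ}
    (hf : JacobiSolution a b z f) (hf2 : SquareSummableAtTop f) (hf0 : f 0 ≠ 0)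
    (hg : JacobiSolution a b z g) (hg2 : SquareSummableAtBot g) (hg0 : g 0 ≠ 0) :
    (a 0 : ℂ)^2 * (-(f 1 / ((a 0 : ℂ) * f 0)) + g 1 / ((a 0 : ℂ) * g 0)) * rho T z = 1 := by
  have ha0 : (a 0 : ℂ) ≠ 0 := by exact_mod_cast (ha 0).ne'
  set w : ℤ → ℂ := fun n => if 0 ≤ n then f n / f 0 else g n / g 0 with hw
  have hmem : Memℓp w 2 := by
    apply memℓp_gen
    have : Summable (fun n : ℤ => ‖w n‖^2) := by
      apply Summable.of_nat_of_neg
      · have h1 : (fun n : ℕ => ‖w (n:ℤ)‖^2) = fun n : ℕ => ‖f (n:ℤ)‖^2 * (‖f 0‖^2)⁻¹ := by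
          funext n
          simp only [hw]
          rw [if_pos (by omega), norm_div, div_pow, div_eq_mul_inv]
        rw [h1]; exact hf2.mul_right _
      · have h1 : (fun n : ℕ => ‖w (-(n:ℤ))‖^2) = fun n : ℕ => ‖g (-(n:ℤ))‖^2 * (‖g 0‖^2)⁻¹ := by
          funext n
          simp only [hw]
          by_cases hn : n = 0
          · subst hn
            simp only [Nat.cast_zero, neg_zero, le_refl, if_true]
            rw [div_self hf0]
            have : ‖g 0‖ ≠ 0 := norm_ne_zero_iff.2 hg0
            field_simp; simp
          · rw [if_neg (by omega), norm_div, div_pow, div_eq_mul_inv]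
        rw [h1]; exact hg2.mul_right _
    simpa using this
  set W : lp (fun _ : ℤ => ℂ) 2 := ⟨w, hmem⟩ with hW
  have hWn : ∀ n, W n = w n := fun n => rfl
  have w0 : w 0 = 1 := by simp only [hw]; simp [hf0]
  have wpos : ∀ n, 0 ≤ n → w n = f n / f 0 := fun n hn => by simp only [hw]; rw [if_pos hn]
  have wneg : ∀ n, n ≤ 0 → w n = g n / g 0 := fun n hn => by
    rcases hn.lt_or_eq with h | h
    · simp only [hw]; rw [if_neg (by omega)]
    · rw [h, w0, div_self hg0]
  set G : ℂ := (a 0 : ℂ)^2 * (-(f 1 / ((a 0 : ℂ) * f 0)) + g 1 / ((a 0 : ℂ) * g 0)) with hG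
  have heq : (algebraMap ℂ (lp (fun _ : ℤ => ℂ) 2 →L[ℂ] lp (fun _ : ℤ => ℂ) 2) z - T) W = G • del 0 := by
    apply lp.ext
    funext n
    rw [ContinuousLinearMap.sub_apply, lp.coeFn_sub, Pi.sub_apply, hT, lp.coeFn_smul, Pi.smul_apply,
      del_apply, Algebra.algebraMap_eq_smul_one, ContinuousLinearMap.smul_apply, lp.coeFn_smul, Pi.smul_apply,
      ContinuousLinearMap.one_apply, smul_eq_mul, smul_eq_mul, hWn, hWn, hWn]
    rcases lt_trichotomy n 0 with h | h | h
    · rw [if_neg (by omega), wneg n (by omega), wneg (n+1) (by omega), wneg (n-1) (by omega), mul_zero]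
      have := hg n
      field_simp
      linear_combination -this
    · subst h
      rw [if_pos rfl, w0, wpos (0+1) (by omega), wneg (0-1) (by omega)]
      have := hg 0
      rw [hG]
      norm_num at this ⊢
      field_simp
      linear_combination -(f 0) * this
    · rw [if_neg (by omega), wpos n (by omega), wpos (n+1) (by omega), wpos (n-1) (by omega), mul_zero]
      have := hf n
      field_simp
      linear_combination -this
  have hu : IsUnit (algebraMap ℂ (lp (fun _ : ℤ => ℂ) 2 →L[ℂ] lp (fun _ : ℤ => ℂ) 2) z - T) := jac_resolvent hT hz
  have h1 : W = G • resolvent T z (del 0) := by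
    rw [← ContinuousLinearMap.map_smul, ← heq, resolvent, ← ContinuousLinearMap.mul_apply,
      Ring.inverse_mul_cancel _ hu, ContinuousLinearMap.one_apply]
  have h2 := congrArg (fun u : lp (fun _ : ℤ => ℂ) 2 => u 0) h1
  simp only [lp.coeFn_smul, Pi.smul_apply, smul_eq_mul] at h2
  rw [hWn, w0] at h2
  exact h2.symm

/-- limits of square summable sequences -/
lemma ssq_tend_top {f : ℤ → ℂ} (h : SquareSummableAtTop f) : Tendsto (fun n : ℕ => f (n:ℤ)) atTop (nhds 0) := by
  have := h.tendsto_atTop_zero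
  rw [tendsto_zero_iff_norm_tendsto_zero]
  have h2 := this.sqrt
  simpa using h2

lemma ssq_tend_bot {f : ℤ → ℂ} (h : SquareSummableAtBot f) : Tendsto (fun n : ℕ => f (-(n:ℤ))) atTop (nhds 0) := by
  have := h.tendsto_atTop_zero
  rw [tendsto_zero_iff_norm_tendsto_zero]
  have h2 := this.sqrt
  simpa using h2

lemma mplus_unique {m1 m2 : ℂ → ℂ} {R : ℝ} (ha : ∀ n, 0 < a n) (hb : ∀ n, |a n| ≤ R) (h1 : IsJacobiMPlus a b m1)
    (h2 : IsJacobiMPlus a b m2) {z : ℂ} (hz : 0 < z.im) : m1 z = m2 z := by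
  obtain ⟨f, hf, hf2, hf0, e1⟩ := h1 z hz
  obtain ⟨g, hg, hg2, hg0, e2⟩ := h2 z hz
  have hW : ∀ n : ℕ, (a n : ℂ) * (f n * g (n+1) - f (n+1) * g n) = a 0 * (f 0 * g 1 - f 1 * g 0) := by
    intro n
    induction n with
    | zero => simp
    | succ k ih =>
      rw [← ih]
      have e3 := hf (k+1)
      have e4 := hg (k+1)
      push_cast
      rw [add_sub_cancel_right] at e3 e4
      linear_combination f (k+1) * e4 - g (k+1) * e3
  have ht : Tendsto (fun n : ℕ => (a n : ℂ) * (f n * g (n+1) - f (n+1) * g n)) atTop (nhds 0) := by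
    have s1 := ssq_tend_top hf2
    have s2 := ssq_tend_top hg2
    have s3 : Tendsto (fun n : ℕ => f ((n:ℤ)+1)) atTop (nhds 0) := by
      exact_mod_cast s1.comp (tendsto_add_atTop_nat 1)
    have s4 : Tendsto (fun n : ℕ => g ((n:ℤ)+1)) atTop (nhds 0) := by
      exact_mod_cast s2.comp (tendsto_add_atTop_nat 1)
    have s5 : Tendsto (fun n : ℕ => f n * g (n+1) - f (n+1) * g n) atTop (nhds 0) := by
      simpa using (s1.mul s4).sub (s3.mul s2)
    apply squeeze_zero_norm (a := fun n : ℕ => R * ‖f n * g (n+1) - f (n+1) * g n‖)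
    · intro n
      rw [norm_mul, Complex.norm_real, Real.norm_eq_abs]
      gcongr; exact hb n
    · simpa using s5.norm.const_mul R
  have h0 : (a 0 : ℂ) * (f 0 * g 1 - f 1 * g 0) = 0 := by
    refine tendsto_nhds_unique ?_ ht
    simp only [hW]; exact tendsto_const_nhds
  have ha0 : (a 0 : ℂ) ≠ 0 := by exact_mod_cast (ha 0).ne'
  have h3 := (mul_eq_zero.1 h0).resolve_left ha0
  rw [e1, e2, neg_inj, div_eq_div_iff (mul_ne_zero ha0 hf0) (mul_ne_zero ha0 hg0)]
  linear_combination -(a 0:ℂ) * h3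

/-- lower bound for the Wronskian on the left half line -/
lemma wronsk_bot {z : ℂ} {f : ℤ → ℂ} {R : ℝ} (ha : ∀ n, 0 < a n) (hb : ∀ n, |a n| ≤ R)
    (hf : JacobiSolution a b z f) (hf2 : SquareSummableAtBot f) (hz : 0 < z.im) (n : ℤ) (hn : n ≤ 0) :
    0 ≤ a (n-1) * (starRingEnd ℂ (f (n-1)) * f n).im := by
  have mono : ∀ k : ℕ, a (-(k:ℤ)-1+n) * (starRingEnd ℂ (f (-(k:ℤ)-1+n)) * f (-(k:ℤ)+n)).im ≤
      a (n-1) * (starRingEnd ℂ (f (n-1)) * f n).im := by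
    intro k
    induction k with
    | zero => simp [show -1 + n = n - 1 by ring]
    | succ k ih =>
      refine le_trans ?_ ih
      have := wronsk_im hf (-(k:ℤ)-1+n)
      rw [show -(k:ℤ)-1+n+1 = -(k:ℤ)+n by ring] at this
      rw [this]
      push_cast
      rw [show -((k:ℤ)+1)-1+n = -(k:ℤ)-1+n-1 by ring, show -((k:ℤ)+1)+n = -(k:ℤ)-1+n by ring]
      have : 0 ≤ z.im * ‖f (-(k:ℤ)-1+n)‖^2 := by positivity
      linarith
  have ht : Tendsto (fun k : ℕ => a (-(k:ℤ)-1+n) * (starRingEnd ℂ (f (-(k:ℤ)-1+n)) * f (-(k:ℤ)+n)).im) atTop (nhds 0) := by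
    have s1 := ssq_tend_bot hf2
    obtain ⟨N, hN⟩ : ∃ N : ℕ, n = -(N:ℤ) := ⟨n.natAbs, by omega⟩
    have s2 : Tendsto (fun k : ℕ => f (-(k:ℤ)+n)) atTop (nhds 0) := by
      have := s1.comp (tendsto_add_atTop_nat N)
      refine this.congr fun k => ?_
      simp only [Function.comp]
      congr 1; push_cast; omega
    have s3 : Tendsto (fun k : ℕ => f (-(k:ℤ)-1+n)) atTop (nhds 0) := by
      have := s1.comp (tendsto_add_atTop_nat (N+1))
      refine this.congr fun k => ?_
      simp only [Function.comp]
      congr 1; push_cast; omega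
    have s4 : Tendsto (fun k : ℕ => ‖f (-(k:ℤ)-1+n)‖ * ‖f (-(k:ℤ)+n)‖) atTop (nhds 0) := by
      simpa using s3.norm.mul s2.norm
    apply squeeze_zero_norm (a := fun k : ℕ => R * (‖f (-(k:ℤ)-1+n)‖ * ‖f (-(k:ℤ)+n)‖))
    · intro k
      rw [norm_mul, Real.norm_eq_abs, Real.norm_eq_abs]
      have : |(starRingEnd ℂ (f (-(k:ℤ)-1+n)) * f (-(k:ℤ)+n)).im| ≤ ‖f (-(k:ℤ)-1+n)‖ * ‖f (-(k:ℤ)+n)‖ := by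
        refine (Complex.abs_im_le_norm _).trans ?_
        rw [norm_mul, RCLike.norm_conj]
      gcongr
      · exact (abs_nonneg _).trans (hb 0)
      · exact hb _
    · simpa using s4.const_mul R
  exact le_of_tendsto' ht mono

end Opsec


lemma mminus_im {a b : ℤ → ℝ} {mm : ℂ → ℂ} {R : ℝ} (ha : ∀ n, 0 < a n) (hb : ∀ n, |a n| ≤ R)
    (hm : IsJacobiMMinus a b mm) {z : ℂ} (hz : 0 < z.im) : 0 ≤ (mm z).im := by
  obtain ⟨g, hg, hg2, hg0, e⟩ := hm z hz
  have h1 := wronsk_im hg 0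
  have h2 := wronsk_bot ha hb hg hg2 hz 0 le_rfl
  have h3 : 0 ≤ a 0 * (starRingEnd ℂ (g 0) * g (0+1)).im := by
    rw [h1]; have : 0 ≤ z.im * ‖g 0‖^2 := by positivity
    linarith
  have h4 : 0 ≤ (starRingEnd ℂ (g 0) * g 1).im := by
    rw [zero_add] at h3
    exact nonneg_of_mul_nonneg_right h3 (ha 0)
  have ha0 : (a 0 : ℂ) ≠ 0 := by exact_mod_cast (ha 0).ne'
  have h5 : mm z = (((a 0 * normSq (g 0))⁻¹ : ℝ) : ℂ) * (starRingEnd ℂ (g 0) * g 1) := by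
    rw [e]
    push_cast
    rw [Complex.normSq_eq_conj_mul_self]
    have : starRingEnd ℂ (g 0) ≠ 0 := by simpa using hg0
    field_simp
  rw [h5, im_ofReal_mul]
  exact mul_nonneg (inv_nonneg.2 (mul_nonneg (ha 0).le (normSq_nonneg _))) h4

lemma norm_inv_le_of_im {x : ℂ} {c : ℝ} (hc : 0 < c) (h : c ≤ x.im) : ‖x⁻¹‖ ≤ c⁻¹ := by
  rw [norm_inv]
  exact inv_anti₀ hc (h.trans ((le_abs_self _).trans (Complex.abs_im_le_norm x)))

lemma mminus_eq {a b : ℤ → ℝ} {R : ℝ} {T : lp (fun _ : ℤ => ℂ) 2 →L[ℂ] lp (fun _ : ℤ => ℂ) 2}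
    {mp mm M : ℂ → ℂ} (ha : ∀ n, 0 < a n)
    (hT : IsJacobiOperator a b T) (hR : ‖T‖ ≤ R)
    (h1 : IsJacobiMPlus a b mp) (h2 : IsJacobiMMinus a b mm) (h3 : ReflectionlessOn22 mp mm)
    (hM : DifferentiableOn ℂ M Omega22) (hMi : ∀ z ∈ Omega22, 0 < (M z).im)
    (hMm : ∀ z : ℂ, 0 < z.im → M z = mp z) {z : ℂ} (hz : 0 < z.im) :
    mm z = - starRingEnd ℂ (M (starRingEnd ℂ z)) := by
  have hbd : ∀ n, |a n| ≤ R := fun n => (jac_bdd hT hR n).1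
  set Mc : ℂ → ℂ := fun z => starRingEnd ℂ (M (starRingEnd ℂ z)) with hMc
  have hMd : ∀ z ∈ Omega22, DifferentiableAt ℂ M z := fun z hz => hM.differentiableAt (omega_open.mem_nhds hz)
  have hMcd : ∀ z ∈ Omega22, DifferentiableAt ℂ Mc z := by
    intro z hz
    have := (hMd _ (omega_conj hz)).conj_conj
    rw [Complex.conj_conj] at this
    exact this
  have hMci : ∀ z ∈ Omega22, (Mc z).im < 0 := by
    intro z hz
    simp only [hMc]; rw [conj_im]
    linarith [hMi _ (omega_conj hz)]
  have hmmi : ∀ z : ℂ, 0 < z.im → 0 ≤ (mm z).im := fun z hz => mminus_im ha hbd h2 hz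
  have ha0 : (a 0 : ℂ) ≠ 0 := by exact_mod_cast (ha 0).ne'
  have hgr : ∀ z : ℂ, 0 < z.im → (a 0 : ℂ)^2 * rho T z = (mp z + mm z)⁻¹ := by
    intro z hz
    obtain ⟨f, hf, hf2, hf0, e1⟩ := h1 z hz
    obtain ⟨g, hg, hg2, hg0, e2⟩ := h2 z hz
    have := jac_green hT ha hz hf hf2 hf0 hg hg2 hg0
    rw [← e1, ← e2] at this
    apply eq_inv_of_mul_eq_one_left
    linear_combination this
  set d : ℂ → ℂ := fun z => (a 0 : ℂ)^2 * rho T z - (M z - Mc z)⁻¹ with hd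
  have hne : ∀ z ∈ Omega22, M z - Mc z ≠ 0 := by
    intro z hz h0
    have := congrArg Complex.im h0
    rw [sub_im, zero_im] at this
    linarith [hMi z hz, hMci z hz]
  have hsub : ∀ z : ℂ, 0 < z.im → z ∈ Omega22 := fun z hz => omega_of_im hz.ne'
  have hdd : DifferentiableOn ℂ d {z : ℂ | 0 < z.im} := by
    apply DifferentiableOn.sub
    · exact (rho_diff hT).const_mul _
    · intro z hz
      apply DifferentiableAt.differentiableWithinAt
      exact ((hMd z (hsub z hz)).sub (hMcd z (hsub z hz))).inv (hne z (hsub z hz))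
  -- compactness
  obtain ⟨c, hc0, hc⟩ : ∃ c : ℝ, 0 < c ∧ ∀ z : ℂ, |z.re| ≤ 1/2 → |z.im| ≤ 1/2 → c ≤ (M z).im := by
    have hK : IsCompact (Icc (-(1/2):ℝ) (1/2) ×ℂ Icc (-(1/2):ℝ) (1/2)) := isCompact_Icc.reProdIm isCompact_Icc
    have hKs : Icc (-(1/2):ℝ) (1/2) ×ℂ Icc (-(1/2):ℝ) (1/2) ⊆ Omega22 := by
      intro z hz
      rw [mem_reProdIm] at hz
      right; constructor <;> linarith [hz.1.1, hz.1.2]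
    obtain ⟨z0, hz0, hmin⟩ := hK.exists_isMinOn ⟨0, by rw [mem_reProdIm]; norm_num⟩
      (Complex.continuous_im.comp_continuousOn (hM.continuousOn.mono hKs))
    refine ⟨(M z0).im, hMi z0 (hKs hz0), fun z hz1 hz2 => ?_⟩
    exact hmin (by rw [mem_reProdIm]; exact ⟨abs_le.1 hz1, abs_le.1 hz2⟩)
  have im1 : ∀ x y : ℝ, ((x:ℂ) + (y:ℂ) * I).im = y := by intro x y; simp
  have re1 : ∀ x y : ℝ, ((x:ℂ) + (y:ℂ) * I).re = x := by intro x y; simp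
  have hest : ∀ x y : ℝ, |x| ≤ 1/2 → 0 < y → y ≤ 1/2 →
      ‖(mp (x + y*I) + mm (x + y*I))⁻¹‖ ≤ c⁻¹ ∧ ‖(M (x + y*I) - Mc (x+y*I))⁻¹‖ ≤ c⁻¹ := by
    intro x y hx hy hy2
    have hzz : 0 < ((x:ℂ) + (y:ℂ) * I).im := by rw [im1]; exact hy
    have k1 := hc ((x:ℂ) + (y:ℂ) * I) (by rw [re1]; exact hx) (by rw [im1, abs_of_pos hy]; exact hy2)
    constructor
    · apply norm_inv_le_of_im hc0
      rw [add_im, ← hMm _ hzz]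
      linarith [hmmi _ hzz]
    · apply norm_inv_le_of_im hc0
      rw [sub_im]
      linarith [hMci _ (hsub _ hzz)]
  have hB : ∀ x y : ℝ, |x| ≤ 1/2 → 0 < y → y ≤ 1/2 → ‖d (x + y * I)‖ ≤ c⁻¹ + c⁻¹ := by
    intro x y hx hy hy2
    have hzz : 0 < ((x:ℂ) + (y:ℂ) * I).im := by rw [im1]; exact hy
    obtain ⟨e1, e2⟩ := hest x y hx hy hy2
    simp only [hd]
    rw [hgr _ hzz]
    exact (norm_sub_le _ _).trans (add_le_add e1 e2)
  have hlim : ∀ᵐ x : ℝ, |x| ≤ 1/2 → Tendsto (fun y : ℝ => d (x + y * I)) (nhdsWithin 0 (Ioi 0)) (nhds 0) := by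
    filter_upwards [h3] with x hx hx2
    have hxx := abs_le.1 hx2
    have hxO : (x:ℂ) ∈ Omega22 := by
      right; rw [ofReal_re]; constructor <;> linarith [hxx.1, hxx.2]
    have t1 := hx ⟨by linarith [hxx.1], by linarith [hxx.2]⟩
    have t2 : Tendsto (fun y : ℝ => (x:ℂ) + (y:ℂ) * I) (nhdsWithin 0 (Ioi 0)) (nhds (x:ℂ)) := by
      have hcc : Continuous (fun y : ℝ => (x:ℂ) + (y:ℂ) * I) := by fun_prop
      have := (hcc.tendsto 0).mono_left (nhdsWithin_le_nhds (s := Ioi 0))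
      simpa using this
    have t3 := (hMd _ hxO).continuousAt.tendsto.comp t2
    have t4 := (hMcd _ hxO).continuousAt.tendsto.comp t2
    have t5 := (Complex.continuous_conj.tendsto _).comp t1
    have t6 := (Complex.continuous_conj.tendsto _).comp t3
    have hMcx : Mc (x:ℂ) = starRingEnd ℂ (M x) := by simp only [hMc]; rw [conj_ofReal]
    have t7 : Tendsto (fun y : ℝ => mm (x + y*I) + Mc (x + y*I)) (nhdsWithin 0 (Ioi 0)) (nhds 0) := by
      have := (t5.add t4).sub t6
      rw [hMcx, map_zero, zero_add, sub_self] at this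
      refine this.congr' ?_
      filter_upwards [self_mem_nhdsWithin] with y hy
      simp only [Function.comp]
      rw [map_add, Complex.conj_conj, hMm _ (by rw [im1]; exact hy)]
      ring
    apply squeeze_zero_norm' (a := fun y : ℝ => c⁻¹ * ‖mm (x + y*I) + Mc (x + y*I)‖ * c⁻¹)
    · filter_upwards [Ioc_mem_nhdsGT (show (0:ℝ) < 1/2 by norm_num)] with y hy
      have hzz : 0 < ((x:ℂ) + (y:ℂ) * I).im := by rw [im1]; exact hy.1
      obtain ⟨e1, e2⟩ := hest x y hx2 hy.1 hy.2
      have n1 : mp (x + y*I) + mm (x + y*I) ≠ 0 := by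
        intro h0
        have := congrArg Complex.im h0
        rw [add_im, zero_im, ← hMm _ hzz] at this
        linarith [hMi _ (hsub _ hzz), hmmi _ hzz]
      have : d (x + y*I) = (mp (x + y*I) + mm (x + y*I))⁻¹ * (-(mm (x + y*I) + Mc (x + y*I))) *
          (M (x + y*I) - Mc (x+y*I))⁻¹ := by
        simp only [hd]
        rw [hgr _ hzz, inv_sub_inv n1 (hne _ (hsub _ hzz)), hMm _ hzz]
        rw [div_eq_mul_inv, mul_inv]; ring
      rw [this, norm_mul, norm_mul, norm_neg]
      gcongr
    · simpa using (t7.norm.const_mul c⁻¹).mul_const c⁻¹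
  have h0 := zero_of_bdry hdd hB hlim hz
  simp only [hd] at h0
  rw [hgr _ hz, sub_eq_zero, inv_inj, hMm _ hz] at h0
  linear_combination h0


lemma mm_shift {a b : ℤ → ℝ} {m : ℂ → ℂ} {R : ℝ} (ha : ∀ n, 0 < a n) (hb : ∀ n, |a n| ≤ R)
    (hm : IsJacobiMMinus a b m) :
    IsJacobiMMinus (fun n => a (n-1)) (fun n => b (n-1)) (fun z => (z - b 0 - (a 0:ℂ)^2 * m z)⁻¹) ∧
    ∀ z : ℂ, 0 < z.im → ‖z - b 0 - (a 0:ℂ)^2 * m z‖ ≤ R^2 / z.im := by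
  have main : ∀ z : ℂ, 0 < z.im → ∃ f : ℤ → ℂ, JacobiSolution a b z f ∧ SquareSummableAtBot f ∧ f (-1) ≠ 0 ∧
      f 0 ≠ 0 ∧ z - b 0 - (a 0:ℂ)^2 * m z = a (-1) * f (-1) / f 0 ∧
      z.im * ‖f (-1)‖ ≤ a (-1) * ‖f 0‖ := by
    intro z hz
    obtain ⟨f, hf, hf2, hf0, e⟩ := hm z hz
    have ha0 : (a 0 : ℂ) ≠ 0 := by exact_mod_cast (ha 0).ne'
    have ha1 : (a (-1) : ℂ) ≠ 0 := by exact_mod_cast (ha (-1)).ne'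
    have w1 := wronsk_im hf (-1)
    have w2 := wronsk_im hf (-2)
    have p1 := wronsk_bot ha hb hf hf2 hz (-1) (by norm_num)
    have p2 := wronsk_bot ha hb hf hf2 hz (-2) (by norm_num)
    have e0 := hf 0
    have e1 := hf (-1)
    norm_num at w1 w2 p1 p2 e0 e1
    have hne : f (-1) ≠ 0 := by
      intro h
      rw [h] at w2 e1
      simp at w2 e1
      have h2 : z.im * ‖f (-2)‖^2 ≤ 0 := by linarith
      have h3 : ‖f (-2)‖^2 ≤ 0 := by
        by_contra hc
        push Not at hc
        nlinarith [mul_pos hz hc]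
      have h4 : f (-2) = 0 := by
        have : ‖f (-2)‖ = 0 := by nlinarith [norm_nonneg (f (-2))]
        exact norm_eq_zero.1 this
      rw [h4, mul_zero, add_zero] at e1
      rcases mul_eq_zero.1 e1 with h5 | h5
      · exact ha1 h5
      · exact hf0 h5
    refine ⟨f, hf, hf2, hne, hf0, ?_, ?_⟩
    · rw [e]
      field_simp
      linear_combination -e0
    · have h1 : (starRingEnd ℂ (f (-1)) * f 0).im ≤ ‖f (-1)‖ * ‖f 0‖ := by
        refine (le_abs_self _).trans ((Complex.abs_im_le_norm _).trans ?_)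
        rw [norm_mul, RCLike.norm_conj]
      have h2 : z.im * ‖f (-1)‖^2 ≤ a (-1) * (‖f (-1)‖ * ‖f 0‖) := by
        have := mul_le_mul_of_nonneg_left h1 (ha (-1)).le
        simp at this w1
        linarith
      have h3 : 0 < ‖f (-1)‖ := norm_pos_iff.2 hne
      nlinarith
  constructor
  · intro z hz
    obtain ⟨f, hf, hf2, hne, hf0, e, _⟩ := main z hz
    refine ⟨fun n => f (n-1), ?_, ?_, by simpa using hne, ?_⟩
    · intro n
      have := hf (n-1)
      rw [show n - 1 + 1 = n + 1 - 1 by ring] at this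
      exact this
    · have := (summable_nat_add_iff 1).2 hf2
      refine this.congr fun n => ?_
      beta_reduce
      congr 3; push_cast; ring
    · beta_reduce
      rw [e, inv_div]
      norm_num
  · intro z hz
    obtain ⟨f, hf, hf2, hne, hf0, e, h⟩ := main z hz
    rw [e, norm_div, norm_mul, Complex.norm_real, Real.norm_eq_abs, abs_of_pos (ha _),
      div_le_div_iff₀ (norm_pos_iff.2 hf0) hz]
    have h1 : a (-1) ≤ R := (le_abs_self _).trans (hb _)
    have h2 : a (-1) * a (-1) ≤ R^2 := by nlinarith [ha (-1)]
    calc a (-1) * ‖f (-1)‖ * z.im = a (-1) * (z.im * ‖f (-1)‖) := by ring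
      _ ≤ a (-1) * (a (-1) * ‖f 0‖) := mul_le_mul_of_nonneg_left h (ha _).le
      _ = (a (-1) * a (-1)) * ‖f 0‖ := by ring
      _ ≤ _ := by gcongr

lemma mm_det0 {a b a' b' : ℤ → ℝ} {m : ℂ → ℂ} {R : ℝ} (ha : ∀ n, 0 < a n) (hb : ∀ n, |a n| ≤ R)
    (ha' : ∀ n, 0 < a' n) (hb' : ∀ n, |a' n| ≤ R)
    (hm : IsJacobiMMinus a b m) (hm' : IsJacobiMMinus a' b' m) : a 0 = a' 0 ∧ b 0 = b' 0 := by
  have h1 := (mm_shift ha hb hm).2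
  have h2 := (mm_shift ha' hb' hm').2
  set C : ℝ := 2 * R^4 with hC
  have key : ∀ y : ℝ, 0 < y → |a' 0^2 - a 0^2| * y ≤ C / y ∧ |a' 0^2 * b 0 - a 0^2 * b' 0| ≤ C / y := by
    intro y hy
    have hz : 0 < ((y:ℂ) * I).im := by simpa using hy
    have k1 := h1 _ hz
    have k2 := h2 _ hz
    have him : ((y:ℂ) * I).im = y := by simp
    rw [him] at k1 k2
    set X : ℂ := ((a' 0^2 - a 0^2 : ℝ):ℂ) * (y * I) - ((a' 0^2 * b 0 - a 0^2 * b' 0 : ℝ):ℂ) with hX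
    have hXe : X = ((a' 0^2:ℝ):ℂ) * ((y:ℂ) * I - b 0 - (a 0:ℂ)^2 * m (y * I)) -
        ((a 0^2:ℝ):ℂ) * ((y:ℂ) * I - b' 0 - (a' 0:ℂ)^2 * m (y * I)) := by
      rw [hX]; push_cast; ring
    have q1 : a 0^2 ≤ R^2 := sq_le_sq' (by linarith [abs_le.1 (hb 0)]) (abs_le.1 (hb 0)).2
    have q2 : a' 0^2 ≤ R^2 := sq_le_sq' (by linarith [abs_le.1 (hb' 0)]) (abs_le.1 (hb' 0)).2
    have hXn : ‖X‖ ≤ C / y := by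
      rw [hXe]
      refine (norm_sub_le _ _).trans ?_
      rw [norm_mul, norm_mul, Complex.norm_real, Complex.norm_real, Real.norm_eq_abs, Real.norm_eq_abs,
        abs_of_nonneg (sq_nonneg _), abs_of_nonneg (sq_nonneg _)]
      calc _ ≤ R^2 * (R^2/y) + R^2 * (R^2/y) := by gcongr
        _ = _ := by rw [hC]; ring
    constructor
    · have := (Complex.abs_im_le_norm X).trans hXn
      have e : X.im = (a' 0^2 - a 0^2) * y := by
        rw [hX, sub_im, ofReal_im, im_ofReal_mul, him, sub_zero]
      rwa [e, abs_mul, abs_of_pos hy] at this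
    · have := (Complex.abs_re_le_norm X).trans hXn
      have e : X.re = -(a' 0^2 * b 0 - a 0^2 * b' 0) := by
        rw [hX, sub_re, ofReal_re, re_ofReal_mul]; simp
      rwa [e, abs_neg] at this
  have hC0 : 0 ≤ C := by positivity
  have lim : ∀ x : ℝ, 0 ≤ x → (∀ y : ℝ, 1 ≤ y → x ≤ C / y) → x = 0 := by
    intro x hx h
    by_contra hne
    have hxp : 0 < x := lt_of_le_of_ne hx (Ne.symm hne)
    have := h (C/x + 1) (by have : 0 ≤ C/x := by positivity
                            linarith)
    rw [le_div_iff₀ (by positivity), mul_add, mul_div_cancel₀ _ hne] at this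
    linarith
  have r1 := lim _ (abs_nonneg (a' 0^2 - a 0^2)) (fun y hy => by
    refine le_trans ?_ (key y (by linarith)).1
    nlinarith [abs_nonneg (a' 0^2 - a 0^2)])
  have r2 := lim _ (abs_nonneg (a' 0^2 * b 0 - a 0^2 * b' 0)) (fun y hy => (key y (by linarith)).2)
  rw [abs_eq_zero] at r1 r2
  have e1 : a 0 = a' 0 := by nlinarith [ha 0, ha' 0]
  refine ⟨e1, ?_⟩
  rw [← e1, ← mul_sub] at r2
  rcases mul_eq_zero.1 r2 with h | h
  · exact absurd h (pow_ne_zero 2 (ha 0).ne')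
  · linarith

lemma mm_det {R : ℝ} (k : ℕ) : ∀ {a b a' b' : ℤ → ℝ} {m : ℂ → ℂ}, (∀ n, 0 < a n) → (∀ n, |a n| ≤ R) →
    (∀ n, 0 < a' n) → (∀ n, |a' n| ≤ R) →
    IsJacobiMMinus a b m → IsJacobiMMinus a' b' m → a (-k) = a' (-k) ∧ b (-k) = b' (-k) := by
  induction k with
  | zero =>
    intro a b a' b' m ha hb ha' hb' hm hm'
    simpa using mm_det0 ha hb ha' hb' hm hm'
  | succ k ih =>
    intro a b a' b' m ha hb ha' hb' hm hm'
    obtain ⟨e1, e2⟩ := mm_det0 ha hb ha' hb' hm hm'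
    have s1 := (mm_shift ha hb hm).1
    have s2 := (mm_shift ha' hb' hm').1
    rw [← e1, ← e2] at s2
    have := ih (fun n => ha (n-1)) (fun n => hb (n-1)) (fun n => ha' (n-1)) (fun n => hb' (n-1)) s1 s2
    push_cast
    rw [show -((k:ℤ)+1) = -(k:ℤ) - 1 by ring]
    exact this

lemma mp_reflect {a b : ℤ → ℝ} {m : ℂ → ℂ} (ha : ∀ n, 0 < a n) (hm : IsJacobiMPlus a b m)
    (hne : ∀ z : ℂ, 0 < z.im → m z ≠ 0) {c : ℝ} (hc : a 0 = c) :
    IsJacobiMMinus (fun n => a (-n)) (fun n => b (1-n)) (fun z => -((c:ℂ)^2 * m z)⁻¹) := by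
  subst hc
  intro z hz
  obtain ⟨f, hf, hf2, hf0, e⟩ := hm z hz
  have ha0 : (a 0 : ℂ) ≠ 0 := by exact_mod_cast (ha 0).ne'
  have hf1 : f 1 ≠ 0 := by
    intro h
    apply hne z hz
    rw [e, h]; simp
  refine ⟨fun n => f (1-n), ?_, ?_, by simpa using hf1, ?_⟩
  · intro n
    have := hf (1-n)
    beta_reduce
    rw [show -(n-1) = 1 - n by ring, show 1 - (n+1) = 1 - n - 1 by ring, show 1 - (n-1) = 1 - n + 1 by ring,
      show -n = 1 - n - 1 by ring]
    linear_combination this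
  · have := (summable_nat_add_iff 1).2 hf2
    refine this.congr fun n => ?_
    beta_reduce
    congr 3; push_cast; ring
  · beta_reduce
    rw [e]
    norm_num
    field_simp

lemma IsJacobiMMinus.congr {a b : ℤ → ℝ} {m m' : ℂ → ℂ} (h : IsJacobiMMinus a b m)
    (he : ∀ z : ℂ, 0 < z.im → m' z = m z) : IsJacobiMMinus a b m' := by
  intro z hz
  obtain ⟨f, h1, h2, h3, h4⟩ := h z hz
  exact ⟨f, h1, h2, h3, (he z hz).trans h4⟩

lemma IsJacobiMPlus.congr {a b : ℤ → ℝ} {m m' : ℂ → ℂ} (h : IsJacobiMPlus a b m)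
    (he : ∀ z : ℂ, 0 < z.im → m' z = m z) : IsJacobiMPlus a b m' := by
  intro z hz
  obtain ⟨f, h1, h2, h3, h4⟩ := h z hz
  exact ⟨f, h1, h2, h3, (he z hz).trans h4⟩

/-- data extracted from a reflectionless Jacobi matrix with given F function -/
lemma extract {R : ℝ} {a b : ℤ → ℝ} {F E : ℂ → ℂ} (h : MemMR R a b) (hF : IsFFunction a b F)
    (hE : ∀ l : ℂ, 0 < l.im → F l = E l) :
    (∀ n, 0 < a n) ∧ (∀ n, |a n| ≤ R) ∧ IsJacobiMPlus a b (fun z => E (lamU z)) ∧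
    IsJacobiMMinus a b (fun z => - starRingEnd ℂ (E (lamU (starRingEnd ℂ z)))) ∧
    (∀ z : ℂ, 0 < z.im → E (lamU z) ≠ 0) := by
  obtain ⟨ha, ⟨T, hT, hTR⟩, mp, mm, h1, h2, h3⟩ := h
  obtain ⟨mp', M, g1, hM, hMi, hMm, hFM⟩ := hF
  have hb : ∀ n, |a n| ≤ R := fun n => (jac_bdd hT hTR n).1
  have hME : ∀ z ∈ Omega22, M z = E (lamU z) := by
    intro z hz
    rw [← hE _ (lamU_im hz), hFM _ (lamU_im hz), lamU_phi hz]
  have hMm2 : ∀ z : ℂ, 0 < z.im → M z = mp z := fun z hz => by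
    rw [hMm z hz, mplus_unique ha hb g1 h1 hz]
  refine ⟨ha, hb, h1.congr fun z hz => ?_, h2.congr fun z hz => ?_, fun z hz h0 => ?_⟩
  · rw [← hME z (omega_of_im hz.ne'), hMm2 z hz]
  · rw [mminus_eq ha hT hTR h1 h2 h3 hM hMi hMm2 hz, hME _ (omega_conj (omega_of_im hz.ne'))]
  · have hz' := omega_of_im hz.ne'
    have := hMi z hz'
    rw [hME z hz', h0] at this
    simp at this

lemma jacobi_unique {R : ℝ} {a b a' b' : ℤ → ℝ} {F F' E : ℂ → ℂ} (h : MemMR R a b) (hF : IsFFunction a b F)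
    (hE : ∀ l : ℂ, 0 < l.im → F l = E l) (h' : MemMR R a' b') (hF' : IsFFunction a' b' F')
    (hE' : ∀ l : ℂ, 0 < l.im → F' l = E l) : a = a' ∧ b = b' := by
  obtain ⟨ha, hb, p, q, ne⟩ := extract h hF hE
  obtain ⟨ha', hb', p', q', _⟩ := extract h' hF' hE'
  have L := fun k : ℕ => mm_det k ha hb ha' hb' q q'
  have e0 : a' 0 = a 0 := by simpa using (L 0).1.symm
  have s := mp_reflect ha p ne rfl
  have s' := mp_reflect ha' p' ne e0
  have Rr := fun k : ℕ => mm_det k (fun n => ha (-n)) (fun n => hb (-n)) (fun n => ha' (-n))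
    (fun n => hb' (-n)) s s'
  constructor
  · funext n
    rcases le_total n 0 with hn | hn
    · obtain ⟨k, rfl⟩ : ∃ k : ℕ, n = -(k:ℤ) := ⟨n.natAbs, by omega⟩
      exact (L k).1
    · obtain ⟨k, rfl⟩ : ∃ k : ℕ, n = (k:ℤ) := ⟨n.natAbs, by omega⟩
      simpa using (Rr k).1
  · funext n
    rcases le_or_gt n 0 with hn | hn
    · obtain ⟨k, rfl⟩ : ∃ k : ℕ, n = -(k:ℤ) := ⟨n.natAbs, by omega⟩
      exact (L k).2
    · obtain ⟨k, rfl⟩ : ∃ k : ℕ, n = 1 - (-(k:ℤ)) := ⟨(n-1).natAbs, by omega⟩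
      exact (Rr k).2


/-- Theorem 3.1 (Marchenko parametrization, sufficiency): let `R ≥ 2`, `r ∈ (0,1]` with
`r + 1/r = R`, and let `σ` be a finite Borel measure supported in `(-1/r,-r) ∪ (r,1/r)`
with `1 - σ₋₂ + ∫ dσ(t)/(t² + Et + 1) > 0` for all `|E| > R`. Then there is exactly one
`J ∈ M_R` (given by its coefficient sequences `(a, b)`) whose `F` function satisfies
`F(λ) = -σ₋₁ + (1-σ₋₂)λ + ∫ dσ(t)/(t-λ)` on `ℂ⁺`. -/
theorem statement7 (R r : ℝ) (hR : 2 ≤ R) (hr0 : 0 < r) (hr1 : r ≤ 1)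
    (hrR : r + 1/r = R) (σ : Measure ℝ) (hfin : IsFiniteMeasure σ)
    (hsupp : σ ((Set.Ioo (-(1/r)) (-r) ∪ Set.Ioo r (1/r))ᶜ) = 0)
    (hpos : ∀ E : ℝ, R < |E| →
      0 < 1 - (∫ t : ℝ, (t^2)⁻¹ ∂σ) + ∫ t : ℝ, (t^2 + E*t + 1)⁻¹ ∂σ) :
    ∃! ab : (ℤ → ℝ) × (ℤ → ℝ), MemMR R ab.1 ab.2 ∧
      ∃ F : ℂ → ℂ, IsFFunction ab.1 ab.2 F ∧
        ∀ l : ℂ, 0 < l.im →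
          F l = (↑(-(∫ t : ℝ, t⁻¹ ∂σ)) : ℂ) + (↑(1 - ∫ t : ℝ, (t^2)⁻¹ ∂σ) : ℂ) * l +
            ∫ t : ℝ, ((t:ℂ) - l)⁻¹ ∂σ := by
  have hfin' := hfin
  have h : SD R r σ := by
    refine ⟨hr0, hr1, hrR, hfin, ?_, hpos⟩
    have hae : ∀ᵐ t ∂σ, t ∈ Set.Ioo (-(1/r)) (-r) ∪ Set.Ioo r (1/r) := mem_ae_iff.2 hsupp
    filter_upwards [hae] with t ht
    rcases ht with ht | ht
    · have h0 : t < 0 := by linarith [ht.2]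
      rw [abs_of_neg h0]
      exact ⟨by linarith [ht.2], by linarith [ht.1]⟩
    · have h0 : 0 < t := by linarith [ht.1]
      rw [abs_of_pos h0]
      exact ⟨ht.1, ht.2⟩
  obtain ⟨a, b, hM, hF⟩ := h.existence
  refine ⟨(a, b), ⟨hM, EE σ, hF, fun l _ => rfl⟩, ?_⟩
  rintro ⟨a', b'⟩ ⟨hM', F', hF', hE'⟩
  have := jacobi_unique (E := EE σ) hM' hF' (fun l hl => hE' l hl) hM hF (fun l _ => rfl)
  exact Prod.ext this.1 this.2
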